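/- Crossing-unitarity for the fused R-matrix: for 1 ≤ k, k' ≤ N and generic ξ ∈ ℂ, define on (ℂ^N)^{⊗k} ⊗ (ℂ^N)^{⊗k'} (first k factors labelled 1, …, k, last k' factors labelled 1', …, k') the matrix 𝒮ℛ(z) = ∏_{j=1'}^{→ k'} ∏_{i=1}^{← k} R̂_{ij}(q^{i−j−(k−k')/2} z), where R̂_{ij}(w) is R̂ evaluated at argument w (i.e. at ξ + (i−j−(k−k')/2)ζ) acting on factors i and j. Let T denote partial transposition in the first k factors. Then, assuming 𝒮ℛ(z)^{T} and 𝒮ℛ(q^N z) are invertible, one has (𝒮ℛ(z)^{T})^{−1} = (𝒮ℛ(q^N z)^{−1})^{T}. -/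

import Mathlib

open Complex Matrix Kronecker

noncomputable section

/-- `eπ x = exp(iπx)`; the variables `z, q, p` of the paper are `eπ ξ, eπ ζ, eπ (2τ)`. -/
def eπ (x : ℂ) : ℂ := Complex.exp (Real.pi * Complex.I * x)

/-- Jacobi theta function with characteristics `ϑ[γ₁,γ₂](u,τ)`. -/
def jTheta (γ₁ γ₂ : ℝ) (u τ : ℂ) : ℂ :=
  ∑' m : ℤ, Complex.exp (Real.pi * Complex.I * ((m : ℂ) + (γ₁ : ℂ)) ^ 2 * τ +
    2 * Real.pi * Complex.I * ((m : ℂ) + (γ₁ : ℂ)) * (u + (γ₂ : ℂ)))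

/-- single infinite Pochhammer symbol `(x;s)_∞`. -/
def poch1 (x s : ℂ) : ℂ := ∏' n : ℕ, (1 - x * s ^ n)

/-- double infinite Pochhammer symbol `(x;p₁,p₂)_∞`. -/
def poch2 (x p₁ p₂ : ℂ) : ℂ := ∏' n : ℕ × ℕ, (1 - x * p₁ ^ n.1 * p₂ ^ n.2)

/-- Jacobi `Θ_s(x)` function. -/
def ThetaF (s x : ℂ) : ℂ := poch1 x s * poch1 (s * x⁻¹) s * poch1 s s

/-- numerator of `1/κ(z²)`, with `z = eπ ξ`, `q = eπ ζ`, `p = eπ (2τ)`. -/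
def kappaNum (N : ℕ) (ξ ζ τ : ℂ) : ℂ :=
  poch2 (eπ (2 * N * ζ - 2 * ξ)) (eπ (2 * τ)) (eπ (2 * N * ζ)) *
  poch2 (eπ (2 * ζ + 2 * ξ)) (eπ (2 * τ)) (eπ (2 * N * ζ)) *
  poch2 (eπ (2 * τ - 2 * ξ)) (eπ (2 * τ)) (eπ (2 * N * ζ)) *
  poch2 (eπ (2 * τ + (2 * N - 2) * ζ + 2 * ξ)) (eπ (2 * τ)) (eπ (2 * N * ζ))

/-- denominator of `1/κ(z²)`: the numerator with `ξ → -ξ`. -/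
def kappaDen (N : ℕ) (ξ ζ τ : ℂ) : ℂ := kappaNum N (-ξ) ζ τ

/-- the diagonal matrix `g^{1/2}` with entries `e^{iπj/N}`, `1 ≤ j ≤ N`. -/
def gHalf (N : ℕ) : Matrix (Fin N) (Fin N) ℂ :=
  Matrix.diagonal fun j => eπ ((((j : ℕ) : ℂ) + 1) / N)

/-- the diagonal matrix `g` with entries `ω^j = e^{2iπj/N}`, `1 ≤ j ≤ N`. -/
def gMat (N : ℕ) : Matrix (Fin N) (Fin N) ℂ :=
  Matrix.diagonal fun j => eπ (2 * (((j : ℕ) : ℂ) + 1) / N)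

/-- the shift matrix `h`, `h_{jl} = δ_{j+1,l}` (mod `N`). -/
def hMat (N : ℕ) : Matrix (Fin N) (Fin N) ℂ :=
  Matrix.of fun j l => if (l : ℕ) = ((j : ℕ) + 1) % N then 1 else 0

/-- `I_{(α₁,α₂)} = g^{α₂} h^{α₁}`. -/
def Imat (N : ℕ) (α : Fin N × Fin N) : Matrix (Fin N) (Fin N) ℂ :=
  gMat N ^ (α.2 : ℕ) * hMat N ^ (α.1 : ℕ)

/-- the coefficient `W_{(α₁,α₂)}(ξ,ζ,τ)`. -/
def Wcoef (N : ℕ) (α : Fin N × Fin N) (ξ ζ τ : ℂ) : ℂ :=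
  jTheta (1/2 + (α.1 : ℕ) / N) (1/2 + (α.2 : ℕ) / N) (ξ + ζ / N) τ /
    (N * jTheta (1/2 + (α.1 : ℕ) / N) (1/2 + (α.2 : ℕ) / N) (ζ / N) τ)

/-- the matrix `𝒵(z)`, `z = eπ ξ`. -/
def Zmat (N : ℕ) (ξ ζ τ : ℂ) : Matrix (Fin N × Fin N) (Fin N × Fin N) ℂ :=
  (eπ (ξ * (2 / N - 2)) * (kappaNum N ξ ζ τ / kappaDen N ξ ζ τ) *
      jTheta (1/2) (1/2) ζ τ / jTheta (1/2) (1/2) (ξ + ζ) τ) •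
    ∑ α : Fin N × Fin N, Wcoef N α ξ ζ τ • (Imat N α ⊗ₖ (Imat N α)⁻¹)

/-- the Belavin R-matrix `R(z)`, as a function of `ξ` with `z = eπ ξ`. -/
def Rmat (N : ℕ) (ξ ζ τ : ℂ) : Matrix (Fin N × Fin N) (Fin N × Fin N) ℂ :=
  (gHalf N ⊗ₖ gHalf N) * Zmat N ξ ζ τ * (gHalf N ⊗ₖ gHalf N)⁻¹

/-- genericity: every theta-function value and κ-value appearing in a denominator is nonzero. -/
def Rgeneric (N : ℕ) (ξ ζ τ : ℂ) : Prop :=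
  jTheta (1/2) (1/2) (ξ + ζ) τ ≠ 0 ∧
  (∀ α : Fin N × Fin N,
    jTheta (1/2 + (α.1 : ℕ) / N) (1/2 + (α.2 : ℕ) / N) (ζ / N) τ ≠ 0) ∧
  kappaDen N ξ ζ τ ≠ 0

/-- the flip (permutation) operator `P` on `ℂ^N ⊗ ℂ^N`. -/
def Pflip (N : ℕ) : Matrix (Fin N × Fin N) (Fin N × Fin N) ℂ :=
  Matrix.of fun a b => if a.1 = b.2 ∧ a.2 = b.1 then 1 else 0

/-- partial transposition in the second tensor factor. -/
def pt2 {N : ℕ} (M : Matrix (Fin N × Fin N) (Fin N × Fin N) ℂ) :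
    Matrix (Fin N × Fin N) (Fin N × Fin N) ℂ :=
  Matrix.of fun a b => M (a.1, b.2) (b.1, a.2)

/-- `τ_N` evaluated at `eπ u` (all fractional powers via exponentials). -/
def tauNe (N : ℕ) (ζ u : ℂ) : ℂ :=
  eπ (u * (2 / N - 2)) * ThetaF (eπ (2 * N * ζ)) (eπ (ζ + 2 * u)) /
    ThetaF (eπ (2 * N * ζ)) (eπ (ζ - 2 * u))

/-- the normalized Belavin R-matrix `R̂(z) = τ_N(q^{1/2}z⁻¹) R(z)`, as a function of `ξ`. -/
def Rhat (N : ℕ) (ξ ζ τ : ℂ) : Matrix (Fin N × Fin N) (Fin N × Fin N) ℂ :=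
  tauNe N ζ (ζ / 2 - ξ) • Rmat N ξ ζ τ


/-- `M` acting on tensor factors `i` and `j` of a multiple tensor product and as
the identity on the remaining factors. -/
def act2 {N : ℕ} {ι : Type} [Fintype ι] [DecidableEq ι] (i j : ι)
    (M : Matrix (Fin N × Fin N) (Fin N × Fin N) ℂ) :
    Matrix (ι → Fin N) (ι → Fin N) ℂ :=
  Matrix.of fun a b =>
    (if ∀ l, l ≠ i → l ≠ j → a l = b l then 1 else 0) * M (a i, a j) (b i, b j)

/-- the fused matrix `𝒮ℛ(z) = ∏→_{j=1'..k'} ∏←_{i=1..k} R̂_{ij}(q^{i-j-(k-k')/2} z)`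
on `(ℂ^N)^{⊗k} ⊗ (ℂ^N)^{⊗k'}`, the first `k` factors being indexed by `Fin k` (via
`Sum.inl`) and the last `k'` factors by `Fin k'` (via `Sum.inr`); `z = eπ ξ`. -/
def SRmat (N k k' : ℕ) (ξ ζ τ : ℂ) :
    Matrix (Fin k ⊕ Fin k' → Fin N) (Fin k ⊕ Fin k' → Fin N) ℂ :=
  (List.ofFn fun jj : Fin k' =>
    (List.ofFn fun ii : Fin k =>
      act2 (Sum.inl ii.rev) (Sum.inr jj)
        (Rhat N (ξ + ((((ii.rev : ℕ) : ℂ) + 1) - (((jj : ℕ) : ℂ) + 1) -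
          ((k : ℂ) - (k' : ℂ)) / 2) * ζ) ζ τ)).prod).prod

/-- partial transposition `T` in the first `k` tensor factors. -/
def ptFirst {N k k' : ℕ}
    (M : Matrix (Fin k ⊕ Fin k' → Fin N) (Fin k ⊕ Fin k' → Fin N) ℂ) :
    Matrix (Fin k ⊕ Fin k' → Fin N) (Fin k ⊕ Fin k' → Fin N) ℂ :=
  Matrix.of fun a b =>
    M (Sum.elim (fun i => b (Sum.inl i)) (fun j => a (Sum.inr j)))
      (Sum.elim (fun i => a (Sum.inl i)) (fun j => b (Sum.inr j)))

theorem fcu_exists_div (H D : ℂ → ℂ) (hH : Differentiable ℂ H) (hD : Differentiable ℂ D)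
    (hs : ∀ y, D y = 0 → deriv D y ≠ 0) (h0 : ∀ y, D y = 0 → H y = 0) :
    ∃ q : ℂ → ℂ, Differentiable ℂ q ∧ ∀ y, H y = q y * D y := by
  classical
  refine ⟨fun y => if D y = 0 then deriv H y / deriv D y else H y / D y, ?_, ?_⟩
  · intro y
    by_cases hy : D y = 0
    · have hHd : DifferentiableAt ℂ (dslope H y) y := by
        have : DifferentiableOn ℂ (dslope H y) Set.univ :=
          (Complex.differentiableOn_dslope Filter.univ_mem).2 hH.differentiableOn
        exact this.differentiableAt Filter.univ_mem
      have hDd : DifferentiableAt ℂ (dslope D y) y := by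
        have : DifferentiableOn ℂ (dslope D y) Set.univ :=
          (Complex.differentiableOn_dslope Filter.univ_mem).2 hD.differentiableOn
        exact this.differentiableAt Filter.univ_mem
      have hne : dslope D y y ≠ 0 := by rw [dslope_same]; exact hs y hy
      have hq := hHd.div hDd hne
      refine hq.congr_of_eventuallyEq ?_
      filter_upwards [hDd.continuousAt.eventually_ne hne] with w hw
      by_cases hwy : w = y
      · subst hwy
        simp [hy, dslope_same]
      · have e1 : dslope D y w = (w - y)⁻¹ * D w := by
          rw [dslope_of_ne _ hwy, slope_def_field, hy]; field_simp; simp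
        have e2 : dslope H y w = (w - y)⁻¹ * H w := by
          rw [dslope_of_ne _ hwy, slope_def_field, h0 y hy]; field_simp; simp
        have hDw : D w ≠ 0 := by
          intro h; rw [e1, h] at hw; simp at hw
        have : (w - y) ≠ 0 := sub_ne_zero.2 hwy
        simp only [hDw, if_false, Pi.div_apply, e1, e2]
        field_simp
    · have hq := (hH y).div (hD y) hy
      refine hq.congr_of_eventuallyEq ?_
      filter_upwards [(hD y).continuousAt.eventually_ne hy] with w hw
      simp [hw]
  · intro y
    by_cases hy : D y = 0
    · simp [hy, h0 y hy]
    · simp [hy]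

theorem fcu_cancel (D : ℂ → ℂ) (hD : Differentiable ℂ D)
    (hs : ∀ y, D y = 0 → deriv D y ≠ 0) (q r : ℂ → ℂ) (y : ℂ) (hq : ContinuousAt q y)
    (hr : ContinuousAt r y) (h : ∀ᶠ w in nhds y, D w ≠ 0 → q w = r w) : q y = r y := by
  by_cases hy : D y = 0
  · have h1 : ∀ᶠ w in nhdsWithin y {y}ᶜ, D w ≠ 0 :=
      (hD y).hasDerivAt.eventually_ne (hs y hy)
    have h2 : q =ᶠ[nhdsWithin y {y}ᶜ] r := by
      filter_upwards [h1, h.filter_mono nhdsWithin_le_nhds] with w hw hw2 using hw2 hw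
    have t1 : Filter.Tendsto q (nhdsWithin y {y}ᶜ) (nhds (q y)) := hq.tendsto.mono_left nhdsWithin_le_nhds
    have t2 : Filter.Tendsto r (nhdsWithin y {y}ᶜ) (nhds (r y)) := hr.tendsto.mono_left nhdsWithin_le_nhds
    exact tendsto_nhds_unique (t1.congr' h2) t2
  · exact h.self_of_nhds hy

theorem fcu_liouville (τ : ℂ) (hτ : 0 < τ.im) (f : ℂ → ℂ) (hf : Differentiable ℂ f)
    (h1 : ∀ x, ‖f (x + 1)‖ = ‖f x‖) (h2 : ∀ x, ‖f (x + τ)‖ = ‖f x‖) : ∀ x y, f x = f y := by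
  have h1n : ∀ (n : ℤ) x, ‖f (x + n)‖ = ‖f x‖ := by
    intro n
    induction n using Int.induction_on with
    | zero => simp
    | succ n ih => intro x; rw [← ih x, ← h1 (x + ((n : ℤ) : ℂ))]; push_cast; ring_nf
    | pred n ih => intro x; rw [← ih x, ← h1]; push_cast; ring_nf
  have h2n : ∀ (n : ℤ) x, ‖f (x + n * τ)‖ = ‖f x‖ := by
    intro n
    induction n using Int.induction_on with
    | zero => simp
    | succ n ih => intro x; rw [← ih x, ← h2 (x + ((n : ℤ) : ℂ) * τ)]; push_cast; ring_nf
    | pred n ih => intro x; rw [← ih x, ← h2]; push_cast; ring_nf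
  have hc : IsCompact (Set.image (fun p : ℝ × ℝ => (p.1 : ℂ) + p.2 * τ) (Set.Icc 0 1 ×ˢ Set.Icc 0 1)) := by
    apply (isCompact_Icc.prod isCompact_Icc).image
    fun_prop
  obtain ⟨C, hC⟩ := (hc.image hf.continuous).isBounded.exists_norm_le
  have hb : ∀ x, ‖f x‖ ≤ C := by
    intro x
    set t : ℝ := x.im / τ.im
    set s : ℝ := (x - t * τ).re
    have hx : x = s + t * τ := by
      apply Complex.ext
      · simp [s]
      · simp [t]; field_simp
    have e : x = ((Int.fract s : ℝ) : ℂ) + ((Int.fract t : ℝ) : ℂ) * τ + (⌊s⌋ : ℤ) + (⌊t⌋ : ℤ) * τ := by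
      conv_lhs => rw [hx]
      have a1 : (s : ℂ) = ((Int.fract s : ℝ) : ℂ) + (⌊s⌋ : ℤ) := by
        exact_mod_cast (Int.fract_add_floor s).symm
      have a2 : (t : ℂ) = ((Int.fract t : ℝ) : ℂ) + (⌊t⌋ : ℤ) := by
        exact_mod_cast (Int.fract_add_floor t).symm
      linear_combination a1 + τ * a2
    rw [e, h2n, h1n]
    apply hC
    refine ⟨_, ⟨(Int.fract s, Int.fract t), ?_, rfl⟩, rfl⟩
    exact ⟨⟨Int.fract_nonneg _, (Int.fract_lt_one _).le⟩, ⟨Int.fract_nonneg _, (Int.fract_lt_one _).le⟩⟩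
  intro x y
  exact hf.apply_eq_apply_of_bounded (isBounded_iff_forall_norm_le.2 ⟨C, by rintro _ ⟨w, rfl⟩; exact hb w⟩) x y

/-- An entire function which is 1-periodic and multiplicative under `τ` with multiplier
`exp(-2πi s)` vanishes unless `s` is in the lattice. -/
theorem fcu_liouville_zero (τ : ℂ) (hτ : 0 < τ.im) (s : ℂ) (f : ℂ → ℂ) (hf : Differentiable ℂ f)
    (h1 : ∀ x, f (x + 1) = f x)
    (h2 : ∀ x, f (x + τ) = cexp (-(2 * Real.pi * I * s)) * f x)
    (hs : ∀ m n : ℤ, s ≠ m + n * τ) : ∀ x, f x = 0 := by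
  -- choose real r with  r Im τ = ... 
  set r : ℝ := s.im / τ.im
  have hg : Differentiable ℂ (fun x => cexp (2 * Real.pi * I * (r * x)) * f x) := by fun_prop
  have hconst := fcu_liouville τ hτ _ hg (by
    intro x
    simp only [h1, norm_mul]
    congr 1
    rw [Complex.norm_exp, Complex.norm_exp]
    congr 1
    simp) (by
    intro x
    simp only [h2, norm_mul]
    rw [← mul_assoc]
    congr 1
    rw [Complex.norm_exp, Complex.norm_exp, Complex.norm_exp, ← Real.exp_add]
    congr 1
    have : r * τ.im = s.im := by simp only [r]; field_simp
    simp
    linear_combination (-2 * Real.pi) * this)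
  by_contra hne
  push Not at hne
  obtain ⟨x, hx⟩ := hne
  have e1 := hconst (x + 1) x
  have e2 := hconst (x + τ) x
  simp only [h1] at e1
  simp only [h2] at e2
  rw [← mul_assoc, ← Complex.exp_add] at e2
  have e1' := mul_right_cancel₀ hx e1
  have e2' := mul_right_cancel₀ hx e2
  rw [Complex.exp_eq_exp_iff_exists_int] at e1' e2'
  obtain ⟨k, hk⟩ := e1'
  obtain ⟨l, hl⟩ := e2'
  have hpi : (2 * Real.pi * I : ℂ) ≠ 0 := Complex.two_pi_I_ne_zero
  have k1 : (r : ℂ) = k := by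
    apply mul_left_cancel₀ hpi
    linear_combination hk
  have l1 : (r : ℂ) * τ - s = l := by
    apply mul_left_cancel₀ hpi
    linear_combination hl
  apply hs (-l) k
  rw [← k1]
  push_cast
  linear_combination -l1

theorem fcu_poch1_summable (x s : ℂ) (hs : ‖s‖ < 1) : Summable fun n : ℕ => ‖-(x * s ^ n)‖ := by
  simp only [norm_neg, norm_mul, norm_pow]
  exact (summable_geometric_of_lt_one (norm_nonneg _) hs).mul_left _

theorem fcu_poch1_mult (x s : ℂ) (hs : ‖s‖ < 1) : Multipliable fun n : ℕ => (1 - x * s ^ n) := by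
  simp only [sub_eq_add_neg]
  exact multipliable_one_add_of_summable (fcu_poch1_summable x s hs)

theorem fcu_poch1_succ (x s : ℂ) (hs : ‖s‖ < 1) : poch1 x s = (1 - x) * poch1 (s * x) s := by
  unfold poch1
  have e : ∀ n : ℕ, 1 - x * s ^ (n + 1) = 1 - s * x * s ^ n := fun n => by ring
  rw [tprod_eq_zero_mul']
  · simp only [pow_zero, mul_one, e]
  · simp only [e]
    exact fcu_poch1_mult (s * x) s hs

theorem fcu_poch1_eq_zero (x s : ℂ) (hs : ‖s‖ < 1) (h : poch1 x s = 0) : ∃ n : ℕ, x * s ^ n = 1 := by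
  by_contra hn
  push Not at hn
  revert h
  unfold poch1
  simp only [sub_eq_add_neg]
  apply tprod_one_add_ne_zero_of_summable _ (fcu_poch1_summable x s hs)
  intro i hi
  apply hn i
  linear_combination -hi

theorem fcu_poch1_diff (s : ℂ) (hs : ‖s‖ < 1) : Differentiable ℂ fun x => poch1 x s := by
  have h : HasProdLocallyUniformlyOn (fun (n : ℕ) (x : ℂ) => 1 + -(x * s ^ n))
      (fun x => ∏' n : ℕ, (1 + -(x * s ^ n))) Set.univ := by
    apply hasProdLocallyUniformlyOn_of_forall_compact isOpen_univ
    intro K _ hK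
    obtain ⟨C, hC⟩ := hK.isBounded.exists_norm_le
    refine ((summable_geometric_of_lt_one (norm_nonneg s) hs).mul_left C).hasProdUniformlyOn_nat_one_add
      hK (.of_forall fun n x hx => ?_) (fun _ => by fun_prop)
    simp only [norm_neg, norm_mul, norm_pow]
    gcongr
    exact hC x hx
  have h2 := h.differentiableOn (.of_forall fun _ => by
    simpa [Finset.prod_fn] using DifferentiableOn.finsetProd (fun _ _ => by fun_prop)) isOpen_univ
  intro x
  have := h2.differentiableAt (x := x) Filter.univ_mem
  simpa only [poch1, sub_eq_add_neg] using this

theorem fcu_poch2_succ (x p s : ℂ) (hp : ‖p‖ < 1) (hs : ‖s‖ < 1) :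
    poch2 x p s = poch1 x p * poch2 (s * x) p s := by
  have hm : ∀ x, Multipliable fun n : ℕ × ℕ => (1 - x * p ^ n.1 * s ^ n.2) := by
    intro x
    simp only [sub_eq_add_neg]
    apply multipliable_one_add_of_summable
    simp only [norm_neg, norm_mul, norm_pow]
    have := ((summable_geometric_of_lt_one (norm_nonneg p) hp).mul_of_nonneg
      (summable_geometric_of_lt_one (norm_nonneg s) hs) (fun _ => by positivity) (fun _ => by positivity))
    exact (this.mul_left ‖x‖).congr (fun n => by ring)
  have key : ∀ x, HasProd (fun m : ℕ => poch1 (x * s ^ m) p) (poch2 x p s) := by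
    intro x
    have h1 : HasProd (fun n : ℕ × ℕ => (1 - x * p ^ n.2 * s ^ n.1)) (poch2 x p s) :=
      (Equiv.prodComm ℕ ℕ).hasProd_iff.2 (hm x).hasProd
    refine h1.prod_fiberwise (fun m => ?_)
    have := (fcu_poch1_mult (x * s ^ m) p hp).hasProd
    unfold poch1
    convert this using 3
    ring
  rw [← (key x).tprod_eq, ← (key (s * x)).tprod_eq]
  have e : ∀ m : ℕ, poch1 (s * x * s ^ m) p = poch1 (x * s ^ (m + 1)) p := fun m => by
    congr 1; ring
  rw [tprod_eq_zero_mul']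
  · simp [e]
  · simp only [← e]
    exact (key (s * x)).multipliable

theorem fcu_ThetaF_shift (s x : ℂ) (hs : ‖s‖ < 1) (hs0 : s ≠ 0) (hx : x ≠ 0) :
    ThetaF s (s * x) = -x⁻¹ * ThetaF s x := by
  unfold ThetaF
  rw [fcu_poch1_succ x s hs]
  have e : s * (s * x)⁻¹ = x⁻¹ := by field_simp
  rw [e, fcu_poch1_succ x⁻¹ s hs]
  field_simp
  ring

/-- product form of the odd theta function -/
noncomputable def fcuF (τ u : ℂ) : ℂ :=
  cexp (-(Real.pi * I * u)) * (poch1 (cexp (2 * Real.pi * I * u)) (cexp (2 * Real.pi * I * τ)) *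
    poch1 (cexp (2 * Real.pi * I * τ) * cexp (-(2 * Real.pi * I * u))) (cexp (2 * Real.pi * I * τ)))

theorem fcu_norm_p (τ : ℂ) (hτ : 0 < τ.im) : ‖cexp (2 * Real.pi * I * τ)‖ < 1 := by
  rw [Complex.norm_exp]
  have : 0 < Real.pi * τ.im := by positivity
  simp
  nlinarith

theorem fcuF_diff (τ : ℂ) (hτ : 0 < τ.im) : Differentiable ℂ (fcuF τ) := by
  have h := fcu_poch1_diff _ (fcu_norm_p τ hτ)
  unfold fcuF
  refine Differentiable.mul (by fun_prop) (Differentiable.mul ?_ ?_)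
  · exact h.comp (g := fun x => poch1 x (cexp (2 * Real.pi * I * τ))) (f := fun u => cexp (2 * Real.pi * I * u)) (by fun_prop)
  · exact h.comp (g := fun x => poch1 x (cexp (2 * Real.pi * I * τ)))
      (f := fun u => cexp (2 * Real.pi * I * τ) * cexp (-(2 * Real.pi * I * u))) (by fun_prop)

theorem fcuF_add_one (τ u : ℂ) : fcuF τ (u + 1) = - fcuF τ u := by
  unfold fcuF
  have e1 : cexp (2 * Real.pi * I * (u + 1)) = cexp (2 * Real.pi * I * u) := by
    rw [mul_add, Complex.exp_add, mul_one, Complex.exp_two_pi_mul_I, mul_one]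
  have e2 : cexp (-(2 * Real.pi * I * (u + 1))) = cexp (-(2 * Real.pi * I * u)) := by
    rw [Complex.exp_neg, e1, ← Complex.exp_neg]
  have e3 : cexp (-(Real.pi * I * (u + 1))) = - cexp (-(Real.pi * I * u)) := by
    rw [mul_add, neg_add, Complex.exp_add, mul_one, Complex.exp_neg (Real.pi * I), Complex.exp_pi_mul_I]
    norm_num
  rw [e1, e2, e3]; ring

theorem fcuF_add_tau (τ u : ℂ) (hτ : 0 < τ.im) :
    fcuF τ (u + τ) = - cexp (-(Real.pi * I * τ) - 2 * Real.pi * I * u) * fcuF τ u := by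
  unfold fcuF
  have hp := fcu_norm_p τ hτ
  set p := cexp (2 * Real.pi * I * τ) with hpdef
  set x := cexp (2 * Real.pi * I * u) with hx
  have hp0 : p ≠ 0 := Complex.exp_ne_zero _
  have hx0 : x ≠ 0 := Complex.exp_ne_zero _
  have e1 : cexp (2 * Real.pi * I * (u + τ)) = p * x := by
    rw [mul_add, Complex.exp_add]; ring
  have e2 : p * cexp (-(2 * Real.pi * I * (u + τ))) = x⁻¹ := by
    rw [Complex.exp_neg, e1]; field_simp
  have e3 : cexp (-(2 * Real.pi * I * u)) = x⁻¹ := by rw [Complex.exp_neg]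
  have e4 : cexp (-(Real.pi * I * (u + τ))) = cexp (-(Real.pi * I * τ)) * cexp (-(Real.pi * I * u)) := by
    rw [← Complex.exp_add]; ring_nf
  have e5 : cexp (-(Real.pi * I * τ) - 2 * Real.pi * I * u) = cexp (-(Real.pi * I * τ)) * x⁻¹ := by
    rw [sub_eq_add_neg, Complex.exp_add, e3]
  rw [e1, e2, e3, e4, e5, fcu_poch1_succ x p hp, fcu_poch1_succ x⁻¹ p hp]
  field_simp
  ring

theorem fcuF_zero (τ u : ℂ) (hτ : 0 < τ.im) (h : fcuF τ u = 0) : ∃ m n : ℤ, u = m + n * τ := by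
  unfold fcuF at h
  have hpi : (2 * Real.pi * I : ℂ) ≠ 0 := Complex.two_pi_I_ne_zero
  rcases mul_eq_zero.1 ((mul_eq_zero.1 h).resolve_left (Complex.exp_ne_zero _)) with h | h
  · obtain ⟨n, hn⟩ := fcu_poch1_eq_zero _ _ (fcu_norm_p τ hτ) h
    rw [← Complex.exp_nat_mul, ← Complex.exp_add, Complex.exp_eq_one_iff] at hn
    obtain ⟨m, hm⟩ := hn
    refine ⟨m, -n, ?_⟩
    apply mul_left_cancel₀ hpi
    push_cast
    linear_combination hm
  · obtain ⟨n, hn⟩ := fcu_poch1_eq_zero _ _ (fcu_norm_p τ hτ) h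
    rw [← Complex.exp_nat_mul, ← Complex.exp_add, ← Complex.exp_add, Complex.exp_eq_one_iff] at hn
    obtain ⟨m, hm⟩ := hn
    refine ⟨-m, n + 1, ?_⟩
    apply mul_left_cancel₀ hpi
    push_cast
    linear_combination -hm

theorem fcuF_deriv_zero (τ : ℂ) (hτ : 0 < τ.im) : deriv (fcuF τ) 0 ≠ 0 := by
  have hp := fcu_norm_p τ hτ
  set p := cexp (2 * Real.pi * I * τ) with hpdef
  have hd := fcu_poch1_diff _ hp
  let G : ℂ → ℂ := fun u => cexp (-(Real.pi * I * u)) * (poch1 (p * cexp (2 * Real.pi * I * u)) p *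
    poch1 (p * cexp (-(2 * Real.pi * I * u))) p)
  have hG : Differentiable ℂ G := by
    refine Differentiable.mul (by fun_prop) (Differentiable.mul ?_ ?_)
    · exact hd.comp (g := fun x => poch1 x p) (f := fun u => p * cexp (2 * Real.pi * I * u)) (by fun_prop)
    · exact hd.comp (g := fun x => poch1 x p)
        (f := fun u => p * cexp (-(2 * Real.pi * I * u))) (by fun_prop)
  have hFG : fcuF τ = fun u => (1 - cexp (2 * Real.pi * I * u)) * G u := by
    funext u
    simp only [fcuF, G, ← hpdef]
    rw [fcu_poch1_succ (cexp (2 * Real.pi * I * u)) p hp]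
    ring
  have h1 : HasDerivAt (fun u : ℂ => 1 - cexp (2 * Real.pi * I * u)) (-(2 * Real.pi * I)) 0 := by
    have : HasDerivAt (fun u : ℂ => 2 * Real.pi * I * u) (2 * Real.pi * I) 0 := by
      simpa using (hasDerivAt_id (0 : ℂ)).const_mul (2 * Real.pi * I : ℂ)
    simpa using this.cexp.const_sub 1
  have h2 := h1.mul (hG 0).hasDerivAt
  have h3 : deriv (fcuF τ) 0 = -(2 * Real.pi * I) * G 0 := by
    rw [hFG]
    have := h2.deriv
    simp only [mul_zero, Complex.exp_zero, sub_self, zero_mul, add_zero] at this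
    exact this
  rw [h3]
  have hpp : poch1 p p ≠ 0 := by
    intro h0
    obtain ⟨n, hn⟩ := fcu_poch1_eq_zero _ _ hp h0
    have : ‖p * p ^ n‖ < 1 := by
      rw [← pow_succ', norm_pow]
      exact pow_lt_one₀ (norm_nonneg _) hp (by simp)
    rw [hn] at this
    simp at this
  refine mul_ne_zero (neg_ne_zero.2 Complex.two_pi_I_ne_zero) ?_
  simp [G, hpp]

theorem fcu_jTheta_eq (γ₁ γ₂ : ℝ) (u τ : ℂ) : jTheta γ₁ γ₂ u τ =
    cexp (Real.pi * I * (γ₁ : ℂ) ^ 2 * τ + 2 * Real.pi * I * γ₁ * (u + γ₂)) *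
      jacobiTheta₂ (u + γ₂ + γ₁ * τ) τ := by
  unfold jTheta jacobiTheta₂ jacobiTheta₂_term
  rw [← tsum_mul_left]
  apply tsum_congr
  intro m
  rw [← Complex.exp_add]
  ring_nf

/-- the odd theta function -/
noncomputable def fcuT (τ u : ℂ) : ℂ := jTheta (1/2) (1/2) u τ

theorem fcuT_eq (τ u : ℂ) : fcuT τ u =
    cexp (Real.pi * I * (τ / 4) + Real.pi * I * (u + 1/2)) * jacobiTheta₂ (u + 1/2 + τ / 2) τ := by
  unfold fcuT
  rw [fcu_jTheta_eq]
  push_cast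
  ring_nf

theorem fcu_jTheta_half (γ₁ γ₂ : ℝ) (u τ : ℂ) : jTheta (1/2 + γ₁) (1/2 + γ₂) u τ =
    cexp (Real.pi * I * (γ₁ : ℂ) ^ 2 * τ + 2 * Real.pi * I * γ₁ * (u + 1/2 + γ₂)) *
      fcuT τ (u + γ₁ * τ + γ₂) := by
  rw [fcu_jTheta_eq, fcuT_eq, ← mul_assoc, ← Complex.exp_add]
  push_cast
  ring_nf

theorem fcuT_diff (τ : ℂ) (hτ : 0 < τ.im) : Differentiable ℂ (fcuT τ) := by
  have h : Differentiable ℂ (fun z => jacobiTheta₂ z τ) := fun z => differentiableAt_jacobiTheta₂_fst z hτ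
  have : fcuT τ = fun u => cexp (Real.pi * I * (τ / 4) + Real.pi * I * (u + 1/2)) *
      (fun z => jacobiTheta₂ z τ) (u + 1/2 + τ / 2) := by
    funext u; exact fcuT_eq τ u
  rw [this]
  refine Differentiable.mul (by fun_prop) (h.comp (by fun_prop))

theorem fcuT_add_one (τ u : ℂ) : fcuT τ (u + 1) = - fcuT τ u := by
  rw [fcuT_eq, fcuT_eq]
  have e1 : u + 1 + 1/2 + τ / 2 = u + 1/2 + τ/2 + 1 := by ring
  have e2 : Real.pi * I * (τ / 4) + Real.pi * I * (u + 1 + 1/2) =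
    Real.pi * I * (τ / 4) + Real.pi * I * (u + 1/2) + Real.pi * I := by ring
  rw [e1, jacobiTheta₂_add_left, e2, Complex.exp_add _ (Real.pi * I), Complex.exp_pi_mul_I]
  ring

theorem fcuT_add_tau (τ u : ℂ) :
    fcuT τ (u + τ) = - cexp (-(Real.pi * I * τ) - 2 * Real.pi * I * u) * fcuT τ u := by
  rw [fcuT_eq, fcuT_eq]
  have e1 : u + τ + 1/2 + τ / 2 = u + 1/2 + τ/2 + τ := by ring
  rw [e1, jacobiTheta₂_add_left']
  have key : ∀ a b c d J : ℂ, cexp a * (cexp b * J) = cexp (a + b) * J ∧ - cexp c * (cexp d * J) = - cexp (c + d) * J := by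
    intro a b c d J
    rw [Complex.exp_add, Complex.exp_add]; constructor <;> ring
  rw [(key _ _ 0 0 _).1, (key 0 0 _ _ _).2]
  have : Real.pi * I * (τ / 4) + Real.pi * I * (u + τ + 1/2) + -Real.pi * I * (τ + 2 * (u + 1/2 + τ/2))
    = (-(Real.pi * I * τ) - 2 * Real.pi * I * u + (Real.pi * I * (τ / 4) + Real.pi * I * (u + 1/2))) - Real.pi * I := by ring
  rw [this, Complex.exp_sub_pi_mul_I]

theorem fcuT_neg (τ u : ℂ) : fcuT τ (-u) = - fcuT τ u := by
  rw [fcuT_eq, fcuT_eq]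
  have e1 : -u + 1/2 + τ / 2 = -(u + 1/2 + τ/2) + τ + 1 := by ring
  rw [e1, jacobiTheta₂_add_left, jacobiTheta₂_add_left', jacobiTheta₂_neg_left]
  rw [← mul_assoc, ← Complex.exp_add]
  have : Real.pi * I * (τ / 4) + Real.pi * I * (-u + 1/2) + -Real.pi * I * (τ + 2 * -(u + 1/2 + τ/2))
    = ((Real.pi * I * (τ / 4) + Real.pi * I * (u + 1/2))) + Real.pi * I := by ring
  rw [this, Complex.exp_add _ (Real.pi * I), Complex.exp_pi_mul_I]
  ring

theorem fcuT_add_int (τ u : ℂ) (m : ℤ) : fcuT τ (u + m) = cexp (Real.pi * I * m) * fcuT τ u := by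
  induction m using Int.induction_on with
  | zero => simp
  | succ n ih =>
    rw [show u + (((n : ℤ) + 1 : ℤ) : ℂ) = u + ((n : ℤ) : ℂ) + 1 by push_cast; ring, fcuT_add_one, ih]
    push_cast
    rw [mul_add, Complex.exp_add, mul_one, Complex.exp_pi_mul_I]; ring
  | pred n ih =>
    have := fcuT_add_one τ (u + ((-(n : ℤ) - 1 : ℤ) : ℂ))
    rw [show u + ((-(n : ℤ) - 1 : ℤ) : ℂ) + 1 = u + ((-(n : ℤ) : ℤ) : ℂ) by push_cast; ring, ih] at this
    have e : fcuT τ (u + ((-(n : ℤ) - 1 : ℤ) : ℂ)) = -(cexp (Real.pi * I * ((-(n : ℤ) : ℤ) : ℂ)) * fcuT τ u) := by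
      rw [this]; ring
    rw [e]
    push_cast
    rw [mul_sub, mul_one, Complex.exp_sub_pi_mul_I]; ring

theorem fcuT_add_int_tau (τ u : ℂ) (n : ℤ) : fcuT τ (u + n * τ) =
    cexp (Real.pi * I * n - Real.pi * I * n ^ 2 * τ - 2 * Real.pi * I * n * u) * fcuT τ u := by
  induction n using Int.induction_on with
  | zero => simp
  | succ n ih =>
    rw [show u + (((n : ℤ) + 1 : ℤ) : ℂ) * τ = u + ((n : ℤ) : ℂ) * τ + τ by push_cast; ring, fcuT_add_tau, ih]
    push_cast
    rw [← mul_assoc, neg_mul, ← Complex.exp_add, ← Complex.exp_add_pi_mul_I]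
    ring_nf
  | pred n ih =>
    have := fcuT_add_tau τ (u + ((-(n : ℤ) - 1 : ℤ) : ℂ) * τ)
    rw [show u + ((-(n : ℤ) - 1 : ℤ) : ℂ) * τ + τ = u + ((-(n : ℤ) : ℤ) : ℂ) * τ by push_cast; ring, ih] at this
    push_cast at this ⊢
    have e : ∀ a b x y: ℂ, cexp a * x = - cexp b * y → y = cexp (a - b + Real.pi * I) * x := by
      intro a b x y h
      rw [Complex.exp_add_pi_mul_I, Complex.exp_sub, neg_mul, div_mul_eq_mul_div, h]
      have := Complex.exp_ne_zero b
      field_simp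
    rw [e _ _ _ _ this]
    congr 1
    rw [Complex.exp_eq_exp_iff_exists_int]
    exact ⟨1, by push_cast; ring⟩

/-- translation by a lattice point -/
theorem fcuT_add_lattice (τ u : ℂ) (m n : ℤ) : fcuT τ (u + m + n * τ) =
    cexp (Real.pi * I * (m + n) - Real.pi * I * n ^ 2 * τ - 2 * Real.pi * I * n * u) * fcuT τ u := by
  rw [fcuT_add_int_tau, fcuT_add_int, ← mul_assoc, ← Complex.exp_add]
  congr 1
  rw [Complex.exp_eq_exp_iff_exists_int]
  exact ⟨-(n * m), by push_cast; ring⟩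

theorem fcuT_zero (τ : ℂ) : fcuT τ 0 = 0 := by
  have := fcuT_neg τ 0
  rw [neg_zero] at this
  exact self_eq_neg.1 this

theorem fcuT_lattice (τ : ℂ) (m n : ℤ) : fcuT τ (m + n * τ) = 0 := by
  have := fcuT_add_lattice τ 0 m n
  rw [fcuT_zero, mul_zero, zero_add] at this
  exact this

theorem fcuF_deriv_ne (τ : ℂ) (hτ : 0 < τ.im) (y : ℂ) (hy : fcuF τ y = 0) : deriv (fcuF τ) y ≠ 0 := by
  -- propagate by quasi-periodicity
  have hd := fcuF_diff τ hτ
  have s1 : ∀ u, deriv (fcuF τ) (u + 1) = - deriv (fcuF τ) u := by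
    intro u
    rw [← deriv_comp_add_const, ← deriv.fun_neg]
    congr 1
    funext w
    exact fcuF_add_one τ w
  have s2 : ∀ u, fcuF τ u = 0 → deriv (fcuF τ) (u + τ) =
      - cexp (-(Real.pi * I * τ) - 2 * Real.pi * I * u) * deriv (fcuF τ) u := by
    intro u hu
    rw [← deriv_comp_add_const]
    have h1 : (fun x => fcuF τ (x + τ)) = fun x => - cexp (-(Real.pi * I * τ) - 2 * Real.pi * I * x) * fcuF τ x := by
      funext x; exact fcuF_add_tau τ x hτ
    rw [h1, deriv_fun_mul (by fun_prop) (hd u), hu, mul_zero, zero_add]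
  have z2 : ∀ u, fcuF τ u = 0 ↔ fcuF τ (u + τ) = 0 := by
    intro u; rw [fcuF_add_tau τ u hτ]; simp
  have z1 : ∀ u, fcuF τ u = 0 ↔ fcuF τ (u + 1) = 0 := by
    intro u; rw [fcuF_add_one τ u]; simp
  have f0 : fcuF τ 0 = 0 := by
    unfold fcuF
    have : poch1 (cexp (2 * Real.pi * I * 0)) (cexp (2 * Real.pi * I * τ)) = 0 := by
      rw [fcu_poch1_succ _ _ (fcu_norm_p τ hτ)]; simp
    rw [this]; simp
  have P1 : ∀ m : ℤ, fcuF τ m = 0 ∧ deriv (fcuF τ) m ≠ 0 := by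
    intro m
    induction m using Int.induction_on with
    | zero => simpa using ⟨f0, fcuF_deriv_zero τ hτ⟩
    | succ n ih =>
      push_cast at ih ⊢
      rw [← z1, s1]
      exact ⟨ih.1, neg_ne_zero.2 ih.2⟩
    | pred n ih =>
      have e : (((-(n : ℤ) : ℤ)) : ℂ) = ((-(n : ℤ) - 1 : ℤ) : ℂ) + 1 := by push_cast; ring
      rw [e, ← z1, s1] at ih
      exact ⟨ih.1, neg_ne_zero.1 ih.2⟩
  have P2 : ∀ m n : ℤ, fcuF τ (m + n * τ) = 0 ∧ deriv (fcuF τ) (m + n * τ) ≠ 0 := by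
    intro m n
    induction n using Int.induction_on with
    | zero => simpa using P1 m
    | succ n ih =>
      have e : (m : ℂ) + (((n : ℤ) + 1 : ℤ) : ℂ) * τ = m + ((n : ℤ) : ℂ) * τ + τ := by push_cast; ring
      rw [e, ← z2, s2 _ ih.1]
      exact ⟨ih.1, mul_ne_zero (neg_ne_zero.2 (Complex.exp_ne_zero _)) ih.2⟩
    | pred n ih =>
      have e : (m : ℂ) + (((-(n : ℤ) : ℤ)) : ℂ) * τ = m + ((-(n : ℤ) - 1 : ℤ) : ℂ) * τ + τ := by push_cast; ring
      rw [e, ← z2] at ih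
      rw [s2 _ ih.1] at ih
      exact ⟨ih.1, right_ne_zero_of_mul ih.2⟩
  obtain ⟨m, n, rfl⟩ := fcuF_zero τ y hτ hy
  exact (P2 m n).2

/-- (weak) Jacobi triple product -/
theorem fcuT_prod (τ : ℂ) (hτ : 0 < τ.im) : ∃ K : ℂ, ∀ u, fcuT τ u = K * fcuF τ u := by
  obtain ⟨q, hq, hqe⟩ := fcu_exists_div (fcuT τ) (fcuF τ) (fcuT_diff τ hτ) (fcuF_diff τ hτ)
    (fcuF_deriv_ne τ hτ) (by
      intro y hy
      obtain ⟨m, n, rfl⟩ := fcuF_zero τ y hτ hy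
      exact fcuT_lattice τ m n)
  have q1 : ∀ x, q (x + 1) = q x := by
    intro x
    refine fcu_cancel (fcuF τ) (fcuF_diff τ hτ) (fcuF_deriv_ne τ hτ) (fun x => q (x + 1)) q x
      (by have := hq.continuous; fun_prop) (hq x).continuousAt (.of_forall fun w hw => ?_)
    have h := hqe (w + 1)
    rw [fcuT_add_one, fcuF_add_one, hqe w] at h
    apply mul_right_cancel₀ hw
    linear_combination h
  have q2 : ∀ x, q (x + τ) = q x := by
    intro x
    refine fcu_cancel (fcuF τ) (fcuF_diff τ hτ) (fcuF_deriv_ne τ hτ) (fun x => q (x + τ)) q x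
      (by have := hq.continuous; fun_prop) (hq x).continuousAt (.of_forall fun w hw => ?_)
    have h := hqe (w + τ)
    rw [fcuT_add_tau, fcuF_add_tau _ _ hτ, hqe w] at h
    apply mul_right_cancel₀ (mul_ne_zero (Complex.exp_ne_zero (-(Real.pi * I * τ) - 2 * Real.pi * I * w)) hw)
    linear_combination h
  have hc := fcu_liouville τ hτ q hq (fun x => by rw [q1]) (fun x => by rw [q2])
  exact ⟨q 0, fun u => by rw [hqe u, hc u 0]⟩

theorem fcu_lattice_iff (τ : ℂ) (P : ℂ → Prop) (h1 : ∀ x, P (x + 1) ↔ P x) (h2 : ∀ x, P (x + τ) ↔ P x)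
    (x : ℂ) (m n : ℤ) : P (x + m + n * τ) ↔ P x := by
  have a1 : ∀ x (m : ℤ), P (x + m) ↔ P x := by
    intro x m
    induction m using Int.induction_on with
    | zero => simp
    | succ n ih =>
      rw [← ih, ← h1 (x + ((n : ℤ) : ℂ))]
      push_cast
      rw [add_assoc]
    | pred n ih =>
      rw [← ih, ← h1 (x + ((-(n : ℤ) - 1 : ℤ) : ℂ))]
      push_cast
      ring_nf
  have a2 : ∀ x (m : ℤ), P (x + m * τ) ↔ P x := by
    intro x m
    induction m using Int.induction_on with
    | zero => simp
    | succ n ih =>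
      rw [← ih, ← h2 (x + ((n : ℤ) : ℂ) * τ)]
      push_cast
      ring_nf
    | pred n ih =>
      rw [← ih, ← h2 (x + ((-(n : ℤ) - 1 : ℤ) : ℂ) * τ)]
      push_cast
      ring_nf
  rw [a2, a1]

theorem fcuT_zero_iff (τ : ℂ) (hτ : 0 < τ.im) (hne : ∃ u, fcuT τ u ≠ 0) (u : ℂ) :
    fcuT τ u = 0 ↔ ∃ m n : ℤ, u = m + n * τ := by
  constructor
  · intro h
    obtain ⟨K, hK⟩ := fcuT_prod τ hτ
    obtain ⟨v, hv⟩ := hne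
    rw [hK] at h hv
    exact fcuF_zero τ u hτ ((mul_eq_zero.1 h).resolve_left (left_ne_zero_of_mul hv))
  · rintro ⟨m, n, rfl⟩
    exact fcuT_lattice τ m n

theorem fcuT_deriv_ne (τ : ℂ) (hτ : 0 < τ.im) (hne : ∃ u, fcuT τ u ≠ 0) (y : ℂ) (hy : fcuT τ y = 0) :
    deriv (fcuT τ) y ≠ 0 := by
  obtain ⟨K, hK⟩ := fcuT_prod τ hτ
  obtain ⟨v, hv⟩ := hne
  rw [hK] at hy hv
  have hK0 := left_ne_zero_of_mul hv
  have := fcuF_deriv_ne τ hτ y ((mul_eq_zero.1 hy).resolve_left hK0)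
  rw [show fcuT τ = fun u => K * fcuF τ u from funext hK, deriv_const_mul _ (fcuF_diff τ hτ y)]
  exact mul_ne_zero hK0 this

theorem fcuT_deriv_lattice (τ : ℂ) (hτ : 0 < τ.im) (m n : ℤ) : deriv (fcuT τ) (m + n * τ) =
    cexp (Real.pi * I * (m + n) - Real.pi * I * n ^ 2 * τ) * deriv (fcuT τ) 0 := by
  have h := fcuT_diff τ hτ
  have e : deriv (fun u => fcuT τ (u + (m + n * τ))) 0 = deriv (fcuT τ) (m + n * τ) := by
    rw [deriv_comp_add_const, zero_add]
  rw [← e]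
  have : (fun u => fcuT τ (u + (m + n * τ))) = fun u =>
      cexp (Real.pi * I * (m + n) - Real.pi * I * n ^ 2 * τ - 2 * Real.pi * I * n * u) * fcuT τ u := by
    funext u
    rw [← fcuT_add_lattice, add_assoc]
  rw [this, deriv_fun_mul (by fun_prop) (h 0), fcuT_zero]
  simp

/-- the space of even theta functions of order two -/
structure FcuEven (τ : ℂ) (F : ℂ → ℂ) : Prop where
  diff : Differentiable ℂ F
  one : ∀ x, F (x + 1) = F x
  tau : ∀ x, F (x + τ) = cexp (-(2 * Real.pi * I * τ) - 4 * Real.pi * I * x) * F x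
  even : ∀ x, F (-x) = F x

theorem FcuEven.prod (τ : ℂ) (hτ : 0 < τ.im) (y : ℂ) :
    FcuEven τ (fun x => fcuT τ (x - y) * fcuT τ (x + y)) where
  diff := by
    have := fcuT_diff τ hτ
    exact Differentiable.mul (this.comp (by fun_prop)) (this.comp (by fun_prop))
  one x := by
    rw [show x + 1 - y = (x - y) + 1 by ring, show x + 1 + y = (x + y) + 1 by ring, fcuT_add_one, fcuT_add_one]
    ring
  tau x := by
    rw [show x + τ - y = (x - y) + τ by ring, show x + τ + y = (x + y) + τ by ring, fcuT_add_tau, fcuT_add_tau]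
    have : cexp (-(2 * Real.pi * I * τ) - 4 * Real.pi * I * x) =
      cexp (-(Real.pi * I * τ) - 2 * Real.pi * I * (x - y)) * cexp (-(Real.pi * I * τ) - 2 * Real.pi * I * (x + y)) := by
      rw [← Complex.exp_add]; ring_nf
    rw [this]; ring
  even x := by
    rw [show -x - y = -(x + y) by ring, show -x + y = -(x - y) by ring, fcuT_neg, fcuT_neg]
    ring

theorem FcuEven.sum {τ : ℂ} {ι : Type} (s : Finset ι) (c : ι → ℂ) (F : ι → ℂ → ℂ) (h : ∀ i, FcuEven τ (F i)) :
    FcuEven τ (fun x => ∑ i ∈ s, c i * F i x) where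
  diff := by
    have := fun i => (h i).diff
    fun_prop
  one x := by simp only [(h _).one]
  tau x := by
    simp only [(h _).tau, Finset.mul_sum]
    exact Finset.sum_congr rfl fun i _ => by ring
  even x := by simp only [(h _).even]

theorem FcuEven.sub {τ : ℂ} {F G : ℂ → ℂ} (c : ℂ) (hF : FcuEven τ F) (hG : FcuEven τ G) :
    FcuEven τ (fun x => F x - c * G x) where
  diff := by
    have := hF.diff
    have := hG.diff
    fun_prop
  one x := by simp only [hF.one, hG.one]
  tau x := by simp only [hF.tau, hG.tau]; ring
  even x := by simp only [hF.even, hG.even]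

theorem FcuEven.zero_lattice {τ : ℂ} {F : ℂ → ℂ} (hF : FcuEven τ F) (x : ℂ) (m n : ℤ) (h : F x = 0) :
    F (x + m + n * τ) = 0 := by
  refine (fcu_lattice_iff τ (fun x => F x = 0) (fun x => by rw [hF.one]) (fun x => by simp [hF.tau]) x m n).2 h

theorem FcuEven.factor {τ : ℂ} (hτ : 0 < τ.im) (hne : ∃ u, fcuT τ u ≠ 0) {F : ℂ → ℂ} (hF : FcuEven τ F) (X₀ : ℂ)
    (h0 : F X₀ = 0) (h2 : fcuT τ (2 * X₀) ≠ 0) :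
    ∃ C, ∀ X, F X = C * (fcuT τ (X - X₀) * fcuT τ (X + X₀)) := by
  have hT := fcuT_diff τ hτ
  have hP := FcuEven.prod τ hτ X₀
  set D := fun x => fcuT τ (x - X₀) * fcuT τ (x + X₀) with hD
  have hboth : ∀ x, ¬ (fcuT τ (x - X₀) = 0 ∧ fcuT τ (x + X₀) = 0) := by
    rintro x ⟨h, h'⟩
    rw [fcuT_zero_iff τ hτ hne] at h h'
    obtain ⟨m, n, h⟩ := h
    obtain ⟨m', n', h'⟩ := h'
    apply h2
    rw [fcuT_zero_iff τ hτ hne]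
    refine ⟨m' - m, n' - n, ?_⟩
    push_cast
    linear_combination h' - h
  have hs : ∀ y, D y = 0 → deriv D y ≠ 0 := by
    intro y hy
    have e : deriv D y = deriv (fcuT τ) (y - X₀) * fcuT τ (y + X₀) + fcuT τ (y - X₀) * deriv (fcuT τ) (y + X₀) := by
      exact (HasDerivAt.mul (HasDerivAt.comp_sub_const y X₀ (hT _).hasDerivAt)
        (HasDerivAt.comp_add_const y X₀ (hT _).hasDerivAt)).deriv
    rw [e]
    rcases mul_eq_zero.1 hy with h | h
    · rw [h, zero_mul, add_zero]
      exact mul_ne_zero (fcuT_deriv_ne τ hτ hne _ h) fun h' => hboth y ⟨h, h'⟩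
    · rw [h, mul_zero, zero_add]
      exact mul_ne_zero (fun h' => hboth y ⟨h', h⟩) (fcuT_deriv_ne τ hτ hne _ h)
  obtain ⟨q, hq, hqe⟩ := fcu_exists_div F D hF.diff hP.diff hs (by
    intro y hy
    rcases mul_eq_zero.1 hy with h | h
    · obtain ⟨m, n, h⟩ := (fcuT_zero_iff τ hτ hne _).1 h
      rw [show y = X₀ + m + n * τ by linear_combination h]
      exact hF.zero_lattice _ _ _ h0
    · obtain ⟨m, n, h⟩ := (fcuT_zero_iff τ hτ hne _).1 h
      rw [show y = -X₀ + m + n * τ by linear_combination h]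
      exact hF.zero_lattice _ _ _ (by rw [hF.even, h0]))
  have q1 : ∀ x, q (x + 1) = q x := by
    intro x
    refine fcu_cancel D hP.diff hs (fun x => q (x + 1)) q x
      (by have := hq.continuous; fun_prop) (hq x).continuousAt (.of_forall fun w hw => ?_)
    have h := hqe (w + 1)
    rw [hF.one, hP.one, hqe w] at h
    apply mul_right_cancel₀ hw
    exact h.symm
  have q2 : ∀ x, q (x + τ) = q x := by
    intro x
    refine fcu_cancel D hP.diff hs (fun x => q (x + τ)) q x
      (by have := hq.continuous; fun_prop) (hq x).continuousAt (.of_forall fun w hw => ?_)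
    have h := hqe (w + τ)
    rw [hF.tau, hP.tau, hqe w] at h
    apply mul_right_cancel₀ (mul_ne_zero (Complex.exp_ne_zero (-(2 * Real.pi * I * τ) - 4 * Real.pi * I * w)) hw)
    linear_combination -h
  have hc := fcu_liouville τ hτ q hq (fun x => by rw [q1]) (fun x => by rw [q2])
  exact ⟨q 0, fun u => by rw [hqe u, hc u 0]⟩

theorem FcuEven.factor_zero {τ : ℂ} (hτ : 0 < τ.im) (hne : ∃ u, fcuT τ u ≠ 0) {F : ℂ → ℂ} (hF : FcuEven τ F)
    (h0 : F 0 = 0) :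
    ∃ C, ∀ X, F X = C * (fcuT τ X * fcuT τ X) := by
  have hT := fcuT_diff τ hτ
  have hs := fcuT_deriv_ne τ hτ hne
  obtain ⟨q, hq, hqe⟩ := fcu_exists_div F (fcuT τ) hF.diff hT hs (by
    intro y hy
    obtain ⟨m, n, h⟩ := (fcuT_zero_iff τ hτ hne _).1 hy
    rw [show y = 0 + m + n * τ by linear_combination h]
    exact hF.zero_lattice _ _ _ h0)
  have q1 : ∀ x, q (x + 1) = - q x := by
    intro x
    refine fcu_cancel (fcuT τ) hT hs (fun x => q (x + 1)) (fun x => - q x) x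
      (by have := hq.continuous; fun_prop) (by have := hq.continuous; fun_prop) (.of_forall fun w hw => ?_)
    have h := hqe (w + 1)
    rw [hF.one, fcuT_add_one, hqe w] at h
    apply mul_right_cancel₀ hw
    linear_combination h
  have q2 : ∀ x, q (x + τ) = - cexp (-(Real.pi * I * τ) - 2 * Real.pi * I * x) * q x := by
    intro x
    refine fcu_cancel (fcuT τ) hT hs (fun x => q (x + τ)) (fun x => - cexp (-(Real.pi * I * τ) - 2 * Real.pi * I * x) * q x) x
      (by have := hq.continuous; fun_prop) (by have := hq.continuous; fun_prop) (.of_forall fun w hw => ?_)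
    have h := hqe (w + τ)
    have e : cexp (-(2 * Real.pi * I * τ) - 4 * Real.pi * I * w) =
      cexp (-(Real.pi * I * τ) - 2 * Real.pi * I * w) * cexp (-(Real.pi * I * τ) - 2 * Real.pi * I * w) := by
      rw [← Complex.exp_add]; ring_nf
    rw [hF.tau, fcuT_add_tau, hqe w, e] at h
    apply mul_right_cancel₀ (mul_ne_zero (Complex.exp_ne_zero (-(Real.pi * I * τ) - 2 * Real.pi * I * w)) hw)
    linear_combination h
  have q3 : ∀ x, q (-x) = - q x := by
    intro x
    refine fcu_cancel (fcuT τ) hT hs (fun x => q (-x)) (fun x => - q x) x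
      (by have := hq.continuous; fun_prop) (by have := hq.continuous; fun_prop) (.of_forall fun w hw => ?_)
    have h := hqe (-w)
    rw [hF.even, fcuT_neg, hqe w] at h
    apply mul_right_cancel₀ hw
    linear_combination h
  have q0 : q 0 = 0 := by
    have := q3 0
    rw [neg_zero] at this
    exact self_eq_neg.1 this
  obtain ⟨r, hr, hre⟩ := fcu_exists_div q (fcuT τ) hq hT hs (by
    intro y hy
    obtain ⟨m, n, h⟩ := (fcuT_zero_iff τ hτ hne _).1 hy
    rw [show y = 0 + m + n * τ by linear_combination h]
    exact (fcu_lattice_iff τ (fun x => q x = 0) (fun x => by simp [q1]) (fun x => by simp [q2]) 0 m n).2 q0)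
  have r1 : ∀ x, r (x + 1) = r x := by
    intro x
    refine fcu_cancel (fcuT τ) hT hs (fun x => r (x + 1)) (fun x => r x) x
      (by have := hr.continuous; fun_prop) (by have := hr.continuous; fun_prop) (.of_forall fun w hw => ?_)
    have h := hre (w + 1)
    rw [q1, fcuT_add_one, hre w] at h
    apply mul_right_cancel₀ hw
    linear_combination h
  have r2 : ∀ x, r (x + τ) = r x := by
    intro x
    refine fcu_cancel (fcuT τ) hT hs (fun x => r (x + τ)) (fun x => r x) x
      (by have := hr.continuous; fun_prop) (by have := hr.continuous; fun_prop) (.of_forall fun w hw => ?_)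
    have h := hre (w + τ)
    rw [q2, fcuT_add_tau, hre w] at h
    apply mul_right_cancel₀ (mul_ne_zero (Complex.exp_ne_zero (-(Real.pi * I * τ) - 2 * Real.pi * I * w)) hw)
    linear_combination h
  have hc := fcu_liouville τ hτ r hr (fun x => by rw [r1]) (fun x => by rw [r2])
  exact ⟨r 0, fun u => by rw [hqe u, hre u, hc u 0]; ring⟩

theorem fcuT_hasDerivAt (τ : ℂ) (hτ : 0 < τ.im) (x : ℂ) : HasDerivAt (fcuT τ) (deriv (fcuT τ) x) x :=
  (fcuT_diff τ hτ x).hasDerivAt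

/-- a double zero at `X₀` forces vanishing -/
theorem FcuEven.eq_zero_of_deriv {τ : ℂ} (hτ : 0 < τ.im) (hne : ∃ u, fcuT τ u ≠ 0) {F : ℂ → ℂ} (hF : FcuEven τ F)
    (X₀ : ℂ) (h0 : F X₀ = 0) (h1 : HasDerivAt F 0 X₀) (h2 : fcuT τ (2 * X₀) ≠ 0) : ∀ X, F X = 0 := by
  obtain ⟨C, hC⟩ := hF.factor hτ hne X₀ h0 h2
  have d : HasDerivAt F (C * (deriv (fcuT τ) (X₀ - X₀) * fcuT τ (X₀ + X₀) + fcuT τ (X₀ - X₀) * deriv (fcuT τ) (X₀ + X₀))) X₀ := by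
    rw [show F = fun X => C * (fcuT τ (X - X₀) * fcuT τ (X + X₀)) from funext hC]
    refine HasDerivAt.const_mul C (HasDerivAt.mul ?_ ?_)
    · exact HasDerivAt.comp_sub_const X₀ X₀ (fcuT_hasDerivAt τ hτ _)
    · exact HasDerivAt.comp_add_const X₀ X₀ (fcuT_hasDerivAt τ hτ _)
  have e := h1.unique d
  rw [sub_self, fcuT_zero, zero_mul, add_zero, ← two_mul] at e
  have hd := fcuT_deriv_ne τ hτ hne 0 (fcuT_zero τ)
  have : C = 0 := by
    by_contra hCn
    exact mul_ne_zero hCn (mul_ne_zero hd h2) e.symm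
  intro X; rw [hC, this, zero_mul]

theorem FcuEven.eq_zero_of_two {τ : ℂ} (hτ : 0 < τ.im) (hne : ∃ u, fcuT τ u ≠ 0) {F : ℂ → ℂ} (hF : FcuEven τ F)
    (X₀ X₁ : ℂ) (h0 : F X₀ = 0) (h1 : F X₁ = 0) (h2 : fcuT τ (2 * X₀) ≠ 0)
    (h3 : fcuT τ (X₁ - X₀) ≠ 0) (h4 : fcuT τ (X₁ + X₀) ≠ 0) : ∀ X, F X = 0 := by
  obtain ⟨C, hC⟩ := hF.factor hτ hne X₀ h0 h2
  have : C = 0 := by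
    by_contra hCn
    rw [hC] at h1
    exact mul_ne_zero hCn (mul_ne_zero h3 h4) h1
  intro X; rw [hC, this, zero_mul]

/-- `Σ_β W̃_β` building blocks -/
noncomputable def fcuW (N : ℕ) (τ x z : ℂ) (b : ℤ × ℤ) : ℂ :=
  cexp (2 * Real.pi * I * (b.1 * z / N)) * fcuT τ (z + (x + (b.1 * τ + b.2) / N)) / fcuT τ (x + (b.1 * τ + b.2) / N)

/-- the integer pair attached to an index -/
def fcuB {N : ℕ} (β : Fin N × Fin N) : ℤ × ℤ := (((β.1 : ℕ) : ℤ), ((β.2 : ℕ) : ℤ))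

theorem fcu_shift_sum (N : ℕ) (f : ℤ → ℂ) (hf : ∀ b, f (b + N) = f b) (c : ℤ) :
    ∑ i : Fin N, f ((i : ℕ) + c) = ∑ i : Fin N, f (i : ℕ) := by
  have h1 : ∀ c : ℤ, ∑ i : Fin N, f ((i : ℕ) + (c + 1)) = ∑ i : Fin N, f ((i : ℕ) + c) := by
    intro c
    rw [Fin.sum_univ_eq_sum_range (fun i => f ((i : ℕ) + (c + 1))) N,
      Fin.sum_univ_eq_sum_range (fun i => f ((i : ℕ) + c)) N]
    have e1 := Finset.sum_range_succ (fun i : ℕ => f ((i : ℤ) + c)) N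
    have e2 := Finset.sum_range_succ' (fun i : ℕ => f ((i : ℤ) + c)) N
    have e3 : f ((N : ℤ) + c) = f (((0 : ℕ) : ℤ) + c) := by
      rw [← hf ((0 : ℕ) + c)]; congr 1; push_cast; ring
    rw [e1, e3] at e2
    have e4 := add_right_cancel e2
    rw [e4]
    refine Finset.sum_congr rfl fun i _ => ?_
    congr 1; push_cast; ring
  induction c using Int.induction_on with
  | zero => simp
  | succ n ih => rw [h1, ih]
  | pred n ih =>
    have h := h1 (-(n : ℤ) - 1)
    rw [← h, ← ih]
    refine Finset.sum_congr rfl fun i _ => ?_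
    congr 1; ring

theorem fcu_shift_sum2 (N : ℕ) (f : ℤ × ℤ → ℂ) (hf1 : ∀ b, f (b + ((N : ℤ), 0)) = f b) (hf2 : ∀ b, f (b + (0, (N : ℤ))) = f b)
    (c : ℤ × ℤ) :
    ∑ β : Fin N × Fin N, f (fcuB β + c) = ∑ β : Fin N × Fin N, f (fcuB β) := by
  rw [Fintype.sum_prod_type, Fintype.sum_prod_type]
  have e1 : ∀ i : Fin N, ∑ j : Fin N, f (fcuB (i, j) + c) = ∑ j : Fin N, f (((i : ℕ) : ℤ) + c.1, ((j : ℕ) : ℤ)) := by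
    intro i
    refine fcu_shift_sum N (fun j => f (((i : ℕ) : ℤ) + c.1, j)) (fun b => ?_) c.2
    simpa using hf2 (((i : ℕ) : ℤ) + c.1, b)
  simp only [e1]
  refine fcu_shift_sum N (fun i => ∑ j : Fin N, f (i, ((j : ℕ) : ℤ))) (fun b => ?_) c.1
  refine Finset.sum_congr rfl fun j _ => ?_
  simpa using hf1 (b, ((j : ℕ) : ℤ))

theorem fcuW_per1 (N : ℕ) (hN : N ≠ 0) (τ x z : ℂ) (b : ℤ × ℤ) : fcuW N τ x z (b + ((N : ℤ), 0)) = fcuW N τ x z b := by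
  have hN' : (N : ℂ) ≠ 0 := Nat.cast_ne_zero.2 hN
  unfold fcuW
  simp only [Prod.fst_add, Prod.snd_add, add_zero]
  push_cast
  have e1 : x + ((b.1 + N) * τ + b.2) / N = (x + (b.1 * τ + b.2) / N) + τ := by field_simp; ring
  have e2 : z + ((x + (b.1 * τ + b.2) / N) + τ) = (z + (x + (b.1 * τ + b.2) / N)) + τ := by ring
  have e3 : 2 * Real.pi * I * ((b.1 + N) * z / N) = 2 * Real.pi * I * (b.1 * z / N) + 2 * Real.pi * I * z := by
    field_simp
  rw [e1, e2, fcuT_add_tau, fcuT_add_tau, e3]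
  set y := x + (b.1 * τ + b.2) / N
  rw [show -(Real.pi * I * τ) - 2 * Real.pi * I * (z + y) = (-(Real.pi * I * τ) - 2 * Real.pi * I * y) - 2 * Real.pi * I * z by ring,
    Complex.exp_sub _ (2 * Real.pi * I * z), Complex.exp_add]
  have h1 := Complex.exp_ne_zero (2 * Real.pi * I * z)
  have h2 := Complex.exp_ne_zero (-(Real.pi * I * τ) - 2 * Real.pi * I * y)
  set A := cexp (2 * Real.pi * I * z)
  set B := cexp (-(Real.pi * I * τ) - 2 * Real.pi * I * y)
  by_cases hy : fcuT τ y = 0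
  · rw [hy]; simp
  · field_simp

theorem fcuW_per2 (N : ℕ) (hN : N ≠ 0) (τ x z : ℂ) (b : ℤ × ℤ) : fcuW N τ x z (b + (0, (N : ℤ))) = fcuW N τ x z b := by
  have hN' : (N : ℂ) ≠ 0 := Nat.cast_ne_zero.2 hN
  unfold fcuW
  simp only [Prod.fst_add, Prod.snd_add, add_zero]
  push_cast
  have e1 : x + (b.1 * τ + (b.2 + N)) / N = (x + (b.1 * τ + b.2) / N) + 1 := by field_simp; ring
  have e2 : z + ((x + (b.1 * τ + b.2) / N) + 1) = (z + (x + (b.1 * τ + b.2) / N)) + 1 := by ring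
  rw [e1, e2, fcuT_add_one, fcuT_add_one]
  rw [mul_neg, neg_div_neg_eq]

/-- `Σ_β W̃_β` -/
noncomputable def fcuS (N : ℕ) (τ x z : ℂ) : ℂ := ∑ β : Fin N × Fin N, fcuW N τ x z (fcuB β)

theorem fcuS_shift_one (N : ℕ) (hN : N ≠ 0) (τ y z : ℂ) : fcuS N τ ((y + 1) / N) z = fcuS N τ (y / N) z := by
  have hN' : (N : ℂ) ≠ 0 := Nat.cast_ne_zero.2 hN
  unfold fcuS
  rw [← fcu_shift_sum2 N (fcuW N τ (y / N) z) (fcuW_per1 N hN τ _ z) (fcuW_per2 N hN τ _ z) (0, 1)]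
  refine Finset.sum_congr rfl fun β _ => ?_
  unfold fcuW
  simp only [Prod.fst_add, Prod.snd_add, add_zero]
  push_cast
  have e1 : (y + 1) / N + ((fcuB β).1 * τ + (fcuB β).2) / N = y / N + ((fcuB β).1 * τ + ((fcuB β).2 + 1)) / N := by ring
  rw [e1]

theorem fcuS_shift_tau (N : ℕ) (hN : N ≠ 0) (τ y z : ℂ) : fcuS N τ ((y + τ) / N) z =
    cexp (-(2 * Real.pi * I * (z / N))) * fcuS N τ (y / N) z := by
  have hN' : (N : ℂ) ≠ 0 := Nat.cast_ne_zero.2 hN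
  unfold fcuS
  rw [← fcu_shift_sum2 N (fcuW N τ (y / N) z) (fcuW_per1 N hN τ _ z) (fcuW_per2 N hN τ _ z) (1, 0), Finset.mul_sum]
  refine Finset.sum_congr rfl fun β _ => ?_
  unfold fcuW
  simp only [Prod.fst_add, Prod.snd_add, add_zero]
  push_cast
  have e1 : (y + τ) / N + ((fcuB β).1 * τ + (fcuB β).2) / N = y / N + (((fcuB β).1 + 1) * τ + (fcuB β).2) / N := by ring
  have e2 : 2 * Real.pi * I * (((fcuB β).1 + 1) * z / N) =
    2 * Real.pi * I * ((fcuB β).1 * z / N) - -(2 * Real.pi * I * (z / N)) := by ring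
  have h0 := Complex.exp_ne_zero (-(2 * Real.pi * I * (z / N)))
  rw [e1, e2, Complex.exp_sub]
  generalize cexp (-(2 * Real.pi * I * (z / N))) = A at h0 ⊢
  field_simp

theorem fcu_not_lattice (N : ℕ) (hN : N ≠ 0) (τ : ℂ) (hτ : 0 < τ.im) (β : Fin N × Fin N) (m n : ℤ)
    (h : ((fcuB β).1 * τ + (fcuB β).2) / N = (m : ℂ) + n * τ) : fcuB β = (0, 0) := by
  have hN' : (N : ℂ) ≠ 0 := Nat.cast_ne_zero.2 hN
  rw [div_eq_iff hN'] at h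
  have him := congrArg Complex.im h
  simp [fcuB] at him
  have hτ' := hτ.ne'
  have h1 : (((β.1 : ℕ) : ℝ)) = n * N := by
    apply mul_right_cancel₀ hτ'
    linear_combination him
  have h1' : (((β.1 : ℕ) : ℤ)) = n * N := by exact_mod_cast h1
  have hre := congrArg Complex.re h
  simp [fcuB] at hre
  have h2 : (((β.2 : ℕ) : ℝ)) = m * N := by
    rw [h1] at hre
    linear_combination hre
  have h2' : (((β.2 : ℕ) : ℤ)) = m * N := by exact_mod_cast h2
  have l1 : ((β.1 : ℕ) : ℤ) < N := by exact_mod_cast β.1.2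
  have l2 : ((β.2 : ℕ) : ℤ) < N := by exact_mod_cast β.2.2
  have aux : ∀ (a c : ℤ), 0 ≤ a → a < N → a = c * N → a = 0 := by
    intro a c h0 h1 h2
    exact Int.eq_zero_of_dvd_of_nonneg_of_lt h0 h1 ⟨c, by rw [h2, mul_comm]⟩
  unfold fcuB
  rw [aux _ _ (by positivity) l1 h1', aux _ _ (by positivity) l2 h2']

theorem fcu_xb_ne (N : ℕ) (hN : N ≠ 0) (τ : ℂ) (hτ : 0 < τ.im) (hne : ∃ u, fcuT τ u ≠ 0) (y : ℂ)
    (hy : fcuT τ y ≠ 0) (b : ℤ × ℤ) : fcuT τ (y / N + (b.1 * τ + b.2) / N) ≠ 0 := by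
  have hN' : (N : ℂ) ≠ 0 := Nat.cast_ne_zero.2 hN
  intro h
  apply hy
  rw [fcuT_zero_iff τ hτ hne] at h ⊢
  obtain ⟨m, n, h⟩ := h
  refine ⟨N * m - b.2, N * n - b.1, ?_⟩
  push_cast
  field_simp at h
  linear_combination h

/-- distribution identity -/
theorem fcu_L (N : ℕ) (hN : N ≠ 0) (τ : ℂ) (hτ : 0 < τ.im) (hne : ∃ u, fcuT τ u ≠ 0) (z y : ℂ) (hy : fcuT τ y ≠ 0) :
    fcuT τ (z / N) * fcuT τ y * fcuS N τ (y / N) z = N * fcuT τ z * fcuT τ (z / N + y) := by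
  have hN' : (N : ℂ) ≠ 0 := Nat.cast_ne_zero.2 hN
  by_cases hz : ∃ m n : ℤ, z / N = m + n * τ
  · have h1 := (fcuT_zero_iff τ hτ hne _).2 hz
    have h2 : fcuT τ z = 0 := by
      obtain ⟨m, n, h⟩ := hz
      rw [fcuT_zero_iff τ hτ hne]
      refine ⟨N * m, N * n, ?_⟩
      push_cast
      field_simp at h
      linear_combination h
    rw [h1, h2]; ring
  have hT := fcuT_diff τ hτ
  have hs := fcuT_deriv_ne τ hτ hne
  have hc : ∀ c : ℂ, Differentiable ℂ (fun y => fcuT τ (y / N + c)) := fun c =>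
    hT.comp (by fun_prop)
  have hQ : ∀ β : Fin N × Fin N, ∃ q : ℂ → ℂ, Differentiable ℂ q ∧
      ∀ y, fcuT τ y = q y * fcuT τ (y / N + ((fcuB β).1 * τ + (fcuB β).2) / N) := by
    intro β
    refine fcu_exists_div (fcuT τ) (fun y => fcuT τ (y / N + ((fcuB β).1 * τ + (fcuB β).2) / N)) hT (hc _) ?_ ?_
    · intro w hw
      have hd : HasDerivAt (fun y => fcuT τ (y / N + ((fcuB β).1 * τ + (fcuB β).2) / N))
        (deriv (fcuT τ) (w / N + ((fcuB β).1 * τ + (fcuB β).2) / N) * (1 / N)) w :=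
        HasDerivAt.comp w (fcuT_hasDerivAt τ hτ _) (((hasDerivAt_id w).div_const _).add_const _)
      rw [hd.deriv]
      exact mul_ne_zero (hs _ hw) (one_div_ne_zero hN')
    · intro w hw
      by_contra h
      exact fcu_xb_ne N hN τ hτ hne w h _ hw
  choose Q hQd hQe using hQ
  set H : ℂ → ℂ := fun y => fcuT τ (z / N) * ∑ β : Fin N × Fin N, cexp (2 * Real.pi * I * ((fcuB β).1 * z / N)) *
    fcuT τ (y / N + (z + ((fcuB β).1 * τ + (fcuB β).2) / N)) * Q β y - N * fcuT τ z * fcuT τ (z / N + y) with hH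
  set G : ℂ → ℂ := fun y => fcuT τ (z / N) * fcuS N τ (y / N) z - N * fcuT τ z * (fcuT τ (z / N + y) / fcuT τ y) with hG
  have hHd : Differentiable ℂ H := by
    have : Differentiable ℂ (fun y => fcuT τ (z / N + y)) := hT.comp (by fun_prop)
    fun_prop
  have hHG : ∀ w, fcuT τ w ≠ 0 → H w = G w * fcuT τ w := by
    intro w hw
    simp only [hH, hG, fcuS, fcuW]
    rw [sub_mul, mul_assoc (fcuT τ (z / N)), Finset.sum_mul]
    congr 1
    · congr 1
      refine Finset.sum_congr rfl fun β _ => ?_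
      have h1 := fcu_xb_ne N hN τ hτ hne w hw (fcuB β)
      have h2 := hQe β w
      rw [show w / N + (z + ((fcuB β).1 * τ + (fcuB β).2) / N) = z + (w / N + ((fcuB β).1 * τ + (fcuB β).2) / N) by ring]
      rw [h2, div_mul_eq_mul_div, ← mul_assoc, mul_div_cancel_right₀ _ h1]
    · field_simp
  have G1 : ∀ w, G (w + 1) = G w := by
    intro w
    simp only [hG]
    rw [fcuS_shift_one N hN, ← add_assoc, fcuT_add_one, fcuT_add_one, neg_div_neg_eq]
  have G2 : ∀ w, G (w + τ) = cexp (-(2 * Real.pi * I * (z / N))) * G w := by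
    intro w
    simp only [hG]
    rw [fcuS_shift_tau N hN, ← add_assoc, fcuT_add_tau, fcuT_add_tau]
    rw [show -(Real.pi * I * τ) - 2 * Real.pi * I * (z / N + w) = -(2 * Real.pi * I * (z / N)) + (-(Real.pi * I * τ) - 2 * Real.pi * I * w) by ring, Complex.exp_add]
    have h2 := Complex.exp_ne_zero (-(Real.pi * I * τ) - 2 * Real.pi * I * w)
    set B := cexp (-(Real.pi * I * τ) - 2 * Real.pi * I * w)
    have : ∀ a b c : ℂ, -(c * B) * a / (-B * b) = c * (a / b) := by
      intro a b c
      rw [show -(c * B) * a = (-B) * (c * a) by ring, mul_div_mul_left _ _ (neg_ne_zero.2 h2), mul_div_assoc]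
    rw [this]
    ring
  have n1 : ∀ w, fcuT τ w ≠ 0 → fcuT τ (w + 1) ≠ 0 := fun w hw => by rw [fcuT_add_one]; simpa using hw
  have n2 : ∀ w, fcuT τ w ≠ 0 → fcuT τ (w + τ) ≠ 0 := fun w hw => by rw [fcuT_add_tau]; simpa using hw
  have H1 : ∀ x, H (x + 1) = - H x := by
    intro x
    refine fcu_cancel (fcuT τ) hT hs (fun x => H (x + 1)) (fun x => - H x) x
      (by have := hHd.continuous; fun_prop) (by have := hHd.continuous; fun_prop) (.of_forall fun w hw => ?_)
    rw [hHG _ hw, hHG _ (n1 w hw), G1, fcuT_add_one]; ring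
  have H2 : ∀ x, H (x + τ) = - cexp (-(2 * Real.pi * I * (z / N))) * cexp (-(Real.pi * I * τ) - 2 * Real.pi * I * x) * H x := by
    intro x
    refine fcu_cancel (fcuT τ) hT hs (fun x => H (x + τ)) (fun x => - cexp (-(2 * Real.pi * I * (z / N))) * cexp (-(Real.pi * I * τ) - 2 * Real.pi * I * x) * H x) x
      (by have := hHd.continuous; fun_prop) (by have := hHd.continuous; fun_prop) (.of_forall fun w hw => ?_)
    rw [hHG _ hw, hHG _ (n2 w hw), G2, fcuT_add_tau]; ring
  have hT0 := fcuT_zero τ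
  have hd0 := hs 0 hT0
  have H0 : H 0 = 0 := by
    have q0 : ∀ β : Fin N × Fin N, fcuB β ≠ (0, 0) → Q β 0 = 0 := by
      intro β hβ
      have := hQe β 0
      rw [hT0] at this
      refine (mul_eq_zero.1 this.symm).resolve_right ?_
      intro h0
      rw [zero_div, zero_add] at h0
      obtain ⟨m, n, h⟩ := (fcuT_zero_iff τ hτ hne _).1 h0
      exact hβ (fcu_not_lattice N hN τ hτ β m n h)
    have hpos : 0 < N := Nat.pos_of_ne_zero hN
    set β₀ : Fin N × Fin N := (⟨0, hpos⟩, ⟨0, hpos⟩) with hβ₀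
    have b0 : fcuB β₀ = (0, 0) := rfl
    have qq : Q β₀ 0 = N := by
      have e : fcuT τ = fun y => Q β₀ y * fcuT τ (y / N) := by
        funext y
        have := hQe β₀ y
        rw [b0] at this
        simpa using this
      have d1 : HasDerivAt (fun y => fcuT τ (y / N)) (deriv (fcuT τ) (0 / N) * (1 / N)) 0 :=
        HasDerivAt.comp (0 : ℂ) (fcuT_hasDerivAt τ hτ _) ((hasDerivAt_id (0 : ℂ)).div_const _)
      have d2 := ((hQd β₀ 0).hasDerivAt.mul d1)
      have d3 := fcuT_hasDerivAt τ hτ 0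
      have d4 := d2.congr_of_eventuallyEq (.of_forall fun y => congrFun e y)
      have := d3.unique d4
      rw [zero_div, hT0, mul_zero, zero_add] at this
      field_simp at this
      exact this.symm
    simp only [hH]
    rw [Finset.sum_eq_single β₀]
    · rw [b0, qq]; simp; ring
    · intro β _ hβ
      rw [q0 β, mul_zero]
      intro h
      apply hβ
      rw [← b0] at h
      simp only [fcuB, Prod.mk.injEq, Nat.cast_inj] at h
      exact Prod.ext (Fin.ext h.1) (Fin.ext h.2)
    · simp
  obtain ⟨q, hq, hqe⟩ := fcu_exists_div H (fcuT τ) hHd hT hs (by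
    intro y hy
    obtain ⟨m, n, h⟩ := (fcuT_zero_iff τ hτ hne _).1 hy
    rw [show y = 0 + m + n * τ by linear_combination h]
    exact (fcu_lattice_iff τ (fun x => H x = 0) (fun x => by rw [H1]; simp)
      (fun x => by rw [H2]; simp) 0 m n).2 H0)
  have hqG : ∀ w, fcuT τ w ≠ 0 → q w = G w := by
    intro w hw
    apply mul_right_cancel₀ hw
    rw [← hqe, hHG w hw]
  have q1 : ∀ x, q (x + 1) = q x := by
    intro x
    refine fcu_cancel (fcuT τ) hT hs (fun x => q (x + 1)) q x
      (by have := hq.continuous; fun_prop) (by have := hq.continuous; fun_prop) (.of_forall fun w hw => ?_)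
    rw [hqG _ hw, hqG _ (n1 w hw), G1]
  have q2 : ∀ x, q (x + τ) = cexp (-(2 * Real.pi * I * (z / N))) * q x := by
    intro x
    refine fcu_cancel (fcuT τ) hT hs (fun x => q (x + τ)) (fun x => cexp (-(2 * Real.pi * I * (z / N))) * q x) x
      (by have := hq.continuous; fun_prop) (by have := hq.continuous; fun_prop) (.of_forall fun w hw => ?_)
    rw [hqG _ hw, hqG _ (n2 w hw), G2]
  have := fcu_liouville_zero τ hτ (z / N) q hq q1 q2 (fun m n h => hz ⟨m, n, h⟩) y
  rw [hqG y hy] at this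
  simp only [hG] at this
  field_simp at this ⊢
  linear_combination this

/-- shifted point -/
noncomputable def fcuX (N : ℕ) (τ x : ℂ) (b : ℤ × ℤ) : ℂ := x + (b.1 * τ + b.2) / N

theorem fcuW_def (N : ℕ) (τ x z : ℂ) (b : ℤ × ℤ) : fcuW N τ x z b =
    cexp (2 * Real.pi * I * (b.1 * z / N)) * fcuT τ (z + fcuX N τ x b) / fcuT τ (fcuX N τ x b) := rfl

theorem fcuW_zero (N : ℕ) (τ x : ℂ) (b : ℤ × ℤ) (h : fcuT τ (fcuX N τ x b) ≠ 0) : fcuW N τ x 0 b = 1 := by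
  rw [fcuW_def]; simp [h]

theorem fcuW_deriv_z (N : ℕ) (τ : ℂ) (hτ : 0 < τ.im) (x z : ℂ) (b : ℤ × ℤ) :
    HasDerivAt (fun z => fcuW N τ x z b) (2 * Real.pi * I * (b.1 / N) * fcuW N τ x z b +
      cexp (2 * Real.pi * I * (b.1 * z / N)) * deriv (fcuT τ) (z + fcuX N τ x b) / fcuT τ (fcuX N τ x b)) z := by
  simp only [fcuW_def]
  have h1 : HasDerivAt (fun z : ℂ => 2 * Real.pi * I * (b.1 * z / N)) (2 * Real.pi * I * (b.1 / N)) z := by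
    have := ((hasDerivAt_id z).const_mul (b.1 / N : ℂ)).const_mul (2 * Real.pi * I : ℂ)
    refine this.congr_deriv (by ring) |>.congr_of_eventuallyEq (.of_forall fun w => ?_)
    simp only [id]; ring
  have h2 := (h1.cexp.mul (HasDerivAt.comp_add_const z (fcuX N τ x b) (fcuT_hasDerivAt τ hτ _))).div_const (fcuT τ (fcuX N τ x b))
  refine h2.congr_deriv ?_
  ring

theorem fcuW_diff_z (N : ℕ) (τ : ℂ) (hτ : 0 < τ.im) (x : ℂ) (b : ℤ × ℤ) :
    Differentiable ℂ (fun z => fcuW N τ x z b) := fun z => (fcuW_deriv_z N τ hτ x z b).differentiableAt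

theorem fcuT_comp_div (τ : ℂ) (hτ : 0 < τ.im) (N c y : ℂ) :
    HasDerivAt (fun y => fcuT τ (y / N + c)) (deriv (fcuT τ) (y / N + c) * (1 / N)) y :=
  HasDerivAt.comp y (fcuT_hasDerivAt τ hτ _) (((hasDerivAt_id y).div_const _).add_const _)

theorem fcuW_deriv_y (N : ℕ) (τ : ℂ) (hτ : 0 < τ.im) (y z : ℂ) (b : ℤ × ℤ) (h : fcuT τ (fcuX N τ (y / N) b) ≠ 0) :
    HasDerivAt (fun y => fcuW N τ (y / N) z b)
      (1 / N * (cexp (2 * Real.pi * I * (b.1 * z / N)) * deriv (fcuT τ) (z + fcuX N τ (y / N) b) / fcuT τ (fcuX N τ (y / N) b)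
        - fcuW N τ (y / N) z b * (deriv (fcuT τ) (fcuX N τ (y / N) b) / fcuT τ (fcuX N τ (y / N) b)))) y := by
  have h1 := fcuT_comp_div τ hτ N ((b.1 * τ + b.2) / N) y
  have h2 := fcuT_comp_div τ hτ N (z + (b.1 * τ + b.2) / N) y
  have h3 := (h2.const_mul (cexp (2 * Real.pi * I * (b.1 * z / N)))).fun_div h1 h
  refine (h3.congr_deriv ?_).congr_of_eventuallyEq (.of_forall fun w => ?_)
  · rw [fcuW_def]
    rw [show y / N + (z + (b.1 * τ + b.2) / N) = z + fcuX N τ (y / N) b by unfold fcuX; ring]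
    have key : ∀ M A t t1 s s1 : ℂ, t ≠ 0 → (A * (s1 * (1 / M)) * t - A * s * (t1 * (1 / M))) / t ^ 2 =
        1 / M * (A * s1 / t - A * s / t * (t1 / t)) := by
      intro M A t t1 s s1 ht
      field_simp
    exact key _ _ _ _ _ _ h
  · simp only [fcuW_def]
    rw [show w / N + (z + (b.1 * τ + b.2) / N) = z + fcuX N τ (w / N) b by unfold fcuX; ring]
    rfl

/-- value of the sum at `-Nζ` -/
theorem fcuS_cross (N : ℕ) (hN : N ≠ 0) (τ : ℂ) (hτ : 0 < τ.im) (ζ : ℂ) (hζ : fcuT τ ζ ≠ 0) :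
    fcuS N τ (ζ / N) (-(N * ζ)) = 0 := by
  have hN' : (N : ℂ) ≠ 0 := Nat.cast_ne_zero.2 hN
  have h := fcu_L N hN τ hτ ⟨ζ, hζ⟩ (-(N * ζ)) ζ hζ
  rw [show -(N * ζ) / N = -ζ by field_simp, neg_add_cancel, fcuT_zero, mul_zero, fcuT_neg] at h
  have h' : -fcuT τ ζ * fcuT τ ζ ≠ 0 := mul_ne_zero (neg_ne_zero.2 hζ) hζ
  exact (mul_eq_zero.1 h).resolve_left h'

/-- the derivative of the sum at zero is a logarithmic derivative of theta -/
theorem fcuS_deriv_zero (N : ℕ) (hN : N ≠ 0) (τ : ℂ) (hτ : 0 < τ.im) (y : ℂ) (hy : fcuT τ y ≠ 0) :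
    ∑ β : Fin N × Fin N, (2 * Real.pi * I * ((fcuB β).1 / N) +
      deriv (fcuT τ) (fcuX N τ (y / N) (fcuB β)) / fcuT τ (fcuX N τ (y / N) (fcuB β))) =
    N * (deriv (fcuT τ) y / fcuT τ y) := by
  generalize hSS : (∑ β : Fin N × Fin N, (2 * Real.pi * I * ((fcuB β).1 / N) +
      deriv (fcuT τ) (fcuX N τ (y / N) (fcuB β)) / fcuT τ (fcuX N τ (y / N) (fcuB β)))) = SS
  have hN' : (N : ℂ) ≠ 0 := Nat.cast_ne_zero.2 hN
  have hne : ∃ u, fcuT τ u ≠ 0 := ⟨y, hy⟩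
  have hT := fcuT_diff τ hτ
  have hT1 : Differentiable ℂ (deriv (fcuT τ)) := hT.deriv
  have hS : Differentiable ℂ (fun z => fcuS N τ (y / N) z) := by
    unfold fcuS
    have := fun b => fcuW_diff_z N τ hτ (y / N) b
    fun_prop
  have hS1 : Differentiable ℂ (deriv (fun z => fcuS N τ (y / N) z)) := hS.deriv
  have hx : ∀ β : Fin N × Fin N, fcuT τ (fcuX N τ (y / N) (fcuB β)) ≠ 0 := fun β =>
    fcu_xb_ne N hN τ hτ hne y hy (fcuB β)
  have hS0 : HasDerivAt (fun z => fcuS N τ (y / N) z) SS 0 := by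
    rw [← hSS]
    unfold fcuS
    refine HasDerivAt.fun_sum fun β _ => ?_
    refine (fcuW_deriv_z N τ hτ (y / N) 0 (fcuB β)).congr_deriv ?_
    rw [fcuW_zero _ _ _ _ (hx β)]
    simp
  have dN : ∀ (f : ℂ → ℂ) (hf : Differentiable ℂ f) (c z : ℂ), HasDerivAt (fun z => f (z / N + c)) (deriv f (z / N + c) * (1 / N)) z := by
    intro f hf c z
    exact HasDerivAt.comp z (hf _).hasDerivAt (((hasDerivAt_id z).div_const _).add_const _)
  have e0 : (fun z => fcuT τ (z / N + 0) * fcuT τ y * fcuS N τ (y / N) z) = fun z => N * fcuT τ z * fcuT τ (z / N + y) := by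
    funext z
    rw [add_zero]
    exact fcu_L N hN τ hτ hne z y hy
  have e1 : ∀ z, deriv (fcuT τ) (z / N + 0) * (1 / N) * fcuT τ y * fcuS N τ (y / N) z +
      fcuT τ (z / N + 0) * fcuT τ y * deriv (fun z => fcuS N τ (y / N) z) z =
      N * deriv (fcuT τ) z * fcuT τ (z / N + y) + N * fcuT τ z * (deriv (fcuT τ) (z / N + y) * (1 / N)) := by
    intro z
    have l := (((dN (fcuT τ) hT 0 z).mul_const (fcuT τ y)).fun_mul (hS z).hasDerivAt)
    have r := (((hT z).hasDerivAt.const_mul (N : ℂ)).fun_mul (dN (fcuT τ) hT y z))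
    rw [e0] at l
    exact l.unique r
  have t2 : deriv (deriv (fcuT τ)) 0 = 0 := by
    have ev : ∀ x, deriv (fcuT τ) (-x) = deriv (fcuT τ) x := by
      intro x
      have h := deriv_comp_neg (f := fcuT τ) x
      have e : (fun x => fcuT τ (-x)) = fun x => - fcuT τ x := funext (fcuT_neg τ)
      rw [e, deriv.fun_neg] at h
      exact (neg_injective h).symm
    have h := deriv_comp_neg (f := deriv (fcuT τ)) 0
    rw [show (fun x => deriv (fcuT τ) (-x)) = deriv (fcuT τ) from funext ev, neg_zero] at h
    exact self_eq_neg.1 h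
  have l := ((((dN _ hT1 0 0).mul_const (1 / N : ℂ)).mul_const (fcuT τ y)).fun_mul (hS 0).hasDerivAt).fun_add
    (((dN (fcuT τ) hT 0 0).mul_const (fcuT τ y)).fun_mul (hS1 0).hasDerivAt)
  have r := (((hT1 0).hasDerivAt.const_mul (N : ℂ)).fun_mul (dN (fcuT τ) hT y 0)).fun_add
    (((hT 0).hasDerivAt.const_mul (N : ℂ)).fun_mul ((dN (deriv (fcuT τ)) hT1 y 0).mul_const (1 / N : ℂ)))
  rw [funext e1] at l
  have e := l.unique r
  rw [hS0.deriv] at e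
  simp only [zero_div, add_zero, zero_add, t2, fcuT_zero, zero_mul, mul_zero] at e
  have hd := fcuT_deriv_ne τ hτ hne 0 (fcuT_zero τ)
  rw [← mul_div_assoc, eq_div_iff hy]
  field_simp at e
  linear_combination e

/-- the second order theta function attached to a pairing sum -/
theorem fcu_pair (N : ℕ) (hN : N ≠ 0) (τ : ℂ) (hτ : 0 < τ.im) (x c : ℂ) (g : ℤ × ℤ) (χ : Fin N × Fin N → ℂ) :
    ∃ F, FcuEven τ F ∧ ∀ u, ∑ β, χ β * (fcuW N τ x u (fcuB β + g) * fcuW N τ x (-u - c) (fcuB β)) =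
      cexp (2 * Real.pi * I * (g.1 * u / N)) * F (u + (c + (g.1 * τ + g.2) / N) / 2) := by
  have hN' : (N : ℂ) ≠ 0 := Nat.cast_ne_zero.2 hN
  set d : ℂ := (g.1 * τ + g.2) / N with hd
  refine ⟨fun X => ∑ β : Fin N × Fin N, (-χ β * cexp (-(2 * Real.pi * I * ((fcuB β).1 * c / N))) /
    (fcuT τ (fcuX N τ x (fcuB β + g)) * fcuT τ (fcuX N τ x (fcuB β)))) *
    (fcuT τ (X - (fcuX N τ x (fcuB β) + (d - c) / 2)) * fcuT τ (X + (fcuX N τ x (fcuB β) + (d - c) / 2))),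
    FcuEven.sum _ _ _ (fun β => FcuEven.prod τ hτ (fcuX N τ x (fcuB β) + (d - c) / 2)), fun u => ?_⟩
  rw [Finset.mul_sum]
  refine Finset.sum_congr rfl fun β _ => ?_
  rw [fcuW_def, fcuW_def]
  generalize fcuB β = b
  have e1 : fcuX N τ x (b + g) = fcuX N τ x b + d := by
    simp only [fcuX, hd, Prod.fst_add, Prod.snd_add]; push_cast; ring
  have e2 : u + (c + d) / 2 - (fcuX N τ x b + (d - c) / 2) = -(-u - c + fcuX N τ x b) := by ring
  have e3 : u + (c + d) / 2 + (fcuX N τ x b + (d - c) / 2) = u + (fcuX N τ x b + d) := by ring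
  have e4 : cexp (2 * Real.pi * I * ((b + g).1 * u / N)) * cexp (2 * Real.pi * I * (b.1 * (-u - c) / N)) =
      cexp (2 * Real.pi * I * (g.1 * u / N)) * cexp (-(2 * Real.pi * I * (b.1 * c / N))) := by
    rw [← Complex.exp_add, ← Complex.exp_add]
    congr 1
    simp only [Prod.fst_add]
    push_cast; ring
  rw [e1, e2, e3, fcuT_neg, div_mul_div_comm, mul_mul_mul_comm, e4]
  ring

theorem fcu_exp_int (k : ℤ) : cexp (2 * Real.pi * I * k) = 1 := by
  rw [mul_comm]; exact Complex.exp_int_mul_two_pi_mul_I k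

/-- additive characters -/
noncomputable def fcuChi (N : ℕ) (g b : ℤ × ℤ) : ℂ := cexp (2 * Real.pi * I * ((b.1 * g.2 - g.1 * b.2) / N))

theorem fcuChi_add (N : ℕ) (g b c : ℤ × ℤ) : fcuChi N g (b + c) = fcuChi N g b * fcuChi N g c := by
  unfold fcuChi
  rw [← Complex.exp_add]
  simp only [Prod.fst_add, Prod.snd_add]
  push_cast; ring_nf

theorem fcuChi_self (N : ℕ) (g : ℤ × ℤ) : fcuChi N g g = 1 := by
  unfold fcuChi
  rw [mul_comm (g.1 : ℂ), sub_self]; simp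

theorem fcuChi_per1 (N : ℕ) (hN : N ≠ 0) (g b : ℤ × ℤ) : fcuChi N g (b + ((N : ℤ), 0)) = fcuChi N g b := by
  have hN' : (N : ℂ) ≠ 0 := Nat.cast_ne_zero.2 hN
  rw [fcuChi_add]
  have : fcuChi N g ((N : ℤ), 0) = 1 := by
    rw [← fcu_exp_int g.2]; unfold fcuChi; congr 1; push_cast; field_simp; ring
  rw [this, mul_one]

theorem fcuChi_per2 (N : ℕ) (hN : N ≠ 0) (g b : ℤ × ℤ) : fcuChi N g (b + (0, (N : ℤ))) = fcuChi N g b := by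
  have hN' : (N : ℂ) ≠ 0 := Nat.cast_ne_zero.2 hN
  rw [fcuChi_add]
  have : fcuChi N g (0, (N : ℤ)) = 1 := by
    rw [← fcu_exp_int (-g.1)]; unfold fcuChi; congr 1; push_cast; field_simp; ring
  rw [this, mul_one]

theorem fcu_root_ne (N : ℕ) (hN : N ≠ 0) (j : Fin N) (hj : (j : ℕ) ≠ 0) : cexp (2 * Real.pi * I * (((j : ℕ) : ℂ) / N)) ≠ 1 := by
  have hN' : (N : ℂ) ≠ 0 := Nat.cast_ne_zero.2 hN
  intro h
  rw [Complex.exp_eq_one_iff] at h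
  obtain ⟨n, h⟩ := h
  have h2 : (2 * Real.pi * I : ℂ) ≠ 0 := Complex.two_pi_I_ne_zero
  rw [mul_comm (n : ℂ)] at h
  have h3 := mul_left_cancel₀ h2 h
  rw [div_eq_iff hN'] at h3
  have h4 : ((j : ℕ) : ℤ) = n * N := by exact_mod_cast h3
  have h5 : ((j : ℕ) : ℤ) < N := by exact_mod_cast j.2
  have := Int.eq_zero_of_dvd_of_nonneg_of_lt (by positivity) h5 ⟨n, by rw [h4, mul_comm]⟩
  exact hj (by exact_mod_cast this)

theorem fcuChi_sum (N : ℕ) (hN : N ≠ 0) (γ : Fin N × Fin N) (hγ : fcuB γ ≠ (0, 0)) :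
    ∑ β : Fin N × Fin N, fcuChi N (fcuB γ) (fcuB β) = 0 := by
  have key : ∀ c, fcuChi N (fcuB γ) c ≠ 1 → ∑ β : Fin N × Fin N, fcuChi N (fcuB γ) (fcuB β) = 0 := by
    intro c hc
    have h := fcu_shift_sum2 N (fcuChi N (fcuB γ)) (fcuChi_per1 N hN _) (fcuChi_per2 N hN _) c
    simp only [fcuChi_add] at h
    rw [← Finset.sum_mul] at h
    by_contra hne
    exact hc (mul_left_cancel₀ hne (by rw [h, mul_one]))
  by_cases h2 : (γ.2 : ℕ) = 0
  · have h1 : (γ.1 : ℕ) ≠ 0 := by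
      intro h1; apply hγ; simp [fcuB, h1, h2]
    refine key (0, -1) ?_
    have := fcu_root_ne N hN γ.1 h1
    unfold fcuChi fcuB
    simpa using this
  · refine key (1, 0) ?_
    have := fcu_root_ne N hN γ.2 h2
    unfold fcuChi fcuB
    simpa using this

theorem fcu_even_deriv {τ : ℂ} {F f : ℂ → ℂ} (a X₀ : ℂ) (h : ∀ u, f u = cexp (a * u) * F (u + X₀))
    (h0 : f 0 = 0) (h1 : HasDerivAt f 0 0) : F X₀ = 0 ∧ HasDerivAt F 0 X₀ := by
  have e : ∀ X, F X = cexp (-a * (X - X₀)) * f (X - X₀) := by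
    intro X
    rw [h, ← mul_assoc, ← Complex.exp_add, sub_add_cancel]
    rw [show -a * (X - X₀) + a * (X - X₀) = 0 by ring]; simp
  refine ⟨by rw [e, sub_self, h0, mul_zero], ?_⟩
  have d1 : HasDerivAt (fun X => f (X - X₀)) 0 X₀ := HasDerivAt.comp_sub_const X₀ X₀ (by rwa [sub_self])
  have d2 : DifferentiableAt ℂ (fun X => cexp (-a * (X - X₀))) X₀ := by fun_prop
  have d3 := d2.hasDerivAt.mul d1
  rw [sub_self, h0] at d3
  refine (d3.congr_deriv (by simp)).congr_of_eventuallyEq (.of_forall fun X => e X)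

theorem fcu_unit_ne (N : ℕ) (hN : N ≠ 0) (τ : ℂ) (hτ : 0 < τ.im) (ζ : ℂ) (hζ : fcuT τ ζ ≠ 0)
    (γ : Fin N × Fin N) (hγ : fcuB γ ≠ (0, 0)) (u : ℂ) :
    ∑ β : Fin N × Fin N, fcuChi N (fcuB γ) (fcuB β) *
      (fcuW N τ (ζ / N) u (fcuB β + fcuB γ) * fcuW N τ (ζ / N) (-u) (fcuB β)) = 0 := by
  have hN' : (N : ℂ) ≠ 0 := Nat.cast_ne_zero.2 hN
  have hne : ∃ u, fcuT τ u ≠ 0 := ⟨ζ, hζ⟩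
  obtain ⟨F, hF, hFe⟩ := fcu_pair N hN τ hτ (ζ / N) 0 (fcuB γ) (fun β => fcuChi N (fcuB γ) (fcuB β))
  set x := ζ / N
  have hx : ∀ b : ℤ × ℤ, fcuT τ (fcuX N τ x b) ≠ 0 := fun b =>
    fcu_xb_ne N hN τ hτ hne ζ hζ b
  set f : ℂ → ℂ := fun u => ∑ β : Fin N × Fin N, fcuChi N (fcuB γ) (fcuB β) *
      (fcuW N τ x u (fcuB β + fcuB γ) * fcuW N τ x (-u) (fcuB β)) with hf
  have hfe : ∀ u, f u = cexp ((2 * Real.pi * I * ((fcuB γ).1 / N)) * u) * F (u + ((fcuB γ).1 * τ + (fcuB γ).2) / N / 2) := by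
    intro u
    have := hFe u
    simp only [sub_zero, zero_add] at this
    rw [hf]; simp only; rw [this]; congr 2; ring
  have f0 : f 0 = 0 := by
    rw [hf]
    simp only [neg_zero, fcuW_zero _ _ _ _ (hx _), mul_one]
    exact fcuChi_sum N hN γ hγ
  have f1 : HasDerivAt f 0 0 := by
    have dW := fun b => (fcuW_diff_z N τ hτ x b)
    have step : HasDerivAt f (∑ β : Fin N × Fin N, fcuChi N (fcuB γ) (fcuB β) *
      (deriv (fun z => fcuW N τ x z (fcuB β + fcuB γ)) 0 - deriv (fun z => fcuW N τ x z (fcuB β)) 0)) 0 := by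
      refine HasDerivAt.fun_sum fun β _ => HasDerivAt.const_mul _ ?_
      have d1 := (dW (fcuB β + fcuB γ) 0).hasDerivAt
      have d2 : HasDerivAt (fun z => fcuW N τ x (-z) (fcuB β)) (deriv (fun z => fcuW N τ x z (fcuB β)) (-0) * (-1)) 0 :=
        HasDerivAt.comp (0 : ℂ) (h₂ := fun z => fcuW N τ x z (fcuB β)) (dW (fcuB β) (-0)).hasDerivAt (hasDerivAt_neg (0 : ℂ))
      refine (d1.fun_mul d2).congr_deriv ?_
      simp only [neg_zero, fcuW_zero _ _ _ _ (hx _)]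
      ring
    refine step.congr_deriv ?_
    simp only [mul_sub, Finset.sum_sub_distrib]
    rw [sub_eq_zero]
    rw [← fcu_shift_sum2 N (fun b => fcuChi N (fcuB γ) b * deriv (fun z => fcuW N τ x z b) 0)
      (fun b => by simp only [fcuChi_per1 N hN, fcuW_per1 N hN])
      (fun b => by simp only [fcuChi_per2 N hN, fcuW_per2 N hN]) (fcuB γ)]
    refine Finset.sum_congr rfl fun β _ => ?_
    rw [fcuChi_add, fcuChi_self, mul_one]
  obtain ⟨F0, F1⟩ := fcu_even_deriv (τ := τ) _ _ hfe f0 f1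
  have := hF.eq_zero_of_deriv hτ hne _ F0 F1 (by
    rw [show 2 * (((fcuB γ).1 * τ + (fcuB γ).2) / N / 2) = ((fcuB γ).1 * τ + (fcuB γ).2) / N by ring]
    intro h
    obtain ⟨m, n, h⟩ := (fcuT_zero_iff τ hτ hne _).1 h
    exact hγ (fcu_not_lattice N hN τ hτ γ m n h))
  have e := hfe u
  rw [this, mul_zero] at e
  exact e

theorem fcu_unit_zero (N : ℕ) (hN : N ≠ 0) (τ : ℂ) (hτ : 0 < τ.im) (ζ : ℂ) (hζ : fcuT τ ζ ≠ 0) (u : ℂ) :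
    ∑ β : Fin N × Fin N, fcuW N τ (ζ / N) u (fcuB β) * fcuW N τ (ζ / N) (-u) (fcuB β) =
      N ^ 2 * (fcuT τ (ζ + u) * fcuT τ (ζ - u)) / fcuT τ ζ ^ 2 := by
  have hN' : (N : ℂ) ≠ 0 := Nat.cast_ne_zero.2 hN
  have hne : ∃ u, fcuT τ u ≠ 0 := ⟨ζ, hζ⟩
  have hT := fcuT_diff τ hτ
  have hT1 : Differentiable ℂ (deriv (fcuT τ)) := hT.deriv
  have hxall : ∀ (y : ℂ) (hy : fcuT τ y ≠ 0) (b : ℤ × ℤ), fcuT τ (fcuX N τ (y / N) b) ≠ 0 := fun y hy b =>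
    fcu_xb_ne N hN τ hτ hne y hy b
  set x := ζ / N with hxdef
  have hx : ∀ b : ℤ × ℤ, fcuT τ (fcuX N τ x b) ≠ 0 := hxall ζ hζ
  -- rewrite the sum
  have hW : ∀ u b, fcuW N τ x u b * fcuW N τ x (-u) b = -(1 / fcuT τ (fcuX N τ x b) ^ 2) *
      (fcuT τ (u - fcuX N τ x b) * fcuT τ (u + fcuX N τ x b)) := by
    intro u b
    rw [fcuW_def, fcuW_def]
    have : cexp (2 * Real.pi * I * (b.1 * (-u) / N)) = (cexp (2 * Real.pi * I * (b.1 * u / N)))⁻¹ := by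
      rw [← Complex.exp_neg]; ring_nf
    rw [this, show -u + fcuX N τ x b = -(u - fcuX N τ x b) by ring, fcuT_neg]
    have h1 := hx b
    have h2 := Complex.exp_ne_zero (2 * Real.pi * I * (b.1 * u / N))
    generalize cexp (2 * Real.pi * I * (b.1 * u / N)) = A at *
    generalize fcuT τ (u - fcuX N τ x b) = B
    generalize fcuT τ (u + fcuX N τ x b) = C
    generalize fcuT τ (fcuX N τ x b) = D at *
    field_simp
  have hF : FcuEven τ (fun u => ∑ β : Fin N × Fin N, -(1 / fcuT τ (fcuX N τ x (fcuB β)) ^ 2) *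
      (fcuT τ (u - fcuX N τ x (fcuB β)) * fcuT τ (u + fcuX N τ x (fcuB β)))) :=
    FcuEven.sum _ _ _ (fun β => FcuEven.prod τ hτ (fcuX N τ x (fcuB β)))
  have hG := hF.sub (-(N ^ 2 / fcuT τ ζ ^ 2)) (FcuEven.prod τ hτ ζ)
  obtain ⟨C, hC⟩ := hG.factor_zero hτ hne (by
    have : ∀ β : Fin N × Fin N, -(1 / fcuT τ (fcuX N τ x (fcuB β)) ^ 2) *
      (fcuT τ (0 - fcuX N τ x (fcuB β)) * fcuT τ (0 + fcuX N τ x (fcuB β))) = 1 := by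
      intro β
      have := hx (fcuB β)
      rw [zero_sub, zero_add, fcuT_neg]; field_simp
    simp only [this]
    rw [zero_sub, zero_add, fcuT_neg]
    simp
    field_simp
    ring)
  -- derivative of the product functions
  have dP : ∀ a u, HasDerivAt (fun u => fcuT τ (u - a) * fcuT τ (u + a))
      (deriv (fcuT τ) (u - a) * fcuT τ (u + a) + fcuT τ (u - a) * deriv (fcuT τ) (u + a)) u := fun a u =>
    HasDerivAt.mul (HasDerivAt.comp_sub_const u a (hT _).hasDerivAt) (HasDerivAt.comp_add_const u a (hT _).hasDerivAt)
  have ev : ∀ x, deriv (fcuT τ) (-x) = deriv (fcuT τ) x := by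
    intro x
    have h := deriv_comp_neg (f := fcuT τ) x
    have e : (fun x => fcuT τ (-x)) = fun x => - fcuT τ x := funext (fcuT_neg τ)
    rw [e, deriv.fun_neg] at h
    exact (neg_injective h).symm
  have od : ∀ x, deriv (deriv (fcuT τ)) (-x) = - deriv (deriv (fcuT τ)) x := by
    intro x
    have h := deriv_comp_neg (f := deriv (fcuT τ)) x
    rw [show (fun x => deriv (fcuT τ) (-x)) = deriv (fcuT τ) from funext ev] at h
    rw [h]; ring
  have ddP : ∀ a, HasDerivAt (fun u => deriv (fcuT τ) (u - a) * fcuT τ (u + a) + fcuT τ (u - a) * deriv (fcuT τ) (u + a))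
      (2 * (deriv (fcuT τ) a ^ 2 - deriv (deriv (fcuT τ)) a * fcuT τ a)) 0 := by
    intro a
    have := (HasDerivAt.fun_mul (HasDerivAt.comp_sub_const 0 a (hT1 _).hasDerivAt) (HasDerivAt.comp_add_const 0 a (hT _).hasDerivAt)).fun_add
      (HasDerivAt.fun_mul (HasDerivAt.comp_sub_const 0 a (hT _).hasDerivAt) (HasDerivAt.comp_add_const 0 a (hT1 _).hasDerivAt))
    refine this.congr_deriv ?_
    rw [zero_sub, zero_add, ev, od, fcuT_neg]
    ring
  have e1 : ∀ u, (∑ β : Fin N × Fin N, -(1 / fcuT τ (fcuX N τ x (fcuB β)) ^ 2) *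
      (deriv (fcuT τ) (u - fcuX N τ x (fcuB β)) * fcuT τ (u + fcuX N τ x (fcuB β)) + fcuT τ (u - fcuX N τ x (fcuB β)) * deriv (fcuT τ) (u + fcuX N τ x (fcuB β))))
      - (-(N ^ 2 / fcuT τ ζ ^ 2)) * (deriv (fcuT τ) (u - ζ) * fcuT τ (u + ζ) + fcuT τ (u - ζ) * deriv (fcuT τ) (u + ζ))
      = C * (deriv (fcuT τ) (u - 0) * fcuT τ (u + 0) + fcuT τ (u - 0) * deriv (fcuT τ) (u + 0)) := by
    intro u
    have l := (HasDerivAt.fun_sum (u := Finset.univ) fun (β : Fin N × Fin N) _ =>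
      (dP (fcuX N τ x (fcuB β)) u).const_mul (-(1 / fcuT τ (fcuX N τ x (fcuB β)) ^ 2))).fun_sub
      ((dP ζ u).const_mul (-(N ^ 2 / fcuT τ ζ ^ 2)))
    have r := (dP 0 u).const_mul C
    refine (l.congr_of_eventuallyEq (.of_forall fun w => ?_)).unique r
    simp only [sub_zero, add_zero]
    exact (hC w).symm
  have e2 : (∑ β : Fin N × Fin N, -(1 / fcuT τ (fcuX N τ x (fcuB β)) ^ 2) *
      (2 * (deriv (fcuT τ) (fcuX N τ x (fcuB β)) ^ 2 - deriv (deriv (fcuT τ)) (fcuX N τ x (fcuB β)) * fcuT τ (fcuX N τ x (fcuB β)))))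
      - (-(N ^ 2 / fcuT τ ζ ^ 2)) * (2 * (deriv (fcuT τ) ζ ^ 2 - deriv (deriv (fcuT τ)) ζ * fcuT τ ζ))
      = C * (2 * (deriv (fcuT τ) 0 ^ 2 - deriv (deriv (fcuT τ)) 0 * fcuT τ 0)) := by
    have l := (HasDerivAt.fun_sum (u := Finset.univ) fun (β : Fin N × Fin N) _ =>
      (ddP (fcuX N τ x (fcuB β))).const_mul (-(1 / fcuT τ (fcuX N τ x (fcuB β)) ^ 2))).fun_sub
      ((ddP ζ).const_mul (-(N ^ 2 / fcuT τ ζ ^ 2)))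
    have r := (ddP 0).const_mul C
    refine (l.congr_of_eventuallyEq (.of_forall fun w => ?_)).unique r
    exact (e1 w).symm
  -- the distribution relation for the logarithmic derivative
  have e3 : (∑ β : Fin N × Fin N, 1 / N * (-(1 / fcuT τ (fcuX N τ x (fcuB β)) ^ 2) *
      (deriv (fcuT τ) (fcuX N τ x (fcuB β)) ^ 2 - deriv (deriv (fcuT τ)) (fcuX N τ x (fcuB β)) * fcuT τ (fcuX N τ x (fcuB β)))))
      = N * (-(1 / fcuT τ ζ ^ 2) * (deriv (fcuT τ) ζ ^ 2 - deriv (deriv (fcuT τ)) ζ * fcuT τ ζ)) := by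
    have dE : ∀ a, fcuT τ a ≠ 0 → HasDerivAt (fun y => deriv (fcuT τ) y / fcuT τ y)
        (-(1 / fcuT τ a ^ 2) * (deriv (fcuT τ) a ^ 2 - deriv (deriv (fcuT τ)) a * fcuT τ a)) a := by
      intro a ha
      refine ((hT1 a).hasDerivAt.fun_div (hT a).hasDerivAt ha).congr_deriv ?_
      field_simp
      ring
    have r := (dE ζ hζ).const_mul (N : ℂ)
    have l := HasDerivAt.fun_sum (u := Finset.univ) fun (β : Fin N × Fin N) _ =>
      (HasDerivAt.comp ζ (h := fun y : ℂ => y / N + ((fcuB β).1 * τ + (fcuB β).2) / N) (dE _ (hx (fcuB β))) (((hasDerivAt_id ζ).div_const (N : ℂ)).add_const _)).const_add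
        (2 * Real.pi * I * ((fcuB β).1 / N))
    have hev : ∀ᶠ y in nhds ζ, fcuT τ y ≠ 0 := (hT.continuous.continuousAt (x := ζ)).eventually_ne hζ
    have := (l.congr_of_eventuallyEq (hev.mono fun y hy => (fcuS_deriv_zero N hN τ hτ y hy).symm)).unique r
    rw [← this]
    refine Finset.sum_congr rfl fun β _ => ?_
    rw [mul_comm (1 / (N : ℂ))]
    rfl
  have hd := fcuT_deriv_ne τ hτ hne 0 (fcuT_zero τ)
  have hC0 : C = 0 := by
    rw [← Finset.mul_sum] at e3
    have e4 : (∑ β : Fin N × Fin N, -(1 / fcuT τ (fcuX N τ x (fcuB β)) ^ 2) *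
      (2 * (deriv (fcuT τ) (fcuX N τ x (fcuB β)) ^ 2 - deriv (deriv (fcuT τ)) (fcuX N τ x (fcuB β)) * fcuT τ (fcuX N τ x (fcuB β)))))
      = 2 * ∑ β : Fin N × Fin N, -(1 / fcuT τ (fcuX N τ x (fcuB β)) ^ 2) *
      (deriv (fcuT τ) (fcuX N τ x (fcuB β)) ^ 2 - deriv (deriv (fcuT τ)) (fcuX N τ x (fcuB β)) * fcuT τ (fcuX N τ x (fcuB β))) := by
      rw [Finset.mul_sum]
      exact Finset.sum_congr rfl fun β _ => by ring
    rw [e4] at e2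
    generalize (∑ β : Fin N × Fin N, -(1 / fcuT τ (fcuX N τ x (fcuB β)) ^ 2) *
      (deriv (fcuT τ) (fcuX N τ x (fcuB β)) ^ 2 - deriv (deriv (fcuT τ)) (fcuX N τ x (fcuB β)) * fcuT τ (fcuX N τ x (fcuB β)))) = SS at e2 e3
    rw [fcuT_zero, mul_zero, sub_zero] at e2
    have e5 : SS = N * (N * (-(1 / fcuT τ ζ ^ 2) * (deriv (fcuT τ) ζ ^ 2 - deriv (deriv (fcuT τ)) ζ * fcuT τ ζ))) := by
      rw [← e3]; field_simp
    have e6 : C * (2 * deriv (fcuT τ) 0 ^ 2) = 0 := by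
      rw [← e2, e5]; ring
    simpa [hd] using e6
  have := hC u
  rw [hC0, zero_mul, ] at this
  simp only [hW]
  rw [show ζ + u = u + ζ by ring, show ζ - u = -(u - ζ) by ring, fcuT_neg]
  linear_combination this

theorem fcu_mulD (N : ℕ) (τ : ℂ) (hτ : 0 < τ.im) (d y : ℂ) :
    HasDerivAt (fun ζ => fcuT τ (N * ζ + d)) (deriv (fcuT τ) (N * y + d) * N) y := by
  have h1 : HasDerivAt (fun ζ : ℂ => (N : ℂ) * ζ + d) (N : ℂ) y := by
    simpa using ((hasDerivAt_id y).const_mul (N : ℂ)).add_const d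
  exact HasDerivAt.comp y (fcuT_hasDerivAt τ hτ _) h1

/-- extension by continuity across the zeros of `θ(Nζ+d)` -/
theorem fcu_cancelN (N : ℕ) (hN : N ≠ 0) (τ : ℂ) (hτ : 0 < τ.im) (hne : ∃ u, fcuT τ u ≠ 0) (d : ℂ)
    (q r : ℂ → ℂ) (hq : ∀ y, fcuT τ y ≠ 0 → ContinuousAt q y) (hr : ∀ y, fcuT τ y ≠ 0 → ContinuousAt r y)
    (h : ∀ y, fcuT τ y ≠ 0 → fcuT τ (N * y + d) ≠ 0 → q y = r y) (y : ℂ) (hy : fcuT τ y ≠ 0) : q y = r y := by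
  have hN' : (N : ℂ) ≠ 0 := Nat.cast_ne_zero.2 hN
  refine fcu_cancel (fun ζ => fcuT τ (N * ζ + d)) (fun y => (fcu_mulD N τ hτ d y).differentiableAt)
    (fun w hw => ?_) q r y (hq y hy) (hr y hy) ?_
  · rw [(fcu_mulD N τ hτ d w).deriv]
    exact mul_ne_zero (fcuT_deriv_ne τ hτ hne _ hw) hN'
  · filter_upwards [((fcuT_diff τ hτ).continuous.continuousAt (x := y)).eventually_ne hy] with w hw h2
    exact h w hw h2

theorem fcuW_cont (N : ℕ) (hN : N ≠ 0) (τ : ℂ) (hτ : 0 < τ.im) (f : ℂ → ℂ) (hf : Continuous f) (b : ℤ × ℤ) (y : ℂ)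
    (hy : fcuT τ y ≠ 0) : ContinuousAt (fun ζ => fcuW N τ (ζ / N) (f ζ) b) y := by
  have hT := (fcuT_diff τ hτ).continuous
  simp only [fcuW_def]
  have h1 : Continuous fun ζ : ℂ => fcuX N τ (ζ / N) b := by unfold fcuX; fun_prop
  refine ContinuousAt.div ?_ ?_ (fcu_xb_ne N hN τ hτ ⟨y, hy⟩ y hy b)
  · apply Continuous.continuousAt
    exact (by fun_prop : Continuous fun ζ => cexp (2 * Real.pi * I * (b.1 * f ζ / N))).mul
      (hT.comp (hf.add h1))
  · exact (hT.comp h1).continuousAt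

theorem fcu_cross_ne (N : ℕ) (hN : N ≠ 0) (τ : ℂ) (hτ : 0 < τ.im) (ζ : ℂ) (hζ : fcuT τ ζ ≠ 0)
    (γ : Fin N × Fin N) (hγ : fcuB γ ≠ (0, 0)) (u : ℂ) :
    ∑ β : Fin N × Fin N, fcuW N τ (ζ / N) u (fcuB β + fcuB γ) * fcuW N τ (ζ / N) (-u - N * ζ) (fcuB β) = 0 := by
  have hne : ∃ u, fcuT τ u ≠ 0 := ⟨ζ, hζ⟩
  have hc : ∀ y, fcuT τ y ≠ 0 → ContinuousAt (fun ζ : ℂ => ∑ β : Fin N × Fin N,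
      fcuW N τ (ζ / N) u (fcuB β + fcuB γ) * fcuW N τ (ζ / N) (-u - N * ζ) (fcuB β)) y := by
    intro y hy
    refine tendsto_finsetSum _ fun β _ => ?_
    exact (fcuW_cont N hN τ hτ (fun _ => u) continuous_const _ y hy).mul
      (fcuW_cont N hN τ hτ (fun ζ => -u - N * ζ) (by fun_prop) _ y hy)
  set d : ℂ := ((fcuB γ).1 * τ + (fcuB γ).2) / N with hd
  refine fcu_cancelN N hN τ hτ hne 0 _ (fun _ => 0) hc (fun _ _ => continuousAt_const) ?_ ζ hζ
  intro ζ₁ hζ₁ hA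
  refine fcu_cancelN N hN τ hτ hne d _ (fun _ => 0) (fun y hy => (ContinuousAt.mul (hc y hy)
    (g := fun ζ => fcuT τ (N * ζ + 0)) (fcu_mulD N τ hτ 0 y).continuousAt)) (fun _ _ => continuousAt_const) ?_ ζ₁ hζ₁
    |> fun h => (mul_eq_zero.1 h).resolve_right hA
  clear hA hζ₁ ζ₁ hζ ζ
  intro ζ hζ hB
  by_cases hA : fcuT τ (N * ζ + 0) = 0
  · exact mul_eq_zero_of_right _ hA
  refine mul_eq_zero_of_left ?_ _
  rw [add_zero] at hA
  have hx : ∀ b : ℤ × ℤ, fcuT τ (fcuX N τ (ζ / N) b) ≠ 0 := fcu_xb_ne N hN τ hτ hne ζ hζ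
  obtain ⟨F, hF, hf⟩ := fcu_pair N hN τ hτ (ζ / N) (N * ζ) (fcuB γ) (fun _ => 1)
  simp only [one_mul, ← hd] at hf
  have f0 := hf 0
  have f1 := hf (-(N * ζ))
  simp only [fcuW_zero _ _ _ _ (hx _), neg_neg, neg_zero, zero_sub, sub_self, one_mul, mul_one] at f0 f1
  have s0 : ∑ β : Fin N × Fin N, fcuW N τ (ζ / N) (-(N * ζ)) (fcuB β) = 0 := fcuS_cross N hN τ hτ ζ hζ
  rw [fcu_shift_sum2 N (fun b => fcuW N τ (ζ / N) (-(N * ζ)) b)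
      (fun b => by simp only [fcuW_per1 N hN])
      (fun b => by simp only [fcuW_per2 N hN]) (fcuB γ)] at f1
  rw [s0] at f0 f1
  have F0 := (mul_eq_zero.1 f0.symm).resolve_left (Complex.exp_ne_zero _)
  have F1 := (mul_eq_zero.1 f1.symm).resolve_left (Complex.exp_ne_zero _)
  have := hF.eq_zero_of_two hτ hne _ _ F0 F1
    (by rw [show 2 * (0 + (N * ζ + d) / 2) = N * ζ + d by ring]; exact hB)
    (by rw [show -(N * ζ) + (N * ζ + d) / 2 - (0 + (N * ζ + d) / 2) = -(N * ζ) by ring, fcuT_neg]; exact neg_ne_zero.2 hA)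
    (by
      rw [show -(N * ζ) + (N * ζ + d) / 2 + (0 + (N * ζ + d) / 2) = d by ring]
      intro h
      obtain ⟨m, n, h⟩ := (fcuT_zero_iff τ hτ hne _).1 h
      exact hγ (fcu_not_lattice N hN τ hτ γ m n h))
  refine (hf u).trans ?_
  rw [this, mul_zero]

theorem fcu_cross_zero (N : ℕ) (hN : N ≠ 0) (τ : ℂ) (hτ : 0 < τ.im) (ζ : ℂ) (hζ : fcuT τ ζ ≠ 0) (u : ℂ) :
    ∑ β : Fin N × Fin N, fcuW N τ (ζ / N) u (fcuB β) * fcuW N τ (ζ / N) (-u - N * ζ) (fcuB β) =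
      -(N ^ 2 * (fcuT τ u * fcuT τ (u + N * ζ)) / fcuT τ ζ ^ 2) := by
  have hN' : (N : ℂ) ≠ 0 := Nat.cast_ne_zero.2 hN
  have hne : ∃ u, fcuT τ u ≠ 0 := ⟨ζ, hζ⟩
  have hT := fcuT_diff τ hτ
  refine fcu_cancelN N hN τ hτ hne 0 (fun ζ : ℂ => ∑ β : Fin N × Fin N,
      fcuW N τ (ζ / N) u (fcuB β) * fcuW N τ (ζ / N) (-u - N * ζ) (fcuB β))
      (fun ζ => -(N ^ 2 * (fcuT τ u * fcuT τ (u + N * ζ)) / fcuT τ ζ ^ 2)) ?_ ?_ ?_ ζ hζ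
  · intro y hy
    refine tendsto_finsetSum _ fun β _ => ?_
    exact (fcuW_cont N hN τ hτ (fun _ => u) continuous_const _ y hy).mul
      (fcuW_cont N hN τ hτ (fun ζ => -u - N * ζ) (by fun_prop) _ y hy)
  · intro y hy
    have h1 := hT.continuous
    refine ContinuousAt.neg (ContinuousAt.div ?_ ?_ (pow_ne_zero 2 hy))
    · apply Continuous.continuousAt
      have : Continuous fun ζ : ℂ => fcuT τ (u + N * ζ) := h1.comp (by fun_prop)
      fun_prop
    · exact (h1.pow 2).continuousAt
  clear hζ ζ
  intro ζ hζ hA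
  rw [add_zero] at hA
  have hx : ∀ b : ℤ × ℤ, fcuT τ (fcuX N τ (ζ / N) b) ≠ 0 := fcu_xb_ne N hN τ hτ hne ζ hζ
  obtain ⟨F, hF, hf⟩ := fcu_pair N hN τ hτ (ζ / N) (N * ζ) (0, 0) (fun _ => 1)
  have hG := hF.sub (-(N ^ 2 / fcuT τ ζ ^ 2)) (FcuEven.prod τ hτ (N * ζ / 2))
  simp only [one_mul] at hf
  have hf : ∀ u, ∑ β : Fin N × Fin N, fcuW N τ (ζ / N) u (fcuB β) * fcuW N τ (ζ / N) (-u - N * ζ) (fcuB β) = F (u + N * ζ / 2) := by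
    intro u
    have := hf u
    simp only [show ((0 : ℤ), (0 : ℤ)) = 0 from rfl, add_zero] at this
    rw [this]; simp
  have s0 : ∑ β : Fin N × Fin N, fcuW N τ (ζ / N) (-(N * ζ)) (fcuB β) = 0 := fcuS_cross N hN τ hτ ζ hζ
  have hfg : ∀ u, ∑ β : Fin N × Fin N, fcuW N τ (ζ / N) u (fcuB β) * fcuW N τ (ζ / N) (-u - N * ζ) (fcuB β) -
      (-(N ^ 2 / fcuT τ ζ ^ 2)) * (fcuT τ u * fcuT τ (u + N * ζ)) = cexp (0 * u) *
      (fun x => F x - -(N ^ 2 / fcuT τ ζ ^ 2) * (fcuT τ (x - N * ζ / 2) * fcuT τ (x + N * ζ / 2))) (u + N * ζ / 2) := by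
    intro u
    simp only [hf, zero_mul, Complex.exp_zero, one_mul]
    rw [add_sub_cancel_right, add_assoc, add_halves]
  -- the derivative in `y` of the scalar identity
  have key : ∑ β : Fin N × Fin N, (1 / N * (cexp (2 * Real.pi * I * ((fcuB β).1 * (-(N * ζ)) / N)) * deriv (fcuT τ) (-(N * ζ) + fcuX N τ (ζ / N) (fcuB β)) / fcuT τ (fcuX N τ (ζ / N) (fcuB β))
        - fcuW N τ (ζ / N) (-(N * ζ)) (fcuB β) * (deriv (fcuT τ) (fcuX N τ (ζ / N) (fcuB β)) / fcuT τ (fcuX N τ (ζ / N) (fcuB β))))) =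
      N * fcuT τ (N * ζ) * deriv (fcuT τ) 0 / fcuT τ ζ ^ 2 := by
    have d1 := HasDerivAt.fun_sum (u := Finset.univ) fun (β : Fin N × Fin N) _ =>
      fcuW_deriv_y N τ hτ ζ (-(N * ζ)) (fcuB β) (hx _)
    have d2 := ((fcuT_hasDerivAt τ hτ ζ).const_mul (fcuT τ (-(N * ζ) / N))).fun_mul d1
    have d3 : HasDerivAt (fun y => N * fcuT τ (-(N * ζ)) * fcuT τ (-(N * ζ) / N + y))
      (N * fcuT τ (-(N * ζ)) * deriv (fcuT τ) (-(N * ζ) / N + ζ)) ζ :=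
      (HasDerivAt.comp_const_add (-(N * ζ) / N) ζ (fcuT_hasDerivAt τ hτ _)).const_mul _
    have hev : ∀ᶠ y in nhds ζ, fcuT τ y ≠ 0 := (hT.continuous.continuousAt (x := ζ)).eventually_ne hζ
    have e := d3.unique (d2.congr_of_eventuallyEq (hev.mono fun y hy => (fcu_L N hN τ hτ hne (-(N * ζ)) y hy).symm))
    rw [s0, show -(N * ζ) / N = -ζ by field_simp, neg_add_cancel, fcuT_neg, fcuT_neg] at e
    rw [eq_div_iff (pow_ne_zero 2 hζ)]
    linear_combination e
  have hd : HasDerivAt (fun u => ∑ β : Fin N × Fin N, fcuW N τ (ζ / N) u (fcuB β) * fcuW N τ (ζ / N) (-u - N * ζ) (fcuB β) -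
      (-(N ^ 2 / fcuT τ ζ ^ 2)) * (fcuT τ u * fcuT τ (u + N * ζ))) 0 0 := by
    have a1 := HasDerivAt.fun_sum (u := Finset.univ) fun (β : Fin N × Fin N) _ =>
      (fcuW_deriv_z N τ hτ (ζ / N) 0 (fcuB β)).fun_mul
      (HasDerivAt.comp (0 : ℂ) (h := fun u : ℂ => -u - N * ζ) (fcuW_deriv_z N τ hτ (ζ / N) (-0 - N * ζ) (fcuB β))
        (((hasDerivAt_id (0 : ℂ)).neg).sub_const _))
    have a2 := ((fcuT_hasDerivAt τ hτ 0).fun_mul (HasDerivAt.comp_add_const 0 (N * ζ) (fcuT_hasDerivAt τ hτ _))).const_mul (-(N ^ 2 / fcuT τ ζ ^ 2))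
    refine (a1.fun_sub a2).congr_deriv ?_
    simp only [Function.comp, neg_zero, zero_sub, zero_add, fcuT_zero, fcuW_zero _ _ _ _ (hx _), zero_mul, add_zero]
    have k2 := congrArg (fun t : ℂ => -(N : ℂ) * t) key
    simp only [Finset.mul_sum] at k2
    rw [sub_eq_zero, show -((N : ℂ) ^ 2 / fcuT τ ζ ^ 2) * (deriv (fcuT τ) 0 * fcuT τ (N * ζ)) = -(N : ℂ) * (N * fcuT τ (N * ζ) * deriv (fcuT τ) 0 / fcuT τ ζ ^ 2) by ring, ← k2]
    refine Finset.sum_congr rfl fun β _ => ?_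
    simp only [mul_zero, zero_div, Complex.exp_zero, one_mul, mul_one]
    generalize cexp (2 * Real.pi * I * ((fcuB β).1 * (-(N * ζ)) / N)) = E
    generalize fcuW N τ (ζ / N) (-(N * ζ)) (fcuB β) = w
    generalize deriv (fcuT τ) (-(N * ζ) + fcuX N τ (ζ / N) (fcuB β)) = t1
    generalize deriv (fcuT τ) (fcuX N τ (ζ / N) (fcuB β)) = t2
    have := hx (fcuB β)
    generalize fcuT τ (fcuX N τ (ζ / N) (fcuB β)) = t at *
    field_simp
    ring
  obtain ⟨G0, G1⟩ := fcu_even_deriv (τ := τ) (F := fun x => F x - -(N ^ 2 / fcuT τ ζ ^ 2) * (fcuT τ (x - N * ζ / 2) * fcuT τ (x + N * ζ / 2))) 0 (N * ζ / 2) hfg (by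
    simp only [neg_zero, zero_sub, fcuW_zero _ _ _ _ (hx _), one_mul, s0, fcuT_zero, zero_mul, mul_zero, neg_zero]) hd
  have := hG.eq_zero_of_deriv hτ hne _ G0 G1 (by rw [show 2 * (N * ζ / 2) = N * ζ by ring]; exact hA)
  have e := hfg u
  simp only [this, mul_zero] at e
  linear_combination e

noncomputable def fcuE (N : ℕ) (k : ℤ) : ℂ := cexp (2 * Real.pi * I * (k / N))

theorem fcuE_add (N : ℕ) (k l : ℤ) : fcuE N (k + l) = fcuE N k * fcuE N l := by
  unfold fcuE; rw [← Complex.exp_add]; push_cast; ring_nf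

theorem fcuE_zero (N : ℕ) : fcuE N 0 = 1 := by simp [fcuE]

theorem fcuE_per (N : ℕ) (hN : N ≠ 0) (k : ℤ) : fcuE N (N * k) = 1 := by
  have hN' : (N : ℂ) ≠ 0 := Nat.cast_ne_zero.2 hN
  unfold fcuE
  rw [← fcu_exp_int k]; push_cast; congr 1; field_simp

theorem fcuE_congr (N : ℕ) (hN : N ≠ 0) (k l : ℤ) (h : (N : ℤ) ∣ k - l) : fcuE N k = fcuE N l := by
  obtain ⟨m, hm⟩ := h
  rw [show k = l + N * m by omega, fcuE_add, fcuE_per N hN, mul_one]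

/-- the clock and shift matrices with integer labels -/
noncomputable def fcuJ (N : ℕ) (b : ℤ × ℤ) : Matrix (Fin N) (Fin N) ℂ :=
  Matrix.of fun j l => if (N : ℤ) ∣ ((l : ℕ) : ℤ) - ((j : ℕ) : ℤ) - b.1 then fcuE N (b.2 * (((j : ℕ) : ℤ) + 1)) else 0

theorem fcu_fin_eq {N : ℕ} (i j : Fin N) (h : (N : ℤ) ∣ ((i : ℕ) : ℤ) - ((j : ℕ) : ℤ)) : i = j := by
  have hi := i.2
  have hj := j.2
  have := Int.eq_zero_of_abs_lt_dvd h (by rw [abs_lt]; omega)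
  ext; omega

theorem fcuJ_mul (N : ℕ) (hN : N ≠ 0) (b c : ℤ × ℤ) : fcuJ N b * fcuJ N c = fcuE N (b.1 * c.2) • fcuJ N (b + c) := by
  ext j l
  rw [Matrix.mul_apply, Matrix.smul_apply]
  have hNpos : (0 : ℤ) < N := by omega
  let m : Fin N := ⟨((((j : ℕ) : ℤ) + b.1) % N).toNat, by
    have := Int.emod_lt_of_pos (((j : ℕ) : ℤ) + b.1) hNpos
    have := Int.emod_nonneg (((j : ℕ) : ℤ) + b.1) hNpos.ne'
    omega⟩
  have hm : (N : ℤ) ∣ ((m : ℕ) : ℤ) - ((j : ℕ) : ℤ) - b.1 := by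
    have := Int.emod_nonneg (((j : ℕ) : ℤ) + b.1) hNpos.ne'
    have e : ((m : ℕ) : ℤ) = (((j : ℕ) : ℤ) + b.1) % N := by
      simp only [m]; omega
    rw [e, sub_sub]
    exact (Int.mod_modEq _ _).symm.dvd
  rw [Finset.sum_eq_single m]
  · simp only [fcuJ, Matrix.of_apply, hm, if_true]
    have hiff : (N : ℤ) ∣ ((l : ℕ) : ℤ) - ((m : ℕ) : ℤ) - c.1 ↔ (N : ℤ) ∣ ((l : ℕ) : ℤ) - ((j : ℕ) : ℤ) - (b + c).1 := by
      rw [show ((l : ℕ) : ℤ) - ((j : ℕ) : ℤ) - (b + c).1 = (((l : ℕ) : ℤ) - ((m : ℕ) : ℤ) - c.1) + (((m : ℕ) : ℤ) - ((j : ℕ) : ℤ) - b.1) by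
        simp only [Prod.fst_add]; ring]
      exact (Int.dvd_add_left hm).symm
    by_cases h : (N : ℤ) ∣ ((l : ℕ) : ℤ) - ((m : ℕ) : ℤ) - c.1
    · rw [if_pos h, if_pos (hiff.1 h), smul_eq_mul, ← fcuE_add, ← fcuE_add]
      apply fcuE_congr N hN
      simp only [Prod.snd_add]
      rw [show b.2 * (((j : ℕ) : ℤ) + 1) + c.2 * (((m : ℕ) : ℤ) + 1) - (b.1 * c.2 + (b.2 + c.2) * (((j : ℕ) : ℤ) + 1)) =
        c.2 * (((m : ℕ) : ℤ) - ((j : ℕ) : ℤ) - b.1) by ring]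
      exact Dvd.dvd.mul_left hm _
    · rw [if_neg h, if_neg (fun h' => h (hiff.2 h'))]; simp
  · intro i _ hi
    have : ¬ (N : ℤ) ∣ ((i : ℕ) : ℤ) - ((j : ℕ) : ℤ) - b.1 := by
      intro h
      apply hi
      apply fcu_fin_eq
      have := dvd_sub h hm
      rwa [show ((i : ℕ) : ℤ) - ((j : ℕ) : ℤ) - b.1 - (((m : ℕ) : ℤ) - ((j : ℕ) : ℤ) - b.1) = ((i : ℕ) : ℤ) - ((m : ℕ) : ℤ) by ring] at this
    simp [fcuJ, this]
  · simp

theorem fcuJ_per (N : ℕ) (hN : N ≠ 0) (b c : ℤ × ℤ) (h1 : (N : ℤ) ∣ b.1 - c.1) (h2 : (N : ℤ) ∣ b.2 - c.2) :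
    fcuJ N b = fcuJ N c := by
  ext j l
  simp only [fcuJ, Matrix.of_apply]
  have hiff : (N : ℤ) ∣ ((l : ℕ) : ℤ) - ((j : ℕ) : ℤ) - b.1 ↔ (N : ℤ) ∣ ((l : ℕ) : ℤ) - ((j : ℕ) : ℤ) - c.1 := by
    rw [show ((l : ℕ) : ℤ) - ((j : ℕ) : ℤ) - c.1 = ((l : ℕ) : ℤ) - ((j : ℕ) : ℤ) - b.1 + (b.1 - c.1) by ring]
    exact (Int.dvd_add_left h1).symm
  simp only [hiff]
  split_ifs
  · apply fcuE_congr N hN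
    rw [← sub_mul]
    exact Dvd.dvd.mul_right h2 _
  · rfl

theorem fcuJ_zero (N : ℕ) : fcuJ N (0, 0) = 1 := by
  ext j l
  simp only [fcuJ, Matrix.of_apply, Matrix.one_apply, zero_mul, fcuE_zero, sub_zero]
  by_cases h : j = l
  · simp [h]
  · rw [if_neg h, if_neg]
    exact fun h' => h (fcu_fin_eq _ _ h').symm

theorem fcuJ_g (N : ℕ) : gMat N = fcuJ N (0, 1) := by
  ext j l
  simp only [fcuJ, gMat, Matrix.of_apply, Matrix.diagonal_apply, sub_zero]
  by_cases h : j = l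
  · subst h
    simp only [if_true, sub_self, dvd_zero, eπ, fcuE]
    congr 1; push_cast; ring
  · rw [if_neg h, if_neg]
    exact fun h' => h (fcu_fin_eq _ _ h').symm

theorem fcuJ_h (N : ℕ) (hN : N ≠ 0) : hMat N = fcuJ N (1, 0) := by
  ext j l
  simp only [fcuJ, hMat, Matrix.of_apply, zero_mul, fcuE_zero]
  congr 1
  have hl := l.2
  rw [eq_iff_iff, sub_sub]
  constructor
  · intro h
    rw [h]; push_cast
    exact (Int.mod_modEq _ _).symm.dvd
  · intro h
    have := (Int.modEq_iff_dvd.2 h)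
    have := (Int.natCast_modEq_iff (a := (j : ℕ) + 1) (b := (l : ℕ)) (n := N)).1 (by push_cast; exact this)
    rw [Nat.ModEq, Nat.mod_eq_of_lt hl] at this
    exact this.symm

theorem fcuJ_gpow (N : ℕ) (hN : N ≠ 0) (n : ℕ) : gMat N ^ n = fcuJ N (0, n) := by
  induction n with
  | zero => simp [fcuJ_zero]
  | succ n ih => rw [pow_succ, ih, fcuJ_g, fcuJ_mul N hN]; simp [fcuE_zero]

theorem fcuJ_hpow (N : ℕ) (hN : N ≠ 0) (n : ℕ) : hMat N ^ n = fcuJ N (n, 0) := by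
  induction n with
  | zero => simp [fcuJ_zero]
  | succ n ih => rw [pow_succ, ih, fcuJ_h N hN, fcuJ_mul N hN]; simp [fcuE_zero]

theorem fcu_Imat (N : ℕ) (hN : N ≠ 0) (α : Fin N × Fin N) : Imat N α = fcuJ N (fcuB α) := by
  rw [Imat, fcuJ_gpow N hN, fcuJ_hpow N hN, fcuJ_mul N hN]
  simp [fcuE_zero, fcuB]

theorem fcuJ_inv (N : ℕ) (hN : N ≠ 0) (b : ℤ × ℤ) : (fcuJ N b)⁻¹ = fcuE N (b.1 * b.2) • fcuJ N (-b) := by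
  apply Matrix.inv_eq_right_inv
  rw [Matrix.mul_smul, fcuJ_mul N hN, smul_smul, ← fcuE_add]
  simp only [Prod.snd_neg, mul_neg, add_neg_cancel, fcuE_zero, one_smul]
  exact fcuJ_zero N

/-- partial transposition in the first factor -/
def fcuP {N : ℕ} (M : Matrix (Fin N × Fin N) (Fin N × Fin N) ℂ) : Matrix (Fin N × Fin N) (Fin N × Fin N) ℂ :=
  Matrix.of fun a b => M (b.1, a.2) (a.1, b.2)

theorem fcuP_kron {N : ℕ} (A B : Matrix (Fin N) (Fin N) ℂ) : fcuP (A ⊗ₖ B) = Aᵀ ⊗ₖ B := by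
  ext a b; rfl

theorem fcuP_smul {N : ℕ} (c : ℂ) (M : Matrix (Fin N × Fin N) (Fin N × Fin N) ℂ) : fcuP (c • M) = c • fcuP M := by
  ext a b; rfl

theorem fcuP_sum {N : ℕ} {ι : Type} (s : Finset ι) (M : ι → Matrix (Fin N × Fin N) (Fin N × Fin N) ℂ) :
    fcuP (∑ i ∈ s, M i) = ∑ i ∈ s, fcuP (M i) := by
  ext a b; simp [fcuP, Matrix.sum_apply]

theorem fcuP_one {N : ℕ} : fcuP (1 : Matrix (Fin N × Fin N) (Fin N × Fin N) ℂ) = 1 := by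
  rw [← Matrix.one_kronecker_one, fcuP_kron, Matrix.transpose_one]

/-- `I_b ⊗ I_b⁻¹` and its flip -/
noncomputable def fcuK (N : ℕ) (b : ℤ × ℤ) : Matrix (Fin N × Fin N) (Fin N × Fin N) ℂ :=
  fcuE N (b.1 * b.2) • (fcuJ N b ⊗ₖ fcuJ N (-b))

noncomputable def fcuK' (N : ℕ) (b : ℤ × ℤ) : Matrix (Fin N × Fin N) (Fin N × Fin N) ℂ :=
  fcuE N (b.1 * b.2) • (fcuJ N (-b) ⊗ₖ fcuJ N b)

theorem fcuK_zero (N : ℕ) : fcuK N (0, 0) = 1 := by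
  simp [fcuK, fcuJ_zero, fcuE_zero]

theorem fcuK_per (N : ℕ) (hN : N ≠ 0) (b c : ℤ × ℤ) (h1 : (N : ℤ) ∣ b.1 - c.1) (h2 : (N : ℤ) ∣ b.2 - c.2) :
    fcuK N b = fcuK N c := by
  unfold fcuK
  rw [fcuJ_per N hN b c h1 h2, fcuJ_per N hN (-b) (-c) (by simpa [neg_add_eq_sub] using (dvd_sub_comm.1 h1)) (by simpa [neg_add_eq_sub] using (dvd_sub_comm.1 h2)),
    fcuE_congr N hN (b.1 * b.2) (c.1 * c.2)]
  rw [show b.1 * b.2 - c.1 * c.2 = (b.1 - c.1) * b.2 + c.1 * (b.2 - c.2) by ring]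
  exact dvd_add (Dvd.dvd.mul_right h1 _) (Dvd.dvd.mul_left h2 _)

theorem fcuK_mul (N : ℕ) (hN : N ≠ 0) (b g : ℤ × ℤ) : fcuK N (b + g) * fcuK' N b = fcuChi N g b • fcuK N g := by
  have hchi : fcuChi N g b = fcuE N (b.1 * g.2 - g.1 * b.2) := by
    unfold fcuChi fcuE; push_cast; rfl
  unfold fcuK fcuK'
  rw [Matrix.smul_mul, Matrix.mul_smul, ← Matrix.mul_kronecker_mul, fcuJ_mul N hN, fcuJ_mul N hN,
    Matrix.smul_kronecker, Matrix.kronecker_smul, hchi]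
  simp only [smul_smul, ← fcuE_add]
  rw [show b + g + -b = g by abel, show -(b + g) + b = -g by abel]
  congr 2
  simp only [Prod.fst_add, Prod.snd_add, Prod.fst_neg, Prod.snd_neg]
  ring

theorem fcuK_cross (N : ℕ) (hN : N ≠ 0) (b g : ℤ × ℤ) : fcuP (fcuK N (b + g)) * fcuP (fcuK' N b) = fcuP (fcuK N g) := by
  unfold fcuK fcuK'
  simp only [fcuP_smul, fcuP_kron]
  rw [Matrix.smul_mul, Matrix.mul_smul, ← Matrix.mul_kronecker_mul, ← Matrix.transpose_mul, fcuJ_mul N hN, fcuJ_mul N hN,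
    Matrix.transpose_smul, Matrix.smul_kronecker, Matrix.kronecker_smul]
  simp only [smul_smul, ← fcuE_add]
  rw [show -b + (b + g) = g by abel, show -(b + g) + b = -g by abel]
  congr 2
  simp only [Prod.fst_add, Prod.snd_add, Prod.fst_neg, Prod.snd_neg]
  ring

noncomputable def fcuM (N : ℕ) (τ ζ u : ℂ) : Matrix (Fin N × Fin N) (Fin N × Fin N) ℂ :=
  ∑ β : Fin N × Fin N, fcuW N τ (ζ / N) u (fcuB β) • fcuK N (fcuB β)

noncomputable def fcuM' (N : ℕ) (τ ζ u : ℂ) : Matrix (Fin N × Fin N) (Fin N × Fin N) ℂ :=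
  ∑ β : Fin N × Fin N, fcuW N τ (ζ / N) u (fcuB β) • fcuK' N (fcuB β)

/-- matrix valued version of the shift -/
theorem fcu_shift_mat (N : ℕ) {A : Type} [Fintype A] (f : ℤ × ℤ → Matrix A A ℂ)
    (hf1 : ∀ b, f (b + ((N : ℤ), 0)) = f b) (hf2 : ∀ b, f (b + (0, (N : ℤ))) = f b) (c : ℤ × ℤ) :
    ∑ β : Fin N × Fin N, f (fcuB β + c) = ∑ β : Fin N × Fin N, f (fcuB β) := by
  ext i j
  rw [Matrix.sum_apply, Matrix.sum_apply]
  exact fcu_shift_sum2 N (fun b => f b i j) (fun b => by rw [hf1]) (fun b => by rw [hf2]) c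

theorem fcu_b_zero {N : ℕ} (γ : Fin N × Fin N) (γ₀ : Fin N × Fin N) (h0 : fcuB γ₀ = (0, 0)) (h : γ ≠ γ₀) : fcuB γ ≠ (0, 0) := by
  intro h'
  apply h
  rw [← h0] at h'
  simp only [fcuB, Prod.mk.injEq] at h'
  ext <;> omega

theorem fcuM_unit (N : ℕ) (hN : N ≠ 0) (τ : ℂ) (hτ : 0 < τ.im) (ζ : ℂ) (hζ : fcuT τ ζ ≠ 0) (u : ℂ) :
    fcuM N τ ζ u * fcuM' N τ ζ (-u) = (N ^ 2 * (fcuT τ (ζ + u) * fcuT τ (ζ - u)) / fcuT τ ζ ^ 2) • 1 := by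
  let γ₀ : Fin N × Fin N := (⟨0, Nat.pos_of_ne_zero hN⟩, ⟨0, Nat.pos_of_ne_zero hN⟩)
  have h0 : fcuB γ₀ = (0, 0) := by simp [fcuB, γ₀]
  have e1 : fcuM N τ ζ u * fcuM' N τ ζ (-u) = ∑ γ : Fin N × Fin N, (∑ β : Fin N × Fin N, fcuChi N (fcuB γ) (fcuB β) *
      (fcuW N τ (ζ / N) u (fcuB β + fcuB γ) * fcuW N τ (ζ / N) (-u) (fcuB β))) • fcuK N (fcuB γ) := by
    simp only [Finset.sum_smul]
    rw [Finset.sum_comm]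
    unfold fcuM fcuM'
    rw [Finset.mul_sum]
    refine Finset.sum_congr rfl fun β _ => ?_
    rw [← fcu_shift_mat N (fun b => fcuW N τ (ζ / N) u b • fcuK N b)
      (fun b => by simp only [fcuW_per1 N hN]; rw [fcuK_per N hN _ b (by simp) (by simp)])
      (fun b => by simp only [fcuW_per2 N hN]; rw [fcuK_per N hN _ b (by simp) (by simp)]) (fcuB β), Finset.sum_mul]
    refine Finset.sum_congr rfl fun γ _ => ?_
    rw [Matrix.smul_mul, Matrix.mul_smul, add_comm (fcuB γ), fcuK_mul N hN, smul_smul, smul_smul]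
    congr 1
    ring
  rw [e1, Finset.sum_eq_single γ₀]
  · rw [h0, fcuK_zero, ← fcu_unit_zero N hN τ hτ ζ hζ u]
    congr 1
    refine Finset.sum_congr rfl fun β _ => ?_
    simp [fcuChi, show ((0 : ℤ), (0 : ℤ)) = 0 from rfl]
  · intro γ _ hγ
    rw [fcu_unit_ne N hN τ hτ ζ hζ γ (fcu_b_zero γ γ₀ h0 hγ), zero_smul]
  · simp

theorem fcuM_cross (N : ℕ) (hN : N ≠ 0) (τ : ℂ) (hτ : 0 < τ.im) (ζ : ℂ) (hζ : fcuT τ ζ ≠ 0) (u : ℂ) :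
    fcuP (fcuM N τ ζ u) * fcuP (fcuM' N τ ζ (-u - N * ζ)) = (-(N ^ 2 * (fcuT τ u * fcuT τ (u + N * ζ)) / fcuT τ ζ ^ 2)) • 1 := by
  let γ₀ : Fin N × Fin N := (⟨0, Nat.pos_of_ne_zero hN⟩, ⟨0, Nat.pos_of_ne_zero hN⟩)
  have h0 : fcuB γ₀ = (0, 0) := by simp [fcuB, γ₀]
  have e1 : fcuP (fcuM N τ ζ u) * fcuP (fcuM' N τ ζ (-u - N * ζ)) = ∑ γ : Fin N × Fin N, (∑ β : Fin N × Fin N,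
      (fcuW N τ (ζ / N) u (fcuB β + fcuB γ) * fcuW N τ (ζ / N) (-u - N * ζ) (fcuB β))) • fcuP (fcuK N (fcuB γ)) := by
    simp only [Finset.sum_smul]
    rw [Finset.sum_comm]
    unfold fcuM fcuM'
    simp only [fcuP_sum, fcuP_smul]
    rw [Finset.mul_sum]
    refine Finset.sum_congr rfl fun β _ => ?_
    rw [← fcu_shift_mat N (fun b => fcuW N τ (ζ / N) u b • fcuP (fcuK N b))
      (fun b => by simp only [fcuW_per1 N hN]; rw [fcuK_per N hN _ b (by simp) (by simp)])
      (fun b => by simp only [fcuW_per2 N hN]; rw [fcuK_per N hN _ b (by simp) (by simp)]) (fcuB β), Finset.sum_mul]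
    refine Finset.sum_congr rfl fun γ _ => ?_
    rw [Matrix.smul_mul, Matrix.mul_smul, add_comm (fcuB γ), fcuK_cross N hN, smul_smul]
  rw [e1, Finset.sum_eq_single γ₀]
  · rw [h0, fcuK_zero, fcuP_one, ← fcu_cross_zero N hN τ hτ ζ hζ u]
    simp only [show ((0 : ℤ), (0 : ℤ)) = 0 from rfl, add_zero]
  · intro γ _ hγ
    rw [fcu_cross_ne N hN τ hτ ζ hζ γ (fcu_b_zero γ γ₀ h0 hγ), zero_smul]
  · simp

theorem fcu_jB (N : ℕ) (τ u : ℂ) (α : Fin N × Fin N) :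
    jTheta (1/2 + (α.1 : ℕ) / N) (1/2 + (α.2 : ℕ) / N) u τ =
    cexp (Real.pi * I * ((fcuB α).1 / N) ^ 2 * τ + 2 * Real.pi * I * ((fcuB α).1 / N) * (u + 1/2 + (fcuB α).2 / N)) *
      fcuT τ (u + ((fcuB α).1 * τ + (fcuB α).2) / N) := by
  rw [fcu_jTheta_half]
  simp only [fcuB]
  push_cast
  congr 2
  ring

theorem fcu_Wcoef (N : ℕ) (τ ξ ζ : ℂ) (α : Fin N × Fin N) :
    Wcoef N α ξ ζ τ = 1 / N * fcuW N τ (ζ / N) ξ (fcuB α) := by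
  rw [Wcoef, fcu_jB, fcu_jB, fcuW_def]
  rw [show Real.pi * I * ((fcuB α).1 / N : ℂ) ^ 2 * τ + 2 * Real.pi * I * ((fcuB α).1 / N) * (ξ + ζ / N + 1/2 + (fcuB α).2 / N) =
    2 * Real.pi * I * ((fcuB α).1 * ξ / N) + (Real.pi * I * ((fcuB α).1 / N : ℂ) ^ 2 * τ + 2 * Real.pi * I * ((fcuB α).1 / N) * (ζ / N + 1/2 + (fcuB α).2 / N)) by ring,
    Complex.exp_add, show ξ + ζ / N + ((fcuB α).1 * τ + (fcuB α).2) / N = ξ + fcuX N τ (ζ / N) (fcuB α) by unfold fcuX; ring]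
  have := Complex.exp_ne_zero (Real.pi * I * ((fcuB α).1 / N : ℂ) ^ 2 * τ + 2 * Real.pi * I * ((fcuB α).1 / N) * (ζ / N + 1/2 + (fcuB α).2 / N))
  generalize cexp (Real.pi * I * ((fcuB α).1 / N : ℂ) ^ 2 * τ + 2 * Real.pi * I * ((fcuB α).1 / N) * (ζ / N + 1/2 + (fcuB α).2 / N)) = E at *
  change _ / (_ * (E * fcuT τ (fcuX N τ (ζ / N) (fcuB α)))) = _
  generalize fcuT τ (fcuX N τ (ζ / N) (fcuB α)) = t
  rw [mul_left_comm, mul_comm (cexp _), mul_assoc, mul_div_mul_left _ _ this, one_div, div_mul_eq_div_div_swap, inv_mul_eq_div]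

theorem fcu_sumM (N : ℕ) (hN : N ≠ 0) (τ ξ ζ : ℂ) :
    ∑ α : Fin N × Fin N, Wcoef N α ξ ζ τ • (Imat N α ⊗ₖ (Imat N α)⁻¹) = (1 / N : ℂ) • fcuM N τ ζ ξ := by
  unfold fcuM
  rw [Finset.smul_sum]
  refine Finset.sum_congr rfl fun α _ => ?_
  rw [fcu_Wcoef, fcu_Imat N hN, fcuJ_inv N hN, Matrix.kronecker_smul, smul_smul]
  simp only [fcuK, smul_smul, mul_assoc]

theorem fcu_gen_zeta (N : ℕ) (hN : N ≠ 0) (τ : ℂ) (hτ : 0 < τ.im) (ζ : ℂ) (h : ∀ α : Fin N × Fin N,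
    jTheta (1/2 + (α.1 : ℕ) / N) (1/2 + (α.2 : ℕ) / N) (ζ / N) τ ≠ 0) : fcuT τ ζ ≠ 0 := by
  have hN' : (N : ℂ) ≠ 0 := Nat.cast_ne_zero.2 hN
  have h' : ∀ α : Fin N × Fin N, fcuT τ (ζ / N + ((fcuB α).1 * τ + (fcuB α).2) / N) ≠ 0 := by
    intro α
    have := h α
    rw [fcu_jB] at this
    exact right_ne_zero_of_mul this
  let γ₀ : Fin N × Fin N := (⟨0, Nat.pos_of_ne_zero hN⟩, ⟨0, Nat.pos_of_ne_zero hN⟩)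
  have hne : ∃ u, fcuT τ u ≠ 0 := ⟨_, h' γ₀⟩
  intro h0
  obtain ⟨m, n, hmn⟩ := (fcuT_zero_iff τ hτ hne _).1 h0
  have hNpos : (0 : ℤ) < N := by omega
  have key : ∀ k : ℤ, ∃ a : Fin N, ∃ l : ℤ, k + ((a : ℕ) : ℤ) = N * l := by
    intro k
    refine ⟨⟨((-k) % N).toNat, by
      have := Int.emod_lt_of_pos (-k) hNpos
      have := Int.emod_nonneg (-k) hNpos.ne'
      omega⟩, -((-k) / N), ?_⟩
    have := Int.emod_nonneg (-k) hNpos.ne'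
    have h3 := Int.mul_ediv_add_emod (-k) N
    simp only [Int.toNat_of_nonneg this]
    linarith
  obtain ⟨a, l, ha⟩ := key n
  obtain ⟨b, l', hb⟩ := key m
  apply h' (a, b)
  apply (fcuT_zero_iff τ hτ hne _).2
  refine ⟨l', l, ?_⟩
  have ha' : (n : ℂ) + ((a : ℕ) : ℂ) = N * l := by exact_mod_cast congrArg (Int.cast (R := ℂ)) ha
  have hb' : (m : ℂ) + ((b : ℕ) : ℂ) = N * l' := by exact_mod_cast congrArg (Int.cast (R := ℂ)) hb
  rw [hmn, ← add_div, div_eq_iff hN']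
  simp only [fcuB]
  push_cast
  linear_combination τ * ha' + hb'

theorem fcu_epi_add (x y : ℂ) : eπ (x + y) = eπ x * eπ y := by
  unfold eπ; rw [← Complex.exp_add]; ring_nf

theorem fcu_epi_ne (x : ℂ) : eπ x ≠ 0 := Complex.exp_ne_zero _

theorem fcu_epi_inv (x : ℂ) : (eπ x)⁻¹ = eπ (-x) := by
  unfold eπ; rw [← Complex.exp_neg]; ring_nf

theorem fcu_epi_norm (x : ℂ) (hx : 0 < x.im) : ‖eπ x‖ < 1 := by
  unfold eπ
  rw [Complex.norm_exp]
  have : 0 < Real.pi * x.im := by positivity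
  simp
  nlinarith

theorem fcu_im_N (N : ℕ) (hN : N ≠ 0) (ζ : ℂ) (hζ : 0 < ζ.im) : 0 < (2 * N * ζ).im := by
  have : (0 : ℝ) < N := by exact_mod_cast Nat.pos_of_ne_zero hN
  have e : (2 * N * ζ).im = 2 * N * ζ.im := by simp
  rw [e]; positivity

noncomputable def fcuA (τ x : ℂ) : ℂ := poch1 (eπ (2 * x)) (eπ (2 * τ))

noncomputable def fcuD (N : ℕ) (ζ τ x : ℂ) : ℂ := poch2 (eπ (2 * x)) (eπ (2 * τ)) (eπ (2 * N * ζ))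

theorem fcuD_succ (N : ℕ) (hN : N ≠ 0) (ζ τ x y : ℂ) (hτ : 0 < τ.im) (hζ : 0 < ζ.im) (h : y = x + N * ζ) :
    fcuD N ζ τ x = fcuA τ x * fcuD N ζ τ y := by
  subst h
  unfold fcuD fcuA
  rw [fcu_poch2_succ _ _ _ (fcu_epi_norm _ (by simpa using hτ)) (fcu_epi_norm _ (fcu_im_N N hN ζ hζ)), ← fcu_epi_add]
  congr 3
  ring

theorem fcu_kNum (N : ℕ) (ζ τ ξ : ℂ) : kappaNum N ξ ζ τ =
    fcuD N ζ τ (N * ζ - ξ) * fcuD N ζ τ (ζ + ξ) * fcuD N ζ τ (τ - ξ) * fcuD N ζ τ (τ + (N - 1) * ζ + ξ) := by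
  unfold kappaNum fcuD
  congr 1
  · congr 1
    · congr 1
      · congr 2; ring
      · congr 2; ring
    · congr 2; ring
  · congr 2; ring

theorem fcu_kDen (N : ℕ) (ζ τ ξ : ℂ) : kappaDen N ξ ζ τ =
    fcuD N ζ τ (N * ζ + ξ) * fcuD N ζ τ (ζ - ξ) * fcuD N ζ τ (τ + ξ) * fcuD N ζ τ (τ + (N - 1) * ζ - ξ) := by
  rw [kappaDen, fcu_kNum]
  simp only [sub_neg_eq_add, ← sub_eq_add_neg]

theorem fcu_F_A (τ u : ℂ) : fcuA τ u * fcuA τ (τ - u) = eπ u * fcuF τ u := by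
  unfold fcuA fcuF
  rw [← mul_assoc, show cexp (-(Real.pi * I * u)) = (eπ u)⁻¹ by unfold eπ; rw [Complex.exp_neg],
    mul_inv_cancel₀ (fcu_epi_ne u), one_mul]
  unfold eπ
  rw [← Complex.exp_add]
  congr 2 <;> ring_nf

theorem fcu_kappa (N : ℕ) (hN : N ≠ 0) (ζ τ ξ : ℂ) (hτ : 0 < τ.im) (hζ : 0 < ζ.im) :
    kappaNum N (ξ + N * ζ) ζ τ * kappaDen N ξ ζ τ * (fcuT τ (ζ + ξ) * fcuT τ (ζ - (ξ + N * ζ))) =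
    -(eπ ((2 * N - 2) * ζ) * (kappaNum N ξ ζ τ * kappaDen N (ξ + N * ζ) ζ τ * (fcuT τ ξ * fcuT τ (ξ + N * ζ)))) := by
  have S := fun x y => fcuD_succ N hN ζ τ x y hτ hζ
  have e1 : kappaNum N (ξ + N * ζ) ζ τ * (fcuA τ (ζ + ξ) * fcuA τ (τ - (ζ - (ξ + N * ζ)))) =
      kappaNum N ξ ζ τ * (fcuA τ (-ξ) * fcuA τ (τ - (ξ + N * ζ))) := by
    rw [fcu_kNum, fcu_kNum]
    rw [S (N * ζ - (ξ + N * ζ)) (N * ζ - ξ) (by ring), S (ζ + ξ) (ζ + (ξ + N * ζ)) (by ring),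
      S (τ - (ξ + N * ζ)) (τ - ξ) (by ring), S (τ + (N - 1) * ζ + ξ) (τ + (N - 1) * ζ + (ξ + N * ζ)) (by ring)]
    rw [show N * ζ - (ξ + N * ζ) = -ξ by ring, show τ - (ζ - (ξ + N * ζ)) = τ + (N - 1) * ζ + ξ by ring]
    ring
  have e2 : kappaDen N (ξ + N * ζ) ζ τ * (fcuA τ (ξ + N * ζ) * fcuA τ (τ - -ξ)) =
      kappaDen N ξ ζ τ * (fcuA τ (ζ - (ξ + N * ζ)) * fcuA τ (τ - (ζ + ξ))) := by
    rw [fcu_kDen, fcu_kDen]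
    rw [S (N * ζ + ξ) (N * ζ + (ξ + N * ζ)) (by ring), S (ζ - (ξ + N * ζ)) (ζ - ξ) (by ring),
      S (τ + ξ) (τ + (ξ + N * ζ)) (by ring), S (τ + (N - 1) * ζ - (ξ + N * ζ)) (τ + (N - 1) * ζ - ξ) (by ring)]
    rw [show N * ζ + ξ = ξ + N * ζ by ring, show τ - -ξ = τ + ξ by ring, show τ - (ζ + ξ) = τ + (N - 1) * ζ - (ξ + N * ζ) by ring]
    ring
  have f1 := fcu_F_A τ (ζ + ξ)
  have f2 := fcu_F_A τ (ζ - (ξ + N * ζ))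
  have f3 := fcu_F_A τ (-ξ)
  have f4 := fcu_F_A τ (ξ + N * ζ)
  obtain ⟨K, hK⟩ := fcuT_prod τ hτ
  have e3 : kappaNum N (ξ + N * ζ) ζ τ * kappaDen N ξ ζ τ * ((eπ (ζ + ξ) * fcuF τ (ζ + ξ)) * (eπ (ζ - (ξ + N * ζ)) * fcuF τ (ζ - (ξ + N * ζ)))) =
      kappaNum N ξ ζ τ * kappaDen N (ξ + N * ζ) ζ τ * ((eπ (-ξ) * fcuF τ (-ξ)) * (eπ (ξ + N * ζ) * fcuF τ (ξ + N * ζ))) := by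
    rw [← f1, ← f2, ← f3, ← f4]
    generalize kappaNum N (ξ + N * ζ) ζ τ = a at *
    generalize kappaNum N ξ ζ τ = b at *
    generalize kappaDen N (ξ + N * ζ) ζ τ = c at *
    generalize kappaDen N ξ ζ τ = d at *
    linear_combination (d * (fcuA τ (ζ - (ξ + N * ζ)) * fcuA τ (τ - (ζ + ξ)))) * e1 - b * (fcuA τ (-ξ) * fcuA τ (τ - (ξ + N * ζ))) * e2
  have g1 : eπ (ζ + ξ) * eπ (ζ - (ξ + N * ζ)) = eπ ((2 - N) * ζ) := by rw [← fcu_epi_add]; congr 1; ring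
  have g2 : eπ (-ξ) * eπ (ξ + N * ζ) = eπ ((2 - N) * ζ) * eπ ((2 * N - 2) * ζ) := by rw [← fcu_epi_add, ← fcu_epi_add]; congr 1; ring
  have e4 : eπ ((2 - N) * ζ) * (kappaNum N (ξ + N * ζ) ζ τ * kappaDen N ξ ζ τ * (fcuF τ (ζ + ξ) * fcuF τ (ζ - (ξ + N * ζ)))) =
    eπ ((2 - N) * ζ) * (eπ ((2 * N - 2) * ζ) * (kappaNum N ξ ζ τ * kappaDen N (ξ + N * ζ) ζ τ * (fcuF τ (-ξ) * fcuF τ (ξ + N * ζ)))) := by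
    linear_combination e3 - (kappaNum N (ξ + N * ζ) ζ τ * kappaDen N ξ ζ τ * (fcuF τ (ζ + ξ) * fcuF τ (ζ - (ξ + N * ζ)))) * g1 +
      (kappaNum N ξ ζ τ * kappaDen N (ξ + N * ζ) ζ τ * (fcuF τ (-ξ) * fcuF τ (ξ + N * ζ))) * g2
  have e5 := mul_left_cancel₀ (fcu_epi_ne _) e4
  have h := fcuT_neg τ (-ξ)
  rw [neg_neg] at h
  rw [h, hK, hK, hK, hK]
  linear_combination K ^ 2 * e5

theorem fcu_phi_ne (N : ℕ) (hN : N ≠ 0) (ζ τ ξ : ℂ) (hτ : 0 < τ.im) (hζ : 0 < ζ.im) (hne : ∃ u, fcuT τ u ≠ 0)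
    (h1 : kappaNum N ξ ζ τ ≠ 0) (h2 : kappaDen N (ξ + N * ζ) ζ τ ≠ 0) : fcuT τ (ζ - (ξ + N * ζ)) ≠ 0 := by
  have S := fun x y => fcuD_succ N hN ζ τ x y hτ hζ
  obtain ⟨K, hK⟩ := fcuT_prod τ hτ
  obtain ⟨u, hu⟩ := hne
  have hK0 : K ≠ 0 := by rintro rfl; simp [hK] at hu
  rw [fcu_kNum, S (τ + (N - 1) * ζ + ξ) (τ + (N - 1) * ζ + (ξ + N * ζ)) (by ring)] at h1
  rw [fcu_kDen, S (ζ - (ξ + N * ζ)) (ζ - ξ) (by ring)] at h2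
  have a1 : fcuA τ (τ - (ζ - (ξ + N * ζ))) ≠ 0 := by
    rw [show τ - (ζ - (ξ + N * ζ)) = τ + (N - 1) * ζ + ξ by ring]
    exact left_ne_zero_of_mul (right_ne_zero_of_mul h1)
  have a2 : fcuA τ (ζ - (ξ + N * ζ)) ≠ 0 :=
    left_ne_zero_of_mul (right_ne_zero_of_mul (left_ne_zero_of_mul (left_ne_zero_of_mul h2)))
  have := mul_ne_zero a2 a1
  rw [fcu_F_A] at this
  rw [hK]
  exact mul_ne_zero hK0 (right_ne_zero_of_mul this)

theorem fcu_tau (N : ℕ) (hN : N ≠ 0) (ζ u : ℂ) (hζ : 0 < ζ.im) : tauNe N ζ (u - N * ζ) = tauNe N ζ u := by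
  have hN' : (N : ℂ) ≠ 0 := Nat.cast_ne_zero.2 hN
  have hs := fcu_epi_norm _ (fcu_im_N N hN ζ hζ)
  have h1 := fcu_ThetaF_shift (eπ (2 * N * ζ)) (eπ (ζ + 2 * (u - N * ζ))) hs (fcu_epi_ne _) (fcu_epi_ne _)
  have h2 := fcu_ThetaF_shift (eπ (2 * N * ζ)) (eπ (ζ - 2 * u)) hs (fcu_epi_ne _) (fcu_epi_ne _)
  rw [← fcu_epi_add, fcu_epi_inv] at h1 h2
  rw [show 2 * N * ζ + (ζ + 2 * (u - N * ζ)) = ζ + 2 * u by ring] at h1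
  rw [show 2 * N * ζ + (ζ - 2 * u) = ζ - 2 * (u - N * ζ) by ring] at h2
  unfold tauNe
  rw [h1, h2, show (u - N * ζ) * (2 / N - 2) = u * (2 / N - 2) + (2 * N - 2) * ζ by field_simp; ring, fcu_epi_add]
  have e : eπ ((2 * N - 2) * ζ) * (eπ (-(ζ - 2 * u)))⁻¹ = eπ (-(ζ + 2 * (u - N * ζ))) := by
    rw [fcu_epi_inv, ← fcu_epi_add]; congr 1; ring
  rw [← e]
  generalize eπ (-(ζ - 2 * u)) = a at *
  generalize ThetaF (eπ (2 * N * ζ)) (eπ (ζ + 2 * (u - N * ζ))) = b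
  generalize ThetaF (eπ (2 * N * ζ)) (eπ (ζ - 2 * u)) = d
  rw [neg_mul, div_neg, div_mul_eq_div_div]
  ring

noncomputable def fcuG (N : ℕ) (j : Fin N) : ℂ := eπ ((((j : ℕ) : ℂ) + 1) / N)

/-- conjugation by `g^{1/2} ⊗ g^{1/2}` -/
noncomputable def fcuConj (N : ℕ) (X : Matrix (Fin N × Fin N) (Fin N × Fin N) ℂ) : Matrix (Fin N × Fin N) (Fin N × Fin N) ℂ :=
  Matrix.diagonal (fun a : Fin N × Fin N => fcuG N a.1 * fcuG N a.2) * X *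
    Matrix.diagonal (fun a : Fin N × Fin N => (fcuG N a.1 * fcuG N a.2)⁻¹)

noncomputable def fcuConj' (N : ℕ) (X : Matrix (Fin N × Fin N) (Fin N × Fin N) ℂ) : Matrix (Fin N × Fin N) (Fin N × Fin N) ℂ :=
  Matrix.diagonal (fun a : Fin N × Fin N => (fcuG N a.1)⁻¹ * fcuG N a.2) * X *
    Matrix.diagonal (fun a : Fin N × Fin N => ((fcuG N a.1)⁻¹ * fcuG N a.2)⁻¹)

theorem fcu_diag_conj {A : Type} [Fintype A] [DecidableEq A] (d : A → ℂ) (hd : ∀ a, d a ≠ 0) (X Y : Matrix A A ℂ) (c : ℂ)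
    (h : X * Y = c • 1) :
    (Matrix.diagonal d * X * Matrix.diagonal (fun a => (d a)⁻¹)) * (Matrix.diagonal d * Y * Matrix.diagonal (fun a => (d a)⁻¹)) = c • 1 := by
  have h1 : Matrix.diagonal (fun a => (d a)⁻¹) * Matrix.diagonal d = 1 := by
    rw [Matrix.diagonal_mul_diagonal, ← Matrix.diagonal_one]
    congr 1; funext a; exact inv_mul_cancel₀ (hd a)
  have h2 : Matrix.diagonal d * Matrix.diagonal (fun a => (d a)⁻¹) = 1 := by
    rw [Matrix.diagonal_mul_diagonal, ← Matrix.diagonal_one]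
    congr 1; funext a; exact mul_inv_cancel₀ (hd a)
  calc _ = Matrix.diagonal d * X * (Matrix.diagonal (fun a => (d a)⁻¹) * Matrix.diagonal d) * Y * Matrix.diagonal (fun a => (d a)⁻¹) := by
        simp only [Matrix.mul_assoc]
    _ = Matrix.diagonal d * (X * Y) * Matrix.diagonal (fun a => (d a)⁻¹) := by
        rw [h1]; simp only [Matrix.mul_assoc, Matrix.one_mul]
    _ = c • 1 := by rw [h, Matrix.mul_smul, Matrix.smul_mul, Matrix.mul_one, h2]

theorem fcuG_ne (N : ℕ) (j : Fin N) : fcuG N j ≠ 0 := fcu_epi_ne _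

theorem fcuP_conj (N : ℕ) (X : Matrix (Fin N × Fin N) (Fin N × Fin N) ℂ) : fcuP (fcuConj N X) = fcuConj' N (fcuP X) := by
  ext a b
  simp only [fcuP, fcuConj, fcuConj', Matrix.of_apply, Matrix.mul_diagonal, Matrix.diagonal_mul]
  rw [mul_inv, mul_inv, inv_inv]
  ring

theorem fcu_gg (N : ℕ) (X : Matrix (Fin N × Fin N) (Fin N × Fin N) ℂ) :
    (gHalf N ⊗ₖ gHalf N) * X * (gHalf N ⊗ₖ gHalf N)⁻¹ = fcuConj N X := by
  have e : gHalf N ⊗ₖ gHalf N = Matrix.diagonal (fun a : Fin N × Fin N => fcuG N a.1 * fcuG N a.2) := by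
    unfold gHalf
    rw [Matrix.diagonal_kronecker_diagonal]; rfl
  rw [e, Matrix.inv_eq_right_inv (B := Matrix.diagonal (fun a : Fin N × Fin N => (fcuG N a.1 * fcuG N a.2)⁻¹))]
  · rfl
  · rw [Matrix.diagonal_mul_diagonal, ← Matrix.diagonal_one]
    congr 1; funext a; exact mul_inv_cancel₀ (mul_ne_zero (fcuG_ne _ _) (fcuG_ne _ _))

noncomputable def fcuL (N : ℕ) (ξ ζ τ : ℂ) : ℂ := tauNe N ζ (ζ / 2 - ξ) * ((eπ (ξ * (2 / N - 2)) * (kappaNum N ξ ζ τ / kappaDen N ξ ζ τ) *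
      fcuT τ ζ / fcuT τ (ξ + ζ)) * (1 / N))

theorem fcuConj_smul (N : ℕ) (c : ℂ) (X : Matrix (Fin N × Fin N) (Fin N × Fin N) ℂ) : fcuConj N (c • X) = c • fcuConj N X := by
  simp [fcuConj]

theorem fcu_Rhat (N : ℕ) (hN : N ≠ 0) (ξ ζ τ : ℂ) : Rhat N ξ ζ τ = fcuL N ξ ζ τ • fcuConj N (fcuM N τ ζ ξ) := by
  rw [Rhat, Rmat, fcu_gg, Zmat, fcu_sumM N hN, smul_smul, fcuConj_smul, smul_smul]
  rfl

theorem fcu_lambda (N : ℕ) (hN : N ≠ 0) (ξ ζ τ : ℂ) (hτ : 0 < τ.im) (hζ : 0 < ζ.im)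
    (h1 : Rgeneric N ξ ζ τ) (h2 : Rgeneric N (ξ + N * ζ) ζ τ) :
    fcuL N ξ ζ τ * (-(N ^ 2 * (fcuT τ ξ * fcuT τ (ξ + N * ζ)) / fcuT τ ζ ^ 2)) =
    fcuL N (ξ + N * ζ) ζ τ * (N ^ 2 * (fcuT τ (ζ + (ξ + N * ζ)) * fcuT τ (ζ - (ξ + N * ζ))) / fcuT τ ζ ^ 2) := by
  have hN' : (N : ℂ) ≠ 0 := Nat.cast_ne_zero.2 hN
  obtain ⟨t1, hW, k1⟩ := h1
  obtain ⟨t2, -, k2⟩ := h2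
  have hz := fcu_gen_zeta N hN τ hτ ζ hW
  change fcuT τ (ξ + ζ) ≠ 0 at t1
  change fcuT τ (ξ + N * ζ + ζ) ≠ 0 at t2
  have key := fcu_kappa N hN ζ τ ξ hτ hζ
  unfold fcuL
  rw [show ζ / 2 - (ξ + N * ζ) = (ζ / 2 - ξ) - N * ζ by ring, fcu_tau N hN ζ _ hζ]
  have ee : eπ (ξ * (2 / N - 2)) = eπ ((ξ + N * ζ) * (2 / N - 2)) * eπ ((2 * N - 2) * ζ) := by
    rw [← fcu_epi_add]; congr 1; field_simp; ring
  rw [ee, add_comm ζ (ξ + N * ζ)]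
  rw [add_comm ζ ξ] at key
  have q := fcu_epi_ne ((ξ + N * ζ) * (2 / N - 2))
  generalize eπ ((ξ + N * ζ) * (2 / N - 2)) = E at *
  generalize eπ ((2 * N - 2) * ζ) = E2 at *
  generalize tauNe N ζ (ζ / 2 - ξ) = t
  generalize fcuT τ (ξ + N * ζ + ζ) = a1 at *
  generalize fcuT τ (ζ - (ξ + N * ζ)) = a2 at *
  generalize fcuT τ (ξ + N * ζ) = a3 at *
  generalize fcuT τ (ξ + ζ) = a4 at *
  generalize fcuT τ ξ = a5 at *
  generalize fcuT τ ζ = a6 at *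
  generalize kappaNum N (ξ + N * ζ) ζ τ = b1 at *
  generalize kappaNum N ξ ζ τ = b2 at *
  generalize kappaDen N (ξ + N * ζ) ζ τ = b3 at *
  generalize kappaDen N ξ ζ τ = b4 at *
  field_simp
  linear_combination -t * key

theorem fcu_single (N : ℕ) (hN : N ≠ 0) (ξ ζ τ : ℂ) (hτ : 0 < τ.im) (hζ : 0 < ζ.im)
    (h1 : Rgeneric N ξ ζ τ) (h2 : Rgeneric N (ξ + N * ζ) ζ τ) (r1 : Rhat N ξ ζ τ ≠ 0) (r2 : Rhat N (ξ + N * ζ) ζ τ ≠ 0) :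
    ∃ Q : Matrix (Fin N × Fin N) (Fin N × Fin N) ℂ, Rhat N (ξ + N * ζ) ζ τ * Q = 1 ∧ fcuP (Rhat N ξ ζ τ) * fcuP Q = 1 := by
  have hN' : (N : ℂ) ≠ 0 := Nat.cast_ne_zero.2 hN
  have key := fcu_lambda N hN ξ ζ τ hτ hζ h1 h2
  have hz := fcu_gen_zeta N hN τ hτ ζ h1.2.1
  rw [fcu_Rhat N hN] at r1 r2
  have l1 : fcuL N ξ ζ τ ≠ 0 := by intro h; simp [h] at r1
  have l2 : fcuL N (ξ + N * ζ) ζ τ ≠ 0 := by intro h; simp [h] at r2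
  have kn : kappaNum N ξ ζ τ ≠ 0 := by intro h; simp [fcuL, h] at l1
  have p1 := fcu_phi_ne N hN ζ τ ξ hτ hζ ⟨ζ, hz⟩ kn h2.2.2
  have p2 : fcuT τ (ζ + (ξ + N * ζ)) ≠ 0 := by rw [add_comm]; exact h2.1
  have u1 := fcuM_unit N hN τ hτ ζ hz (ξ + N * ζ)
  have u2 := fcuM_cross N hN τ hτ ζ hz ξ
  rw [show -ξ - N * ζ = -(ξ + N * ζ) by ring] at u2
  set φ := (N : ℂ) ^ 2 * (fcuT τ (ζ + (ξ + N * ζ)) * fcuT τ (ζ - (ξ + N * ζ))) / fcuT τ ζ ^ 2 with hφ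
  have φ0 : φ ≠ 0 := by
    rw [hφ]
    exact div_ne_zero (mul_ne_zero (pow_ne_zero _ hN') (mul_ne_zero p2 p1)) (pow_ne_zero _ hz)
  have v1 := fcu_diag_conj (fun a : Fin N × Fin N => fcuG N a.1 * fcuG N a.2) (fun a => mul_ne_zero (fcuG_ne _ _) (fcuG_ne _ _)) _ _ _ u1
  have v2 := fcu_diag_conj (fun a : Fin N × Fin N => (fcuG N a.1)⁻¹ * fcuG N a.2) (fun a => mul_ne_zero (inv_ne_zero (fcuG_ne _ _)) (fcuG_ne _ _)) _ _ _ u2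
  change fcuConj N _ * fcuConj N _ = _ at v1
  change fcuConj' N _ * fcuConj' N _ = _ at v2
  rw [← fcuP_conj, ← fcuP_conj] at v2
  refine ⟨(fcuL N (ξ + N * ζ) ζ τ * φ)⁻¹ • fcuConj N (fcuM' N τ ζ (-(ξ + N * ζ))), ?_, ?_⟩
  · rw [fcu_Rhat N hN, Matrix.smul_mul, Matrix.mul_smul, v1, smul_smul, smul_smul]
    rw [mul_right_comm, mul_inv_cancel₀ (mul_ne_zero l2 φ0), one_smul]
  · rw [fcu_Rhat N hN, fcuP_smul, fcuP_smul, Matrix.smul_mul, Matrix.mul_smul, v2, smul_smul, smul_smul, ← key]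
    have hk : fcuL N ξ ζ τ * (-(N ^ 2 * (fcuT τ ξ * fcuT τ (ξ + N * ζ)) / fcuT τ ζ ^ 2)) ≠ 0 := by
      rw [key]; exact mul_ne_zero l2 φ0
    generalize -((N : ℂ) ^ 2 * (fcuT τ ξ * fcuT τ (ξ + N * ζ)) / fcuT τ ζ ^ 2) = ψ at *
    rw [mul_right_comm, mul_inv_cancel₀ hk, one_smul]

/-- one-site operators -/
noncomputable def fcuSt {N : ℕ} {κ : Type} [Fintype κ] [DecidableEq κ] (i : κ) (A : Matrix (Fin N) (Fin N) ℂ) :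
    Matrix (κ → Fin N) (κ → Fin N) ℂ :=
  (A ⊗ₖ (1 : Matrix ({j // j ≠ i} → Fin N) ({j // j ≠ i} → Fin N) ℂ)).submatrix (Equiv.funSplitAt i (Fin N)) (Equiv.funSplitAt i (Fin N))

section
variable {N : ℕ} {κ : Type} [Fintype κ] [DecidableEq κ]

theorem fcuSt_mul (i : κ) (A B : Matrix (Fin N) (Fin N) ℂ) : fcuSt i A * fcuSt i B = fcuSt i (A * B) := by
  unfold fcuSt
  rw [Matrix.submatrix_mul_equiv, ← Matrix.mul_kronecker_mul, Matrix.one_mul]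

theorem fcuSt_one (i : κ) : fcuSt i (1 : Matrix (Fin N) (Fin N) ℂ) = 1 := by
  unfold fcuSt
  rw [Matrix.one_kronecker_one, Matrix.submatrix_one_equiv]

theorem fcuSt_apply (i : κ) (A : Matrix (Fin N) (Fin N) ℂ) (x y : κ → Fin N) :
    fcuSt i A x y = A (x i) (y i) * (if ∀ l, l ≠ i → x l = y l then 1 else 0) := by
  unfold fcuSt
  simp only [Matrix.submatrix_apply, Matrix.kroneckerMap_apply, Equiv.funSplitAt_apply, Matrix.one_apply, funext_iff, Subtype.forall]

theorem fcuSt_pair (i j : κ) (hij : i ≠ j) (A B : Matrix (Fin N) (Fin N) ℂ) (x y : κ → Fin N) :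
    (fcuSt i A * fcuSt j B) x y = if ∀ l, l ≠ i → l ≠ j → x l = y l then A (x i) (y i) * B (x j) (y j) else 0 := by
  rw [Matrix.mul_apply, Finset.sum_eq_single (Function.update x i (y i))]
  · rw [fcuSt_apply, fcuSt_apply]
    rw [if_pos (by intro l hl; rw [Function.update_of_ne hl])]
    rw [Function.update_self, Function.update_of_ne hij.symm, mul_one]
    by_cases h : ∀ l, l ≠ i → l ≠ j → x l = y l
    · rw [if_pos h, if_pos, mul_one]
      intro l hl
      by_cases hli : l = i
      · subst hli; simp
      · rw [Function.update_of_ne hli]; exact h l hli hl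
    · rw [if_neg h, if_neg, mul_zero, mul_zero]
      intro h'
      apply h
      intro l hli hlj
      have := h' l hlj
      rwa [Function.update_of_ne hli] at this
  · intro w _ hw
    rw [fcuSt_apply, fcuSt_apply]
    by_cases h1 : ∀ l, l ≠ i → x l = w l
    · by_cases h2 : ∀ l, l ≠ j → w l = y l
      · exfalso
        apply hw
        funext l
        by_cases hli : l = i
        · subst hli; rw [Function.update_self]; exact h2 _ hij
        · rw [Function.update_of_ne hli]; exact (h1 l hli).symm
      · rw [if_neg h2]; simp
    · rw [if_neg h1]; simp
  · simp

theorem fcuSt_comm (i j : κ) (hij : i ≠ j) (A B : Matrix (Fin N) (Fin N) ℂ) : fcuSt i A * fcuSt j B = fcuSt j B * fcuSt i A := by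
  ext x y
  rw [fcuSt_pair i j hij, fcuSt_pair j i hij.symm, mul_comm]
  congr 1
  exact propext ⟨fun h l h1 h2 => h l h2 h1, fun h l h1 h2 => h l h2 h1⟩

/-- operators commuting with all sites outside `L` -/
def fcuCen (L : Set κ) : Set (Matrix (κ → Fin N) (κ → Fin N) ℂ) :=
  {A | ∀ i, i ∉ L → ∀ B : Matrix (Fin N) (Fin N) ℂ, fcuSt i B * A = A * fcuSt i B}

/-- operators at one site -/
def fcuRan (i : κ) : Set (Matrix (κ → Fin N) (κ → Fin N) ℂ) := Set.range (fcuSt i)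

theorem fcuCen_one (L : Set κ) : (1 : Matrix (κ → Fin N) (κ → Fin N) ℂ) ∈ fcuCen L := by
  intro i _ B; rw [Matrix.mul_one, Matrix.one_mul]

theorem fcuCen_mul (L L₁ L₂ : Set κ) (h₁ : L₁ ⊆ L) (h₂ : L₂ ⊆ L) (A B : Matrix (κ → Fin N) (κ → Fin N) ℂ)
    (hA : A ∈ fcuCen L₁) (hB : B ∈ fcuCen L₂) : A * B ∈ fcuCen L := by
  intro i hi C
  rw [← Matrix.mul_assoc, hA i (fun h => hi (h₁ h)), Matrix.mul_assoc, hB i (fun h => hi (h₂ h)), Matrix.mul_assoc]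

theorem fcuRan_cen (i : κ) (A : Matrix (κ → Fin N) (κ → Fin N) ℂ) (hA : A ∈ fcuRan i) : A ∈ fcuCen {i} := by
  obtain ⟨a, rfl⟩ := hA
  intro j hj B
  exact fcuSt_comm j i hj B a

theorem fcuRan_mul (i : κ) (A B : Matrix (κ → Fin N) (κ → Fin N) ℂ) (hA : A ∈ fcuRan i) (hB : B ∈ fcuRan i) :
    A * B ∈ fcuRan i := by
  obtain ⟨a, rfl⟩ := hA
  obtain ⟨b, rfl⟩ := hB
  exact ⟨a * b, (fcuSt_mul i a b).symm⟩

theorem fcuRan_one (i : κ) : (1 : Matrix (κ → Fin N) (κ → Fin N) ℂ) ∈ fcuRan i := ⟨1, fcuSt_one i⟩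

end

section
variable {N k k' : ℕ}

noncomputable def fcuKr (A : Matrix (Fin k → Fin N) (Fin k → Fin N) ℂ) (B : Matrix (Fin k' → Fin N) (Fin k' → Fin N) ℂ) :
    Matrix (Fin k ⊕ Fin k' → Fin N) (Fin k ⊕ Fin k' → Fin N) ℂ :=
  (A ⊗ₖ B).submatrix (Equiv.sumArrowEquivProdArrow _ _ _) (Equiv.sumArrowEquivProdArrow _ _ _)

theorem fcuKr_mul (A A' : Matrix (Fin k → Fin N) (Fin k → Fin N) ℂ) (B B' : Matrix (Fin k' → Fin N) (Fin k' → Fin N) ℂ) :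
    fcuKr A B * fcuKr A' B' = fcuKr (A * A') (B * B') := by
  unfold fcuKr
  rw [Matrix.submatrix_mul_equiv, ← Matrix.mul_kronecker_mul]

theorem fcuKr_one : fcuKr (1 : Matrix (Fin k → Fin N) (Fin k → Fin N) ℂ) (1 : Matrix (Fin k' → Fin N) (Fin k' → Fin N) ℂ) = 1 := by
  unfold fcuKr
  rw [Matrix.one_kronecker_one, Matrix.submatrix_one_equiv]

theorem fcuKr_T (A : Matrix (Fin k → Fin N) (Fin k → Fin N) ℂ) (B : Matrix (Fin k' → Fin N) (Fin k' → Fin N) ℂ) :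
    ptFirst (fcuKr A B) = fcuKr Aᵀ B := by
  ext a b; rfl

theorem fcuT_add (M M' : Matrix (Fin k ⊕ Fin k' → Fin N) (Fin k ⊕ Fin k' → Fin N) ℂ) : ptFirst (M + M') = ptFirst M + ptFirst M' := by
  ext a b; rfl

theorem fcuT_smul (c : ℂ) (M : Matrix (Fin k ⊕ Fin k' → Fin N) (Fin k ⊕ Fin k' → Fin N) ℂ) : ptFirst (c • M) = c • ptFirst M := by
  ext a b; rfl

theorem fcuT_z : ptFirst (0 : Matrix (Fin k ⊕ Fin k' → Fin N) (Fin k ⊕ Fin k' → Fin N) ℂ) = 0 := by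
  ext a b; rfl

theorem fcuT_one' : ptFirst (1 : Matrix (Fin k ⊕ Fin k' → Fin N) (Fin k ⊕ Fin k' → Fin N) ℂ) = 1 := by
  rw [← fcuKr_one, fcuKr_T, Matrix.transpose_one]

/-- span of elementary tensors -/
def fcuSp (S : Set (Matrix (Fin k → Fin N) (Fin k → Fin N) ℂ)) (S' : Set (Matrix (Fin k' → Fin N) (Fin k' → Fin N) ℂ)) :
    Submodule ℂ (Matrix (Fin k ⊕ Fin k' → Fin N) (Fin k ⊕ Fin k' → Fin N) ℂ) :=
  Submodule.span ℂ {M | ∃ A ∈ S, ∃ B ∈ S', M = fcuKr A B}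

/-- bilinear induction on two spans -/
theorem fcuSp_ind (S₁ S₂ : Set (Matrix (Fin k → Fin N) (Fin k → Fin N) ℂ)) (S₁' S₂' : Set (Matrix (Fin k' → Fin N) (Fin k' → Fin N) ℂ))
    (p : Matrix (Fin k ⊕ Fin k' → Fin N) (Fin k ⊕ Fin k' → Fin N) ℂ → Matrix (Fin k ⊕ Fin k' → Fin N) (Fin k ⊕ Fin k' → Fin N) ℂ → Prop)
    (h0 : ∀ A ∈ S₁, ∀ B ∈ S₁', ∀ A' ∈ S₂, ∀ B' ∈ S₂', p (fcuKr A B) (fcuKr A' B'))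
    (z1 : ∀ M, p 0 M) (z2 : ∀ M, p M 0)
    (a1 : ∀ M M' M₂, p M M₂ → p M' M₂ → p (M + M') M₂)
    (a2 : ∀ M M' M₁, p M₁ M → p M₁ M' → p M₁ (M + M'))
    (s1 : ∀ (c : ℂ) M M₂, p M M₂ → p (c • M) M₂) (s2 : ∀ (c : ℂ) M M₁, p M₁ M → p M₁ (c • M))
    (M M' : Matrix (Fin k ⊕ Fin k' → Fin N) (Fin k ⊕ Fin k' → Fin N) ℂ) (hM : M ∈ fcuSp S₁ S₁') (hM' : M' ∈ fcuSp S₂ S₂') : p M M' := by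
  unfold fcuSp at hM hM'
  induction hM using Submodule.span_induction with
  | mem x hx =>
    obtain ⟨A, hA, B, hB, rfl⟩ := hx
    induction hM' using Submodule.span_induction with
    | mem y hy =>
      obtain ⟨A', hA', B', hB', rfl⟩ := hy
      exact h0 A hA B hB A' hA' B' hB'
    | zero => exact z2 _
    | add u v _ _ hu hv => exact a2 _ _ _ hu hv
    | smul c u _ hu => exact s2 _ _ _ hu
  | zero => exact z1 _
  | add u v _ _ hu hv => exact a1 _ _ _ hu hv
  | smul c u _ hu => exact s1 _ _ _ hu

theorem fcuSp_mul (S₁ S₂ S : Set (Matrix (Fin k → Fin N) (Fin k → Fin N) ℂ)) (S₁' S₂' S' : Set (Matrix (Fin k' → Fin N) (Fin k' → Fin N) ℂ))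
    (hA : ∀ A ∈ S₁, ∀ A' ∈ S₂, A * A' ∈ S) (hB : ∀ B ∈ S₁', ∀ B' ∈ S₂', B * B' ∈ S')
    (M M' : Matrix (Fin k ⊕ Fin k' → Fin N) (Fin k ⊕ Fin k' → Fin N) ℂ) (hM : M ∈ fcuSp S₁ S₁') (hM' : M' ∈ fcuSp S₂ S₂') :
    M * M' ∈ fcuSp S S' := by
  refine fcuSp_ind S₁ S₂ S₁' S₂' (fun M M' => M * M' ∈ fcuSp S S') ?_ ?_ ?_ ?_ ?_ ?_ ?_ M M' hM hM'
  · intro A hA' B hB' A₂ hA₂ B₂ hB₂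
    rw [fcuKr_mul]
    exact Submodule.subset_span ⟨_, hA _ hA' _ hA₂, _, hB _ hB' _ hB₂, rfl⟩
  · intro M; rw [Matrix.zero_mul]; exact Submodule.zero_mem _
  · intro M; rw [Matrix.mul_zero]; exact Submodule.zero_mem _
  · intro M M' M₂ h h'; rw [Matrix.add_mul]; exact Submodule.add_mem _ h h'
  · intro M M' M₂ h h'; rw [Matrix.mul_add]; exact Submodule.add_mem _ h h'
  · intro c M M₂ h; rw [Matrix.smul_mul]; exact Submodule.smul_mem _ _ h
  · intro c M M₂ h; rw [Matrix.mul_smul]; exact Submodule.smul_mem _ _ h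

theorem fcuSp_one (S : Set (Matrix (Fin k → Fin N) (Fin k → Fin N) ℂ)) (S' : Set (Matrix (Fin k' → Fin N) (Fin k' → Fin N) ℂ))
    (h : 1 ∈ S) (h' : 1 ∈ S') : 1 ∈ fcuSp S S' := Submodule.subset_span ⟨1, h, 1, h', fcuKr_one.symm⟩

theorem fcuSp_mono (S₁ S : Set (Matrix (Fin k → Fin N) (Fin k → Fin N) ℂ)) (S₁' S' : Set (Matrix (Fin k' → Fin N) (Fin k' → Fin N) ℂ))
    (h : S₁ ⊆ S) (h' : S₁' ⊆ S') : fcuSp S₁ S₁' ≤ fcuSp S S' := by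
  refine Submodule.span_mono ?_
  rintro _ ⟨A, hA, B, hB, rfl⟩
  exact ⟨A, h hA, B, h' hB, rfl⟩

theorem fcuT_mul_A (S₁ S₂ : Set (Matrix (Fin k → Fin N) (Fin k → Fin N) ℂ)) (S₁' S₂' : Set (Matrix (Fin k' → Fin N) (Fin k' → Fin N) ℂ))
    (hA : ∀ A ∈ S₁, ∀ A' ∈ S₂, A * A' = A' * A)
    (M M' : Matrix (Fin k ⊕ Fin k' → Fin N) (Fin k ⊕ Fin k' → Fin N) ℂ) (hM : M ∈ fcuSp S₁ S₁') (hM' : M' ∈ fcuSp S₂ S₂') :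
    ptFirst (M * M') = ptFirst M * ptFirst M' := by
  refine fcuSp_ind S₁ S₂ S₁' S₂' (fun M M' => ptFirst (M * M') = ptFirst M * ptFirst M') ?_ ?_ ?_ ?_ ?_ ?_ ?_ M M' hM hM'
  · intro A hA' B hB' A₂ hA₂ B₂ hB₂
    rw [fcuKr_mul, fcuKr_T, fcuKr_T, fcuKr_T, fcuKr_mul, ← Matrix.transpose_mul, hA A hA' A₂ hA₂]
  · intro M; simp only [Matrix.zero_mul, fcuT_z]
  · intro M; simp only [Matrix.mul_zero, fcuT_z]
  · intro M M' M₂ h h'; simp only [Matrix.add_mul, fcuT_add, h, h']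
  · intro M M' M₂ h h'; simp only [Matrix.mul_add, fcuT_add, h, h']
  · intro c M M₂ h; simp only [Matrix.smul_mul, fcuT_smul, h]
  · intro c M M₂ h; simp only [Matrix.mul_smul, fcuT_smul, h]

theorem fcuT_mul_B (S₁ S₂ : Set (Matrix (Fin k → Fin N) (Fin k → Fin N) ℂ)) (S₁' S₂' : Set (Matrix (Fin k' → Fin N) (Fin k' → Fin N) ℂ))
    (hB : ∀ B ∈ S₁', ∀ B' ∈ S₂', B * B' = B' * B)
    (M M' : Matrix (Fin k ⊕ Fin k' → Fin N) (Fin k ⊕ Fin k' → Fin N) ℂ) (hM : M ∈ fcuSp S₁ S₁') (hM' : M' ∈ fcuSp S₂ S₂') :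
    ptFirst (M * M') = ptFirst M' * ptFirst M := by
  refine fcuSp_ind S₁ S₂ S₁' S₂' (fun M M' => ptFirst (M * M') = ptFirst M' * ptFirst M) ?_ ?_ ?_ ?_ ?_ ?_ ?_ M M' hM hM'
  · intro A hA' B hB' A₂ hA₂ B₂ hB₂
    rw [fcuKr_mul, fcuKr_T, fcuKr_T, fcuKr_T, fcuKr_mul, Matrix.transpose_mul, hB B hB' B₂ hB₂]
  · intro M; simp only [Matrix.zero_mul, Matrix.mul_zero, fcuT_z]
  · intro M; simp only [Matrix.zero_mul, Matrix.mul_zero, fcuT_z]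
  · intro M M' M₂ h h'; simp only [Matrix.add_mul, Matrix.mul_add, fcuT_add, h, h']
  · intro M M' M₂ h h'; simp only [Matrix.add_mul, Matrix.mul_add, fcuT_add, h, h']
  · intro c M M₂ h; simp only [Matrix.smul_mul, Matrix.mul_smul, fcuT_smul, h]
  · intro c M M₂ h; simp only [Matrix.smul_mul, Matrix.mul_smul, fcuT_smul, h]

/-- the two-site action -/
noncomputable def fcuAc (i : Fin k) (j : Fin k') (M : Matrix (Fin N × Fin N) (Fin N × Fin N) ℂ) :
    Matrix (Fin k ⊕ Fin k' → Fin N) (Fin k ⊕ Fin k' → Fin N) ℂ := act2 (Sum.inl i) (Sum.inr j) M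

theorem fcuAc_add (i : Fin k) (j : Fin k') (M M' : Matrix (Fin N × Fin N) (Fin N × Fin N) ℂ) :
    fcuAc i j (M + M') = fcuAc i j M + fcuAc i j M' := by
  ext a b
  simp only [fcuAc, act2, Matrix.of_apply, Matrix.add_apply, mul_add]

theorem fcuAc_zero (i : Fin k) (j : Fin k') : fcuAc i j (0 : Matrix (Fin N × Fin N) (Fin N × Fin N) ℂ) = 0 := by
  ext a b
  simp [fcuAc, act2]

theorem fcuAc_kron (i : Fin k) (j : Fin k') (A B : Matrix (Fin N) (Fin N) ℂ) :
    fcuAc i j (A ⊗ₖ B) = fcuKr (fcuSt i A) (fcuSt j B) := by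
  ext a b
  change _ = fcuSt i A (fun l => a (Sum.inl l)) (fun l => b (Sum.inl l)) * fcuSt j B (fun l => a (Sum.inr l)) (fun l => b (Sum.inr l))
  rw [fcuSt_apply, fcuSt_apply]
  simp only [fcuAc, act2, Matrix.of_apply, Matrix.kroneckerMap_apply, Sum.forall, ne_eq, Sum.inl.injEq, Sum.inr.injEq,
    reduceCtorEq, not_false_eq_true, forall_const]
  by_cases h1 : ∀ l, ¬ l = i → a (Sum.inl l) = b (Sum.inl l)
  · by_cases h2 : ∀ l, ¬ l = j → a (Sum.inr l) = b (Sum.inr l)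
    · rw [if_pos h1, if_pos h2, if_pos ⟨h1, h2⟩]; ring
    · rw [if_neg h2, if_neg (fun h => h2 h.2)]; simp
  · rw [if_neg h1, if_neg (fun h => h1 h.1)]; simp

theorem fcuAc_ind (p : Matrix (Fin N × Fin N) (Fin N × Fin N) ℂ → Prop) (h0 : p 0) (ha : ∀ M M', p M → p M' → p (M + M'))
    (hk : ∀ A B : Matrix (Fin N) (Fin N) ℂ, p (A ⊗ₖ B)) (M : Matrix (Fin N × Fin N) (Fin N × Fin N) ℂ) : p M := by
  refine Matrix.induction_on' M h0 ha ?_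
  rintro ⟨a, c⟩ ⟨b, d⟩ x
  have := hk (Matrix.single a b x) (Matrix.single c d 1)
  rwa [Matrix.single_kronecker_single, mul_one] at this

theorem fcuAc_mul (i : Fin k) (j : Fin k') (M M' : Matrix (Fin N × Fin N) (Fin N × Fin N) ℂ) :
    fcuAc i j M * fcuAc i j M' = fcuAc i j (M * M') := by
  refine fcuAc_ind (fun M => fcuAc i j M * fcuAc i j M' = fcuAc i j (M * M')) ?_ ?_ ?_ M
  · simp only [fcuAc_zero, Matrix.zero_mul]
  · intro M M' h h'; simp only [fcuAc_add, Matrix.add_mul, h, h']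
  · intro A B
    refine fcuAc_ind (fun M' => fcuAc i j (A ⊗ₖ B) * fcuAc i j M' = fcuAc i j ((A ⊗ₖ B) * M')) ?_ ?_ ?_ M'
    · simp only [fcuAc_zero, Matrix.mul_zero]
    · intro M M' h h'; simp only [fcuAc_add, Matrix.mul_add, h, h']
    · intro A' B'
      rw [← Matrix.mul_kronecker_mul, fcuAc_kron, fcuAc_kron, fcuAc_kron, fcuKr_mul, fcuSt_mul, fcuSt_mul]

theorem fcuAc_one (i : Fin k) (j : Fin k') : fcuAc i j (1 : Matrix (Fin N × Fin N) (Fin N × Fin N) ℂ) = 1 := by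
  rw [← Matrix.one_kronecker_one, fcuAc_kron, fcuSt_one, fcuSt_one, fcuKr_one]

theorem fcuP_add (M M' : Matrix (Fin N × Fin N) (Fin N × Fin N) ℂ) : fcuP (M + M') = fcuP M + fcuP M' := by
  ext a b; rfl

theorem fcuSt_transpose (i : Fin k) (A : Matrix (Fin N) (Fin N) ℂ) : (fcuSt i A)ᵀ = fcuSt i Aᵀ := by
  ext x y
  rw [Matrix.transpose_apply, fcuSt_apply, fcuSt_apply, Matrix.transpose_apply]
  by_cases h : ∀ l, l ≠ i → x l = y l
  · rw [if_pos h, if_pos (fun l hl => (h l hl).symm)]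
  · rw [if_neg h, if_neg (fun h' => h (fun l hl => (h' l hl).symm))]

theorem fcuAc_T (i : Fin k) (j : Fin k') (M : Matrix (Fin N × Fin N) (Fin N × Fin N) ℂ) :
    ptFirst (fcuAc i j M) = fcuAc i j (fcuP M) := by
  refine fcuAc_ind (fun M => ptFirst (fcuAc i j M) = fcuAc i j (fcuP M)) ?_ ?_ ?_ M
  · rw [fcuAc_zero, fcuT_z]
    exact (fcuAc_zero i j).symm
  · intro M M' h h'; simp only [fcuAc_add, fcuT_add, fcuP_add, h, h']
  · intro A B
    rw [fcuAc_kron, fcuKr_T, fcuP_kron, fcuAc_kron, fcuSt_transpose]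

theorem fcuAc_mem (i : Fin k) (j : Fin k') (M : Matrix (Fin N × Fin N) (Fin N × Fin N) ℂ) :
    fcuAc i j M ∈ fcuSp (fcuRan i) (fcuRan j) := by
  refine fcuAc_ind (fun M => fcuAc i j M ∈ fcuSp (fcuRan i) (fcuRan j)) ?_ ?_ ?_ M
  · rw [fcuAc_zero]; exact Submodule.zero_mem _
  · intro M M' h h'; rw [fcuAc_add]; exact Submodule.add_mem _ h h'
  · intro A B
    rw [fcuAc_kron]
    exact Submodule.subset_span ⟨_, ⟨A, rfl⟩, _, ⟨B, rfl⟩, rfl⟩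

theorem fcu_inner (j : Fin k') (R R' Q : Fin k → Matrix (Fin N × Fin N) (Fin N × Fin N) ℂ)
    (h1 : ∀ i, R' i * Q i = 1) (h2 : ∀ i, fcuP (R i) * fcuP (Q i) = 1) (L : List (Fin k)) (hL : L.Nodup) :
    ∃ U, (L.map fun i => fcuAc i j (R' i)).prod * U = 1 ∧ ptFirst (L.map fun i => fcuAc i j (R i)).prod * ptFirst U = 1 ∧
      (L.map fun i => fcuAc i j (R i)).prod ∈ fcuSp (fcuCen {i | i ∈ L}) (fcuRan j) ∧ U ∈ fcuSp (fcuCen {i | i ∈ L}) (fcuRan j) := by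
  induction L with
  | nil =>
    have : (1 : Matrix (Fin k ⊕ Fin k' → Fin N) (Fin k ⊕ Fin k' → Fin N) ℂ) ∈ fcuSp (fcuCen {i | i ∈ ([] : List (Fin k))}) (fcuRan j) :=
      fcuSp_one _ _ (fcuCen_one _) (fcuRan_one _)
    exact ⟨1, by simp, by simp [fcuT_one'], by simpa using this, this⟩
  | cons i L ih =>
    obtain ⟨hi, hL⟩ := List.nodup_cons.1 hL
    obtain ⟨U, e1, e2, m1, m2⟩ := ih hL
    have c1 : ∀ A ∈ fcuRan (N := N) i, ∀ A' ∈ fcuCen (N := N) {i | i ∈ L}, A * A' = A' * A := by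
      rintro _ ⟨a, rfl⟩ A' hA'
      exact hA' i hi a
    have s1 : ({i} : Set (Fin k)) ⊆ {l | l ∈ i :: L} := by
      rintro _ rfl; simp
    have s2 : {l | l ∈ L} ⊆ {l | l ∈ i :: L} := fun l hl => List.mem_cons_of_mem _ hl
    refine ⟨U * fcuAc i j (Q i), ?_, ?_, ?_, ?_⟩
    · rw [List.map_cons, List.prod_cons]
      calc _ = fcuAc i j (R' i) * ((L.map fun i => fcuAc i j (R' i)).prod * U) * fcuAc i j (Q i) := by
            simp only [Matrix.mul_assoc]
        _ = 1 := by rw [e1, Matrix.mul_one, fcuAc_mul, h1, fcuAc_one]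
    · rw [List.map_cons, List.prod_cons, fcuT_mul_A _ _ _ _ c1 _ _ (fcuAc_mem i j (R i)) m1,
        fcuT_mul_A _ _ _ _ (fun A hA A' hA' => (c1 A' hA' A hA).symm) _ _ m2 (fcuAc_mem i j (Q i))]
      calc _ = ptFirst (fcuAc i j (R i)) * (ptFirst (L.map fun i => fcuAc i j (R i)).prod * ptFirst U) * ptFirst (fcuAc i j (Q i)) := by
            simp only [Matrix.mul_assoc]
        _ = 1 := by rw [e2, Matrix.mul_one, fcuAc_T, fcuAc_T, fcuAc_mul, h2, fcuAc_one]
    · rw [List.map_cons, List.prod_cons]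
      exact fcuSp_mul _ _ _ _ _ _ (fun A hA A' hA' => fcuCen_mul _ _ _ s1 s2 A A' (fcuRan_cen i A hA) hA')
        (fun B hB B' hB' => fcuRan_mul j B B' hB hB') _ _ (fcuAc_mem i j (R i)) m1
    · exact fcuSp_mul _ _ _ _ _ _ (fun A hA A' hA' => fcuCen_mul _ _ _ s2 s1 A A' hA (fcuRan_cen i A' hA'))
        (fun B hB B' hB' => fcuRan_mul j B B' hB hB') _ _ m2 (fcuAc_mem i j (Q i))

theorem fcu_outer (V V' U : Fin k' → Matrix (Fin k ⊕ Fin k' → Fin N) (Fin k ⊕ Fin k' → Fin N) ℂ)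
    (h1 : ∀ j, V' j * U j = 1) (h2 : ∀ j, ptFirst (V j) * ptFirst (U j) = 1)
    (h3 : ∀ j, V j ∈ fcuSp Set.univ (fcuRan j)) (h4 : ∀ j, U j ∈ fcuSp Set.univ (fcuRan j)) (L : List (Fin k')) (hL : L.Nodup) :
    ∃ W, (L.map V').prod * W = 1 ∧ ptFirst (L.map V).prod * ptFirst W = 1 ∧
      (L.map V).prod ∈ fcuSp Set.univ (fcuCen {i | i ∈ L}) ∧ W ∈ fcuSp Set.univ (fcuCen {i | i ∈ L}) := by
  induction L with
  | nil =>
    have : (1 : Matrix (Fin k ⊕ Fin k' → Fin N) (Fin k ⊕ Fin k' → Fin N) ℂ) ∈ fcuSp Set.univ (fcuCen {i | i ∈ ([] : List (Fin k'))}) :=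
      fcuSp_one _ _ (Set.mem_univ _) (fcuCen_one _)
    exact ⟨1, by simp, by simp [fcuT_one'], by simpa using this, this⟩
  | cons i L ih =>
    obtain ⟨hi, hL⟩ := List.nodup_cons.1 hL
    obtain ⟨W, e1, e2, m1, m2⟩ := ih hL
    have c1 : ∀ A ∈ fcuRan (N := N) i, ∀ A' ∈ fcuCen (N := N) {i | i ∈ L}, A * A' = A' * A := by
      rintro _ ⟨a, rfl⟩ A' hA'
      exact hA' i hi a
    have s1 : ({i} : Set (Fin k')) ⊆ {l | l ∈ i :: L} := by
      rintro _ rfl; simp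
    have s2 : {l | l ∈ L} ⊆ {l | l ∈ i :: L} := fun l hl => List.mem_cons_of_mem _ hl
    refine ⟨W * U i, ?_, ?_, ?_, ?_⟩
    · rw [List.map_cons, List.prod_cons]
      calc _ = V' i * ((L.map V').prod * W) * U i := by
            simp only [Matrix.mul_assoc]
        _ = 1 := by rw [e1, Matrix.mul_one, h1]
    · rw [List.map_cons, List.prod_cons, fcuT_mul_B _ _ _ _ c1 _ _ (h3 i) m1,
        fcuT_mul_B _ _ _ _ (fun A hA A' hA' => (c1 A' hA' A hA).symm) _ _ m2 (h4 i)]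
      calc _ = ptFirst (L.map V).prod * (ptFirst (V i) * ptFirst (U i)) * ptFirst W := by
            simp only [Matrix.mul_assoc]
        _ = 1 := by rw [h2, Matrix.mul_one, e2]
    · rw [List.map_cons, List.prod_cons]
      exact fcuSp_mul _ _ _ _ _ _ (fun _ _ _ _ => Set.mem_univ _)
        (fun A hA A' hA' => fcuCen_mul _ _ _ s1 s2 A A' (fcuRan_cen i A hA) hA') _ _ (h3 i) m1
    · exact fcuSp_mul _ _ _ _ _ _ (fun _ _ _ _ => Set.mem_univ _)
        (fun A hA A' hA' => fcuCen_mul _ _ _ s2 s1 A A' hA (fcuRan_cen i A' hA')) _ _ m2 (h4 i)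

theorem fcu_assemble (R R' Q : Fin k → Fin k' → Matrix (Fin N × Fin N) (Fin N × Fin N) ℂ)
    (h1 : ∀ i j, R' i j * Q i j = 1) (h2 : ∀ i j, fcuP (R i j) * fcuP (Q i j) = 1) :
    ∃ W, (List.ofFn fun jj : Fin k' => (List.ofFn fun ii : Fin k => act2 (Sum.inl ii.rev) (Sum.inr jj) (R' ii.rev jj)).prod).prod * W = 1 ∧
      ptFirst (List.ofFn fun jj : Fin k' => (List.ofFn fun ii : Fin k => act2 (Sum.inl ii.rev) (Sum.inr jj) (R ii.rev jj)).prod).prod * ptFirst W = 1 := by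
  have hnd : ((List.finRange k).map Fin.rev).Nodup := (List.nodup_finRange k).map Fin.rev_injective
  choose U u1 u2 u3 u4 using fun j => fcu_inner j (fun i => R i j) (fun i => R' i j) (fun i => Q i j) (fun i => h1 i j) (fun i => h2 i j) _ hnd
  obtain ⟨W, w1, w2, -, -⟩ := fcu_outer (N := N) (k := k) _ _ U u1 u2
    (fun j => fcuSp_mono _ _ _ _ (Set.subset_univ _) subset_rfl (u3 j))
    (fun j => fcuSp_mono _ _ _ _ (Set.subset_univ _) subset_rfl (u4 j)) _ (List.nodup_finRange k')
  refine ⟨W, ?_, ?_⟩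
  · simp only [List.ofFn_eq_map]
    simpa only [List.map_map, Function.comp_def, fcuAc] using w1
  · simp only [List.ofFn_eq_map]
    simpa only [List.map_map, Function.comp_def, fcuAc] using w2

theorem fcu_SR_ne (R : Fin k → Fin k' → Matrix (Fin N × Fin N) (Fin N × Fin N) ℂ)
    (h : (List.ofFn fun jj : Fin k' => (List.ofFn fun ii : Fin k => act2 (Sum.inl ii.rev) (Sum.inr jj) (R ii.rev jj)).prod).prod ≠ 0)
    (i : Fin k) (j : Fin k') : R i j ≠ 0 := by
  intro h0
  apply h
  apply List.prod_eq_zero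
  rw [List.mem_ofFn]
  refine ⟨j, ?_⟩
  apply List.prod_eq_zero
  rw [List.mem_ofFn]
  refine ⟨i.rev, ?_⟩
  rw [Fin.rev_rev, h0]
  exact fcuAc_zero i j

end

/-- Crossing-unitarity for the fused R-matrix:
`(𝒮ℛ(z)^T)⁻¹ = (𝒮ℛ(q^N z)⁻¹)^T`, with `q^N z = eπ (ξ + N ζ)`. -/
theorem fused_crossing_unitarity (N k k' : ℕ) (hN : 2 ≤ N)
    (hk : 1 ≤ k) (hkN : k ≤ N) (hk' : 1 ≤ k') (hk'N : k' ≤ N)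
    (ξ ζ τ : ℂ) (hτ : 0 < τ.im) (hζ : 0 < ζ.im)
    (hgen : ∀ (ii : Fin k) (jj : Fin k'),
      Rgeneric N (ξ + ((((ii : ℕ) : ℂ) + 1) - (((jj : ℕ) : ℂ) + 1) -
        ((k : ℂ) - (k' : ℂ)) / 2) * ζ) ζ τ ∧
      Rgeneric N (ξ + N * ζ + ((((ii : ℕ) : ℂ) + 1) - (((jj : ℕ) : ℂ) + 1) -
        ((k : ℂ) - (k' : ℂ)) / 2) * ζ) ζ τ)
    (hinv1 : IsUnit (ptFirst (SRmat N k k' ξ ζ τ)))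
    (hinv2 : IsUnit (SRmat N k k' (ξ + N * ζ) ζ τ)) :
    (ptFirst (SRmat N k k' ξ ζ τ))⁻¹ = ptFirst ((SRmat N k k' (ξ + N * ζ) ζ τ)⁻¹) := by
  have hN0 : N ≠ 0 := by omega
  haveI : NeZero N := ⟨hN0⟩
  have n1 : SRmat N k k' ξ ζ τ ≠ 0 := by
    intro h
    rw [h, fcuT_z] at hinv1
    exact hinv1.ne_zero rfl
  have n2 : SRmat N k k' (ξ + N * ζ) ζ τ ≠ 0 := hinv2.ne_zero
  have a1 := fcu_SR_ne (fun (ii : Fin k) (jj : Fin k') => Rhat N (ξ + ((((ii : ℕ) : ℂ) + 1) - (((jj : ℕ) : ℂ) + 1) -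
        ((k : ℂ) - (k' : ℂ)) / 2) * ζ) ζ τ) n1
  have a2 := fcu_SR_ne (fun (ii : Fin k) (jj : Fin k') => Rhat N (ξ + N * ζ + ((((ii : ℕ) : ℂ) + 1) - (((jj : ℕ) : ℂ) + 1) -
        ((k : ℂ) - (k' : ℂ)) / 2) * ζ) ζ τ) n2
  have key : ∀ (ii : Fin k) (jj : Fin k'), ∃ Q : Matrix (Fin N × Fin N) (Fin N × Fin N) ℂ,
      Rhat N (ξ + N * ζ + ((((ii : ℕ) : ℂ) + 1) - (((jj : ℕ) : ℂ) + 1) - ((k : ℂ) - (k' : ℂ)) / 2) * ζ) ζ τ * Q = 1 ∧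
      fcuP (Rhat N (ξ + ((((ii : ℕ) : ℂ) + 1) - (((jj : ℕ) : ℂ) + 1) - ((k : ℂ) - (k' : ℂ)) / 2) * ζ) ζ τ) * fcuP Q = 1 := by
    intro ii jj
    obtain ⟨g1, g2⟩ := hgen ii jj
    have b1 := a1 ii jj
    have b2 := a2 ii jj
    rw [add_right_comm ξ] at g2 b2 ⊢
    exact fcu_single N hN0 _ ζ τ hτ hζ g1 g2 b1 b2
  choose Q q1 q2 using key
  obtain ⟨W, w1, w2⟩ := fcu_assemble _ _ Q q1 q2
  rw [Matrix.inv_eq_right_inv (A := SRmat N k k' (ξ + N * ζ) ζ τ) w1]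
  exact Matrix.inv_eq_right_inv w2

end
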